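/- There is an absolute constant C such that for every T > 0 and every solution u of the defocusing cubic NLS on [0,T] × ℝ³, ∫₀^T ∫_{ℝ³} |u(t,x)|⁴ dx dt ≤ C · sup_{t ∈ [0,T]} ‖u(t,·)‖_{Ḣ^{1/2}(ℝ³)}² · ‖u(0,·)‖_{L²(ℝ³)}². -/

import Mathlib

open MeasureTheory Real Complex
open scoped FourierTransform ENNReal ContDiff

noncomputable section

/-- The `j`-th partial derivative of a function on `EuclideanSpace ℝ (Fin n)`. -/
def pd {n : ℕ} {F : Type*} [NormedAddCommGroup F] [NormedSpace ℝ F]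
    (j : Fin n) (f : EuclideanSpace ℝ (Fin n) → F) (x : EuclideanSpace ℝ (Fin n)) : F :=
  fderiv ℝ f x (EuclideanSpace.single j 1)

/-- The Laplacian. -/
def lap {n : ℕ} {F : Type*} [NormedAddCommGroup F] [NormedSpace ℝ F]
    (f : EuclideanSpace ℝ (Fin n) → F) (x : EuclideanSpace ℝ (Fin n)) : F :=
  ∑ j, pd j (pd j f) x

/-- `f` coincides with a (complex-valued) Schwartz function. -/
def IsSchwartz {n : ℕ} (f : EuclideanSpace ℝ (Fin n) → ℂ) : Prop :=
  ∃ g : SchwartzMap (EuclideanSpace ℝ (Fin n)) ℂ, ⇑g = f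

/-- `f` coincides with a (real-valued) Schwartz function. -/
def IsSchwartzR {n : ℕ} (f : EuclideanSpace ℝ (Fin n) → ℝ) : Prop :=
  ∃ g : SchwartzMap (EuclideanSpace ℝ (Fin n)) ℝ, ⇑g = f

/-- A (smooth, spatially Schwartz) solution of the defocusing cubic NLS
`i ∂ₜ u + Δ u = |u|² u` on `[0,T] × ℝⁿ`. -/
def IsNLSSolution (n : ℕ) (T : ℝ) (u : ℝ → EuclideanSpace ℝ (Fin n) → ℂ) : Prop :=
  ContDiff ℝ ∞ (Function.uncurry u) ∧
  (∀ t ∈ Set.Icc (0:ℝ) T, IsSchwartz (u t)) ∧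
  (∀ t ∈ Set.Icc (0:ℝ) T, ∀ x, Complex.I * deriv (fun s => u s x) t + lap (u t) x
      = (‖u t x‖ : ℂ)^2 * u t x)

/-- Inhomogeneous Sobolev norm via the Fourier transform. -/
def HsNorm {n : ℕ} (σ : ℝ) (f : EuclideanSpace ℝ (Fin n) → ℂ) : ℝ :=
  (∫ ξ, (1 + ‖ξ‖) ^ (2 * σ) * ‖𝓕 f ξ‖ ^ 2) ^ ((1:ℝ)/2)

/-- Homogeneous Sobolev norm via the Fourier transform. -/
def HdotNorm {n : ℕ} (σ : ℝ) (f : EuclideanSpace ℝ (Fin n) → ℂ) : ℝ :=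
  (∫ ξ, ‖ξ‖ ^ (2 * σ) * ‖𝓕 f ξ‖ ^ 2) ^ ((1:ℝ)/2)

/-- The Fourier multiplier operator with (real) symbol `m`. -/
def fourierMult {n : ℕ} (m : EuclideanSpace ℝ (Fin n) → ℝ) (f : EuclideanSpace ℝ (Fin n) → ℂ) :
    EuclideanSpace ℝ (Fin n) → ℂ :=
  𝓕⁻ (fun ξ => (m ξ : ℂ) * 𝓕 f ξ)

/-- The standing hypotheses on the radial profile `φ` of the symbol of the smoothing
operator `I = I_N`, with derivative-bound constants `Ck` (independent of `N`). -/
structure IMultiplier (s N : ℝ) (Ck : ℕ → ℝ) (φ : ℝ → ℝ) : Prop where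
  contDiff : ContDiffOn ℝ ∞ φ (Set.Ioi 0)
  pos : ∀ r > (0:ℝ), 0 < φ r
  le_one : ∀ r > (0:ℝ), φ r ≤ 1
  anti : AntitoneOn φ (Set.Ioi 0)
  eq_one : ∀ r : ℝ, 0 < r → r ≤ N → φ r = 1
  eq_pow : ∀ r : ℝ, 2 * N ≤ r → φ r = (r / N) ^ (s - 1)
  mono_mul : MonotoneOn (fun r => r * φ r) (Set.Ioi 0)
  deriv_bound : ∀ k : ℕ, 1 ≤ k → ∀ r > (0:ℝ), |iteratedDeriv k φ r| ≤ Ck k * φ r * r ^ (-(k:ℝ))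

/-- The smoothing operator `I = I_N`, a Fourier multiplier with symbol `φ (|ξ|)`. -/
def Iop {n : ℕ} (φ : ℝ → ℝ) (f : EuclideanSpace ℝ (Fin n) → ℂ) : EuclideanSpace ℝ (Fin n) → ℂ :=
  fourierMult (fun ξ => φ ‖ξ‖) f

/-- The operator `⟨D⟩ I_N`, a Fourier multiplier with symbol `(1 + |ξ|) φ (|ξ|)`. -/
def DIop {n : ℕ} (φ : ℝ → ℝ) (f : EuclideanSpace ℝ (Fin n) → ℂ) : EuclideanSpace ℝ (Fin n) → ℂ :=
  fourierMult (fun ξ => (1 + ‖ξ‖) * φ ‖ξ‖) f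

/-- Mixed space-time norm `‖v‖_{L^q_{[0,T]} L^r_x}` (with values in `ℝ≥0∞`). -/
def mixNorm {α : Type*} [MeasureSpace α] {F : Type*} [NormedAddCommGroup F]
    (T : ℝ) (q r : ℝ≥0∞) (v : ℝ → α → F) : ℝ≥0∞ :=
  eLpNorm (fun t => (eLpNorm (v t) r volume).toReal) q (volume.restrict (Set.Ioc 0 T))

/-- An admissible pair in `ℝ²`: `1/q + 1/r = 1/2` and `2 < q ≤ ∞`. -/
def Admissible (q r : ℝ≥0∞) : Prop := 1/q + 1/r = 1/2 ∧ 2 < q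

/-- The `L²` norm. -/
def L2Norm {n : ℕ} (f : EuclideanSpace ℝ (Fin n) → ℂ) : ℝ :=
  (∫ x, ‖f x‖ ^ 2) ^ ((1:ℝ)/2)

/-- The `L²` norm of the (spatial) gradient. -/
def gradL2Norm {n : ℕ} (f : EuclideanSpace ℝ (Fin n) → ℂ) : ℝ :=
  (∫ x, ∑ j, ‖pd j f x‖ ^ 2) ^ ((1:ℝ)/2)

/-- Space-time `L⁴_{[0,T]} L⁴_x` norm (real-valued). -/
def L4L4Norm {n : ℕ} (T : ℝ) (v : ℝ → EuclideanSpace ℝ (Fin n) → ℂ) : ℝ :=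
  (∫ t in Set.Ioc (0:ℝ) T, ∫ x, ‖v t x‖ ^ 4) ^ ((1:ℝ)/4)

/-- The modified energy `E(v) = ½∫|∇v|² + ¼∫|v|⁴`. -/
def energy {n : ℕ} (v : EuclideanSpace ℝ (Fin n) → ℂ) : ℝ :=
  (1/2) * (∫ x, ∑ j, ‖pd j v x‖ ^ 2) + (1/4) * ∫ x, ‖v x‖ ^ 4

/-- The Morawetz action `M_a(t) = 2 ∫ ∇a · Im (ū ∇u) dx`. -/
def morAction {n : ℕ} (a : EuclideanSpace ℝ (Fin n) → ℝ)
    (u : ℝ → EuclideanSpace ℝ (Fin n) → ℂ) (t : ℝ) : ℝ :=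
  2 * ∫ x, ∑ j, pd j a x * ((starRingEnd ℂ) (u t x) * pd j (u t) x).im

/-- All derivatives of `a` grow at most polynomially. -/
def PolyGrowth {n : ℕ} (a : EuclideanSpace ℝ (Fin n) → ℝ) : Prop :=
  ∀ k : ℕ, ∃ C d : ℝ, ∀ x, ‖iteratedFDeriv ℝ k a x‖ ≤ C * (1 + ‖x‖) ^ d

/-- Three-dimensional Euclidean space. -/
local notation "E3" => EuclideanSpace ℝ (Fin 3)

/-- Complex-valued Schwartz functions on three-dimensional space. -/
local notation "S3" => SchwartzMap (EuclideanSpace ℝ (Fin 3)) ℂ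

open Filter Topology Set in
/-- Differentiation under the integral sign for a continuous family weighted by a
compactly supported function. -/
theorem hasDerivAt_integral_smul_of_hasCompactSupport
    {E : Type*} [NormedAddCommGroup E] [NormedSpace ℝ E] [FiniteDimensional ℝ E]
    [MeasurableSpace E] [BorelSpace E] (μ : Measure E) [IsLocallyFiniteMeasure μ]
    {F : Type*} [NormedAddCommGroup F] [NormedSpace ℝ F]
    {χ : E → ℝ} (hχ : Continuous χ) (hχc : HasCompactSupport χ)
    {q q' : ℝ → E → F} (hq : Continuous (Function.uncurry q))
    (hq' : Continuous (Function.uncurry q'))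
    (hd : ∀ t x, HasDerivAt (fun s => q s x) (q' t x) t) :
    (∀ t, HasDerivAt (fun s => ∫ x, χ x • q s x ∂μ) (∫ x, χ x • q' t x ∂μ) t) ∧
    Continuous (fun t => ∫ x, χ x • q' t x ∂μ) := by
  have hcq : ∀ t, Continuous (q t) := fun t => hq.comp (by fun_prop : Continuous fun x => (t, x))
  have hcq' : ∀ t, Continuous (q' t) := fun t => hq'.comp (by fun_prop : Continuous fun x => (t, x))
  have hrestr : ∀ f : E → F, ∫ x, χ x • f x ∂μ = ∫ x in tsupport χ, χ x • f x ∂μ := by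
    intro f
    symm
    apply setIntegral_eq_integral_of_forall_compl_eq_zero
    intro x hx
    simp [image_eq_zero_of_notMem_tsupport hx]
  have h_int : ∀ f : E → F, Continuous f → Integrable (fun x => χ x • f x) μ := fun f hf =>
    Continuous.integrable_of_hasCompactSupport (hχ.smul hf) hχc.smul_right
  constructor
  · intro t
    have hJ : Continuous (fun p : ℝ × E => χ p.2 • q' p.1 p.2) :=
      (hχ.comp continuous_snd).smul hq'
    obtain ⟨C, hC⟩ := ((isCompact_Icc (a := t - 1) (b := t + 1)).prod
      hχc.isCompact).exists_bound_of_continuousOn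
      hJ.continuousOn
    simp only [hrestr (q' t), fun s => hrestr (q s)]
    refine (hasDerivAt_integral_of_dominated_loc_of_deriv_le
      (𝕜 := ℝ) (F := fun s x => χ x • q s x) (F' := fun s x => χ x • q' s x)
      (μ := μ.restrict (tsupport χ)) (s := Icc (t - 1) (t + 1)) (bound := fun _ => C)
      (Icc_mem_nhds (by linarith) (by linarith)) ?_ ?_ ?_ ?_ ?_ ?_).2
    · exact Eventually.of_forall fun s => (h_int _ (hcq s)).restrict.aestronglyMeasurable
    · exact (h_int _ (hcq t)).restrict
    · exact (h_int _ (hcq' t)).restrict.aestronglyMeasurable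
    · refine (ae_restrict_iff' hχc.measurableSet).2 (Eventually.of_forall fun x hx s hs => ?_)
      exact hC (s, x) ⟨hs, hx⟩
    · exact integrableOn_const hχc.measure_lt_top.ne
    · exact Eventually.of_forall fun x s _ => (hd s x).const_smul (χ x)
  · simp only [hrestr]
    exact continuous_parametric_integral_of_continuous
      (f := fun t x => χ x • q' t x) ((hχ.comp continuous_snd).smul hq') hχc

open Filter Topology Set in
/-- The integrated form of a local conservation law `∂ₜ q = ∑ⱼ ∂ⱼ Vⱼ + r`, whose fluxes grow
slower than the radius on balls. -/
theorem integral_sub_integral_of_conservation_law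
    {E : Type*} [NormedAddCommGroup E] [NormedSpace ℝ E] [FiniteDimensional ℝ E]
    [MeasurableSpace E] [BorelSpace E] (μ : Measure E) [μ.IsAddHaarMeasure]
    {F : Type*} [NormedAddCommGroup F] [NormedSpace ℝ F]
    {ι : Type*} [Fintype ι] (v : ι → E)
    {q q' r : ℝ → E → F} {V V' : ι → ℝ → E → F} {c d K : ℝ}
    (hq : Continuous (Function.uncurry q)) (hq' : Continuous (Function.uncurry q'))
    (hd : ∀ t x, HasDerivAt (fun s => q s x) (q' t x) t)
    (hV : ∀ j, ∀ t ∈ uIcc c d, Continuous (V j t))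
    (hV' : ∀ j, ∀ t ∈ uIcc c d, Continuous (V' j t))
    (hVd : ∀ j, ∀ t ∈ uIcc c d, ∀ x, HasLineDerivAt ℝ (V j t) (V' j t x) x (v j))
    (hid : ∀ t ∈ uIcc c d, ∀ x, q' t x = ∑ j, V' j t x + r t x)
    (hqc : Integrable (q c) μ) (hqd : Integrable (q d) μ)
    (hri : ∀ t ∈ uIcc c d, Integrable (r t) μ)
    (hrK : ∀ t ∈ uIcc c d, ∫ x, ‖r t x‖ ∂μ ≤ K)
    (hVK : ∀ j, ∀ t ∈ uIcc c d, ∀ R : ℝ, 1 ≤ R →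
      ∫ x in Metric.ball 0 (2 * R), ‖V j t x‖ ∂μ ≤ K * R ^ (3/4 : ℝ)) :
    ∫ x, q d x ∂μ - ∫ x, q c x ∂μ = ∫ t in c..d, ∫ x, r t x ∂μ := by
  by_cases hF : CompleteSpace F
  swap
  · simp [integral, hF, intervalIntegral]
  let φ : ContDiffBump (0 : E) := ⟨1, 2, by norm_num, by norm_num⟩
  have hφs : ContDiff ℝ 1 φ := φ.contDiff
  have hφd : Differentiable ℝ φ := hφs.differentiable (by norm_num)
  have hφc : Continuous (fderiv ℝ φ) := hφs.continuous_fderiv (by norm_num)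
  obtain ⟨C, hC⟩ : ∃ C, ∀ x, ‖fderiv ℝ φ x‖ ≤ C :=
    hφc.bounded_above_of_compact_support (φ.hasCompactSupport.fderiv (𝕜 := ℝ))
  have hC0 : 0 ≤ C := (norm_nonneg _).trans (hC 0)
  have hK0 : 0 ≤ K := by
    refine le_trans ?_ (hrK c left_mem_uIcc)
    positivity
  let χ : ℝ → E → ℝ := fun R x => φ (R⁻¹ • x)
  have hχ : ∀ R, Continuous (χ R) := fun R => φ.continuous.comp (by fun_prop)
  have hχ1 : ∀ R x, |χ R x| ≤ 1 := fun R x => by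
    rw [abs_of_nonneg φ.nonneg]; exact φ.le_one
  have hχ0 : ∀ R : ℝ, 0 < R → ∀ x, x ∉ Metric.ball (0:E) (2 * R) → χ R x = 0 := by
    intro R hR x hx
    apply φ.zero_of_le_dist
    simp only [Metric.mem_ball, dist_zero_right, not_lt] at hx
    simp only [dist_zero_right, norm_smul, norm_inv, Real.norm_eq_abs, abs_of_pos hR, φ]
    rw [inv_mul_eq_div, le_div_iff₀ hR]
    exact hx
  have hχc : ∀ R : ℝ, 0 < R → HasCompactSupport (χ R) := fun R hR =>
    HasCompactSupport.intro (isCompact_closedBall (0:E) (2 * R)) fun x hx =>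
      hχ0 R hR x fun h => hx (Metric.ball_subset_closedBall h)
  have hχd : ∀ (R : ℝ) j x, HasLineDerivAt ℝ (χ R) (R⁻¹ * fderiv ℝ φ (R⁻¹ • x) (v j)) x (v j) := by
    intro R j x
    have h1 : HasFDerivAt (fun y : E => R⁻¹ • y) (R⁻¹ • ContinuousLinearMap.id ℝ E) x :=
      (hasFDerivAt_id x).const_smul R⁻¹
    have h2 := ((hφd (R⁻¹ • x)).hasFDerivAt.comp x h1).hasLineDerivAt (v j)
    have h3 : (R⁻¹ * fderiv ℝ φ (R⁻¹ • x) (v j))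
        = ((fderiv ℝ φ (R⁻¹ • x)).comp (R⁻¹ • ContinuousLinearMap.id ℝ E)) (v j) := by simp
    rw [h3]
    exact h2
  have hχlim : ∀ x, Tendsto (fun R => χ R x) atTop (𝓝 1) := by
    intro x
    have h1 : Tendsto (fun R : ℝ => R⁻¹ • x) atTop (𝓝 0) := by
      simpa using (tendsto_inv_atTop_zero (𝕜 := ℝ)).smul_const x
    have h2 := (φ.continuous.tendsto 0).comp h1
    have h3 : φ 0 = 1 := φ.one_of_mem_closedBall (by simp [φ])
    rwa [h3] at h2
  have hlim : ∀ f : E → F, Integrable f μ →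
      Tendsto (fun R => ∫ x, χ R x • f x ∂μ) atTop (𝓝 (∫ x, f x ∂μ)) := by
    intro f hf
    refine tendsto_integral_filter_of_dominated_convergence (fun x => ‖f x‖) ?_ ?_ hf.norm ?_
    · exact Eventually.of_forall fun R => (hχ R).aestronglyMeasurable.smul hf.aestronglyMeasurable
    · refine Eventually.of_forall fun R => Eventually.of_forall fun x => ?_
      rw [norm_smul]
      exact mul_le_of_le_one_left (norm_nonneg _) (hχ1 R x)
    · refine Eventually.of_forall fun x => ?_
      simpa using (hχlim x).smul_const (f x)
  let M : ℝ := ∑ j, C * ‖v j‖ * K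
  have hM0 : 0 ≤ M := Finset.sum_nonneg fun j _ => by positivity
  have key : ∀ t ∈ uIcc c d, ∀ R : ℝ, 1 ≤ R →
      ‖∫ x, χ R x • q' t x ∂μ - ∫ x, χ R x • r t x ∂μ‖ ≤ M * R ^ (-(1/4) : ℝ) := by
    intro t ht R hR
    have hR0 : 0 < R := by linarith
    have h_int : ∀ f : E → F, Continuous f → Integrable (fun x => χ R x • f x) μ := fun f hf =>
      ((hχ R).smul hf).integrable_of_hasCompactSupport (hχc R hR0).smul_right
    have hrint : Integrable (fun x => χ R x • r t x) μ :=
      (hri t ht).bdd_smul 1 (hχ R).aestronglyMeasurable (Eventually.of_forall (hχ1 R))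
    have e1 : ∫ x, χ R x • q' t x ∂μ - ∫ x, χ R x • r t x ∂μ = ∑ j, ∫ x, χ R x • V' j t x ∂μ := by
      rw [← integral_finsetSum _ fun j _ => h_int _ (hV' j t ht), sub_eq_iff_eq_add,
        ← integral_add (integrable_finsetSum _ fun j _ => h_int _ (hV' j t ht)) hrint]
      congr 1 with x
      rw [hid t ht x, smul_add, Finset.smul_sum]
    have hdc : ∀ j, Continuous fun x => R⁻¹ * fderiv ℝ φ (R⁻¹ • x) (v j) := by
      intro j
      have : Continuous fun x : E => fderiv ℝ φ (R⁻¹ • x) := hφc.comp (by fun_prop)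
      exact continuous_const.mul (this.clm_apply continuous_const)
    have hd0 : ∀ j x, x ∉ Metric.ball (0:E) (2 * R) → R⁻¹ * fderiv ℝ φ (R⁻¹ • x) (v j) = 0 := by
      intro j x hx
      have hnn : IsLocalMin φ (R⁻¹ • x) := by
        have : φ (R⁻¹ • x) = 0 := hχ0 R hR0 x hx
        exact Eventually.of_forall fun y => by rw [this]; exact φ.nonneg
      rw [hnn.fderiv_eq_zero]; simp
    have hdcs : ∀ j, HasCompactSupport fun x => R⁻¹ * fderiv ℝ φ (R⁻¹ • x) (v j) := fun j =>
      HasCompactSupport.intro (isCompact_closedBall (0:E) (2 * R)) fun x hx =>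
        hd0 j x fun h => hx (Metric.ball_subset_closedBall h)
    have e2 : ∀ j, ∫ x, χ R x • V' j t x ∂μ
        = - ∫ x, (R⁻¹ * fderiv ℝ φ (R⁻¹ • x) (v j)) • V j t x ∂μ := by
      intro j
      refine integral_bilinear_hasLineDerivAt_right_eq_neg_left_of_integrable
        (B := ContinuousLinearMap.lsmul ℝ ℝ) ?_ (h_int _ (hV' j t ht)) (h_int _ (hV j t ht))
        (fun x _ => hχd R j x) (fun x _ => hVd j t ht x)
      exact ((hdc j).smul (hV j t ht)).integrable_of_hasCompactSupport (hdcs j).smul_right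
    rw [e1]
    refine (norm_sum_le _ _).trans ?_
    rw [Finset.sum_mul]
    refine Finset.sum_le_sum fun j _ => ?_
    rw [e2, norm_neg]
    have e3 : ∫ x, (R⁻¹ * fderiv ℝ φ (R⁻¹ • x) (v j)) • V j t x ∂μ
        = ∫ x in Metric.ball 0 (2 * R), (R⁻¹ * fderiv ℝ φ (R⁻¹ • x) (v j)) • V j t x ∂μ := by
      symm
      apply setIntegral_eq_integral_of_forall_compl_eq_zero
      intro x hx
      rw [hd0 j x hx, zero_smul]
    rw [e3]
    have hVi : IntegrableOn (fun x => ‖V j t x‖) (Metric.ball 0 (2 * R)) μ :=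
      ((hV j t ht).norm.continuousOn.integrableOn_compact
        (isCompact_closedBall (0:E) (2 * R))).mono_set Metric.ball_subset_closedBall
    calc ‖∫ x in Metric.ball 0 (2 * R), (R⁻¹ * fderiv ℝ φ (R⁻¹ • x) (v j)) • V j t x ∂μ‖
        ≤ ∫ x in Metric.ball 0 (2 * R), (R⁻¹ * (C * ‖v j‖)) * ‖V j t x‖ ∂μ := by
          refine norm_integral_le_of_norm_le (hVi.const_mul _) (Eventually.of_forall fun x => ?_)
          rw [norm_smul, norm_mul, norm_inv, Real.norm_eq_abs R, abs_of_pos hR0]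
          gcongr
          exact (ContinuousLinearMap.le_opNorm _ _).trans (by gcongr; exact hC _)
      _ = (R⁻¹ * (C * ‖v j‖)) * ∫ x in Metric.ball 0 (2 * R), ‖V j t x‖ ∂μ :=
          integral_const_mul _ _
      _ ≤ (R⁻¹ * (C * ‖v j‖)) * (K * R ^ (3/4 : ℝ)) := by
          gcongr
          exact hVK j t ht R hR
      _ = C * ‖v j‖ * K * R ^ (-(1/4) : ℝ) := by
          have : R ^ (-(1/4) : ℝ) = R⁻¹ * R ^ (3/4 : ℝ) := by
            rw [← Real.rpow_neg_one, ← Real.rpow_add hR0]; norm_num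
          rw [this]; ring
  have hrpow1 : ∀ R : ℝ, 1 ≤ R → R ^ (-(1/4) : ℝ) ≤ 1 := fun R hR =>
    Real.rpow_le_one_of_one_le_of_nonpos hR (by norm_num)
  have hrχ : ∀ t ∈ uIcc c d, ∀ R, ‖∫ x, χ R x • r t x ∂μ‖ ≤ K := by
    intro t ht R
    refine (norm_integral_le_of_norm_le (hri t ht).norm (Eventually.of_forall fun x => ?_)).trans
      (hrK t ht)
    rw [norm_smul]
    exact mul_le_of_le_one_left (norm_nonneg _) (hχ1 R x)
  have hftc : ∀ᶠ R in atTop, ∫ t in c..d, ∫ x, χ R x • q' t x ∂μ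
      = ∫ x, χ R x • q d x ∂μ - ∫ x, χ R x • q c x ∂μ := by
    filter_upwards [eventually_ge_atTop 1] with R hR
    obtain ⟨h1, h2⟩ := hasDerivAt_integral_smul_of_hasCompactSupport μ (hχ R)
      (hχc R (by linarith)) hq hq' hd
    exact intervalIntegral.integral_eq_sub_of_hasDerivAt (fun t _ => h1 t)
      (h2.intervalIntegrable _ _)
  have hl1 : Tendsto (fun R => ∫ t in c..d, ∫ x, χ R x • q' t x ∂μ) atTop
      (𝓝 (∫ x, q d x ∂μ - ∫ x, q c x ∂μ)) :=
    (tendsto_congr' hftc).2 ((hlim _ hqd).sub (hlim _ hqc))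
  have hl2 : Tendsto (fun R => ∫ t in c..d, ∫ x, χ R x • q' t x ∂μ) atTop
      (𝓝 (∫ t in c..d, ∫ x, r t x ∂μ)) := by
    refine intervalIntegral.tendsto_integral_filter_of_dominated_convergence (fun _ => M + K) ?_ ?_
      (by simp) ?_
    · filter_upwards [eventually_ge_atTop 1] with R hR
      exact (hasDerivAt_integral_smul_of_hasCompactSupport μ (hχ R)
        (hχc R (by linarith)) hq hq' hd).2.aestronglyMeasurable
    · filter_upwards [eventually_ge_atTop 1] with R hR
      refine Eventually.of_forall fun t ht => ?_
      have ht' := uIoc_subset_uIcc ht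
      have h1 := key t ht' R hR
      have h2 := hrχ t ht' R
      have h3 : M * R ^ (-(1/4) : ℝ) ≤ M := mul_le_of_le_one_right hM0 (hrpow1 R hR)
      calc _ = ‖(∫ x, χ R x • q' t x ∂μ - ∫ x, χ R x • r t x ∂μ) + ∫ x, χ R x • r t x ∂μ‖ := by
            rw [sub_add_cancel]
        _ ≤ _ := (norm_add_le _ _).trans (by linarith)
    · refine Eventually.of_forall fun t ht => ?_
      have ht' := uIoc_subset_uIcc ht
      have h1 : Tendsto (fun R => ∫ x, χ R x • q' t x ∂μ - ∫ x, χ R x • r t x ∂μ) atTop (𝓝 0) := by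
        refine squeeze_zero_norm' (a := fun R : ℝ => M * R ^ (-(1/4) : ℝ)) ?_ ?_
        · filter_upwards [eventually_ge_atTop 1] with R hR using key t ht' R hR
        · simpa using (tendsto_rpow_neg_atTop (y := 1/4) (by norm_num)).const_mul M
      simpa using h1.add (hlim _ (hri t ht'))
  exact tendsto_nhds_unique hl1 hl2

/-- The symbol `exp (-c |ξ|²)`. -/
def gaussSymbol (c : ℂ) (ξ : E3) : ℂ := cexp (-c * ((‖ξ‖ ^ 2 : ℝ) : ℂ))

theorem norm_gaussSymbol (c : ℂ) (ξ : E3) : ‖gaussSymbol c ξ‖ = Real.exp (-c.re * ‖ξ‖ ^ 2) := by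
  rw [gaussSymbol, Complex.norm_exp, Complex.re_mul_ofReal, Complex.neg_re]

theorem norm_gaussSymbol_le {c : ℂ} (hc : 0 ≤ c.re) (ξ : E3) : ‖gaussSymbol c ξ‖ ≤ 1 := by
  rw [norm_gaussSymbol]
  exact Real.exp_le_one_iff.2 (by nlinarith [sq_nonneg ‖ξ‖])

theorem iteratedDeriv_cexp_real_mul (c : ℂ) (n : ℕ) :
    iteratedDeriv n (fun t : ℝ => cexp (c * t)) = fun t : ℝ => c ^ n * cexp (c * t) := by
  induction n with
  | zero => simp
  | succ n ih =>
    rw [iteratedDeriv_succ, ih]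
    ext t
    have h1 : HasDerivAt (fun t : ℝ => cexp (c * t)) (cexp (c * t) * (c * 1)) t :=
      ((Complex.ofRealCLM.hasDerivAt (x := t)).const_mul c).cexp
    rw [(h1.const_mul (c ^ n)).deriv]
    ring

theorem hasTemperateGrowth_gaussSymbol {c : ℂ} (hc : 0 ≤ c.re) :
    (gaussSymbol c).HasTemperateGrowth := by
  have hs : ContDiff ℝ ∞ (fun t : ℝ => cexp (-c * t)) :=
    (contDiff_const.mul Complex.ofRealCLM.contDiff).cexp
  refine Function.HasTemperateGrowth.comp' (g := fun t : ℝ => cexp (-c * t))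
    (f := fun ξ : E3 => ‖ξ‖ ^ 2) (t := Set.Ici 0) ?_ (uniqueDiffOn_Ici 0) hs.contDiffOn ?_
    (Function.hasTemperateGrowth_norm_sq E3)
  · rintro - ⟨ξ, rfl⟩
    exact sq_nonneg ‖ξ‖
  · intro N
    refine ⟨0, (1 + ‖c‖) ^ N, by positivity, fun n hn t ht => ?_⟩
    rw [iteratedFDerivWithin_eq_iteratedFDeriv (uniqueDiffOn_Ici 0)
      (hs.contDiffAt.of_le (by exact_mod_cast le_top)) ht,
      norm_iteratedFDeriv_eq_norm_iteratedDeriv,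
      iteratedDeriv_cexp_real_mul, norm_mul, norm_pow, norm_neg, Complex.norm_exp]
    have h1 : Real.exp ((-c * t).re) ≤ 1 := by
      refine Real.exp_le_one_iff.2 ?_
      have : 0 ≤ c.re * t := mul_nonneg hc ht
      simpa using this
    calc ‖c‖ ^ n * Real.exp ((-c * t).re) ≤ (1 + ‖c‖) ^ n * 1 := by gcongr; linarith [norm_nonneg c]
      _ ≤ (1 + ‖c‖) ^ N * (1 + ‖t‖) ^ 0 := by
        simp only [mul_one, pow_zero]
        exact pow_le_pow_right₀ (by linarith [norm_nonneg c]) hn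

/-- The operator with Fourier symbol `exp (-c |ξ|²)`, which is the Schrödinger or the heat flow
according to the value of `c`. -/
def gaussFlow (c : ℂ) (ψ : S3) : S3 := SchwartzMap.fourierMultiplierCLM ℂ (gaussSymbol c) ψ

theorem fourier_gaussFlow {c : ℂ} (hc : 0 ≤ c.re) (ψ : S3) (ξ : E3) :
    𝓕 (gaussFlow c ψ) ξ = gaussSymbol c ξ * 𝓕 ψ ξ := by
  rw [gaussFlow, SchwartzMap.fourierMultiplierCLM_apply, FourierTransform.fourier_fourierInv_eq,
    SchwartzMap.smulLeftCLM_apply_apply (hasTemperateGrowth_gaussSymbol hc), smul_eq_mul]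

theorem gaussFlow_apply {c : ℂ} (hc : 0 ≤ c.re) (ψ : S3) (x : E3) :
    gaussFlow c ψ x = ∫ ξ, Real.fourierChar (inner ℝ ξ x) • (gaussSymbol c ξ * 𝓕 ψ ξ) := by
  rw [gaussFlow, SchwartzMap.fourierMultiplierCLM_apply, SchwartzMap.fourierInv_coe,
    Real.fourierInv_eq]
  simp [SchwartzMap.smulLeftCLM_apply_apply (hasTemperateGrowth_gaussSymbol hc)]

theorem gaussFlow_zero (ψ : S3) : gaussFlow 0 ψ = ψ := by
  have : gaussSymbol 0 = fun _ => (1 : ℂ) := by ext; simp [gaussSymbol]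
  rw [gaussFlow, this, SchwartzMap.fourierMultiplierCLM_const]
  simp

open LineDeriv

theorem fourier_lineDeriv (m : E3) (ψ : S3) (ξ : E3) :
    𝓕 (∂_{m} ψ) ξ = 2 * π * I * (inner ℝ ξ m : ℝ) * 𝓕 ψ ξ := by
  rw [SchwartzMap.fourier_lineDerivOp_eq]
  have h : (inner ℝ · m : E3 → ℝ).HasTemperateGrowth := by fun_prop
  simp [SchwartzMap.smulLeftCLM_apply_apply h, mul_assoc]

theorem gaussFlow_lineDeriv {c : ℂ} (hc : 0 ≤ c.re) (m : E3) (ψ : S3) :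
    gaussFlow c (∂_{m} ψ) = ∂_{m} (gaussFlow c ψ) := by
  apply (FourierTransform.fourierCLE ℂ S3).injective
  ext ξ
  change 𝓕 (gaussFlow c (∂_{m} ψ)) ξ = 𝓕 (∂_{m} (gaussFlow c ψ)) ξ
  rw [fourier_gaussFlow hc, fourier_lineDeriv, fourier_lineDeriv, fourier_gaussFlow hc]
  ring

/-- The Laplacian on Schwartz functions. -/
def lapS (ψ : S3) : S3 := ∑ j : Fin 3, ∂_{EuclideanSpace.single j (1 : ℝ)}
  (∂_{EuclideanSpace.single j (1 : ℝ)} ψ)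

theorem fourier_lapS (ψ : S3) (ξ : E3) :
    𝓕 (lapS ψ) ξ = -(4 * π ^ 2) * ((‖ξ‖ ^ 2 : ℝ) : ℂ) * 𝓕 ψ ξ := by
  have h1 : 𝓕 (lapS ψ) = ∑ j : Fin 3, 𝓕 (∂_{EuclideanSpace.single j (1 : ℝ)}
      (∂_{EuclideanSpace.single j (1 : ℝ)} ψ)) :=
    map_sum (FourierTransform.fourierCLE ℂ S3) _ _
  rw [h1, sum_apply]
  simp only [fourier_lineDeriv]
  rw [EuclideanSpace.real_norm_sq_eq]
  push_cast
  rw [Finset.mul_sum, Finset.sum_mul]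
  refine Finset.sum_congr rfl fun j _ => ?_
  simp only [EuclideanSpace.inner_single_right, conj_trivial, one_mul]
  linear_combination (4 * π ^ 2 * (ξ j : ℂ) ^ 2 * 𝓕 ψ ξ) * Complex.I_sq

theorem lapS_gaussFlow {c : ℂ} (hc : 0 ≤ c.re) (ψ : S3) :
    gaussFlow c (lapS ψ) = lapS (gaussFlow c ψ) := by
  apply (FourierTransform.fourierCLE ℂ S3).injective
  ext ξ
  change 𝓕 (gaussFlow c (lapS ψ)) ξ = 𝓕 (lapS (gaussFlow c ψ)) ξ
  rw [fourier_gaussFlow hc, fourier_lapS, fourier_lapS, fourier_gaussFlow hc]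
  ring

theorem continuous_gaussFlow {X : Type*} [TopologicalSpace X] [FirstCountableTopology X]
    {θ : X → ℂ} {γ : X → E3} (hθ : Continuous θ) (hγ : Continuous γ)
    (hre : ∀ s, 0 ≤ (θ s).re) (ψ : S3) :
    Continuous fun p => gaussFlow (θ p) ψ (γ p) := by
  simp only [fun p => gaussFlow_apply (hre p) ψ]
  refine continuous_of_dominated (bound := fun ξ => ‖𝓕 ψ ξ‖) (fun p => ?_) (fun p => ?_)
    (𝓕 ψ).integrable.norm ?_
  · refine Continuous.aestronglyMeasurable ?_
    have := (𝓕 ψ).continuous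
    have h2 : Continuous fun ξ => gaussSymbol (θ p) ξ := by unfold gaussSymbol; fun_prop
    simp only [Circle.smul_def]
    fun_prop
  · refine Filter.Eventually.of_forall fun ξ => ?_
    rw [Circle.norm_smul, norm_mul]
    exact mul_le_of_le_one_left (norm_nonneg _) (norm_gaussSymbol_le (hre p) ξ)
  · refine Filter.Eventually.of_forall fun ξ => ?_
    have h2 : Continuous fun p => gaussSymbol (θ p) ξ := by unfold gaussSymbol; fun_prop
    simp only [Circle.smul_def]
    fun_prop

theorem hasDerivAt_gaussFlow {θ θ' : ℝ → ℂ} (hθ : ∀ s, HasDerivAt θ (θ' s) s)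
    (hθ' : Continuous θ') (hre : ∀ s, 0 ≤ (θ s).re) (ψ : S3) (x : E3) (s : ℝ) :
    HasDerivAt (fun s => gaussFlow (θ s) ψ x)
      (θ' s / (4 * π ^ 2) * gaussFlow (θ s) (lapS ψ) x) s := by
  obtain ⟨C, hC⟩ := (isCompact_Icc (a := s - 1) (b := s + 1)).exists_bound_of_continuousOn
    hθ'.continuousOn
  have hcont : ∀ (φ : S3) s, Continuous fun ξ : E3 =>
      Real.fourierChar (inner ℝ ξ x) • (gaussSymbol (θ s) ξ * φ ξ) := by
    intro φ s
    have := φ.continuous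
    have h2 : Continuous fun ξ => gaussSymbol (θ s) ξ := by unfold gaussSymbol; fun_prop
    simp only [Circle.smul_def]
    fun_prop
  have hbd : ∀ (φ : S3) s ξ, ‖Real.fourierChar (inner ℝ ξ x) • (gaussSymbol (θ s) ξ * φ ξ)‖
      ≤ ‖φ ξ‖ := by
    intro φ s ξ
    rw [Circle.norm_smul, norm_mul]
    exact mul_le_of_le_one_left (norm_nonneg _) (norm_gaussSymbol_le (hre s) ξ)
  rw [gaussFlow_apply (hre s), ← integral_const_mul]
  simp only [fun s => gaussFlow_apply (hre s) ψ x]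
  refine (hasDerivAt_integral_of_dominated_loc_of_deriv_le (𝕜 := ℝ)
    (F := fun s ξ => Real.fourierChar (inner ℝ ξ x) • (gaussSymbol (θ s) ξ * 𝓕 ψ ξ))
    (F' := fun s ξ => θ' s / (4 * π ^ 2) *
      Real.fourierChar (inner ℝ ξ x) • (gaussSymbol (θ s) ξ * 𝓕 (lapS ψ) ξ))
    (s := Set.Icc (s - 1) (s + 1)) (bound := fun ξ => C / (4 * π ^ 2) * ‖𝓕 (lapS ψ) ξ‖)
      (Icc_mem_nhds (by linarith) (by linarith)) ?_ ?_ ?_ ?_ ?_ ?_).2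
  · exact Filter.Eventually.of_forall fun s => (hcont (𝓕 ψ) s).aestronglyMeasurable
  · exact (𝓕 ψ).integrable.norm.mono' (hcont (𝓕 ψ) s).aestronglyMeasurable
      (Filter.Eventually.of_forall (hbd (𝓕 ψ) s))
  · exact ((hcont (𝓕 (lapS ψ)) s).const_smul (θ' s / (4 * π ^ 2))).aestronglyMeasurable
  · refine Filter.Eventually.of_forall fun ξ t ht => ?_
    rw [norm_mul, norm_div]
    have h4 : ‖(4 * π ^ 2 : ℂ)‖ = 4 * π ^ 2 := by
      rw [norm_mul, norm_pow, Complex.norm_real, Real.norm_of_nonneg Real.pi_pos.le]; norm_num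
    rw [h4]
    exact mul_le_mul (by gcongr; exact hC t ht) (hbd _ _ _) (norm_nonneg _)
      (div_nonneg ((norm_nonneg _).trans (hC t ht)) (by positivity))
  · exact (𝓕 (lapS ψ)).integrable.norm.const_mul _
  · refine Filter.Eventually.of_forall fun ξ t _ => ?_
    have h1 : HasDerivAt (fun t => gaussSymbol (θ t) ξ)
        (cexp (-θ t * ((‖ξ‖ ^ 2 : ℝ) : ℂ)) * (-θ' t * ((‖ξ‖ ^ 2 : ℝ) : ℂ))) t :=
      ((hθ t).neg.mul_const _).cexp
    have h2 := (h1.mul_const (𝓕 ψ ξ)).const_mul (Real.fourierChar (inner ℝ ξ x) : ℂ)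
    have hπ : (π : ℂ) ≠ 0 := by exact_mod_cast Real.pi_ne_zero
    refine h2.congr_deriv ?_
    rw [fourier_lapS, Circle.smul_def, gaussSymbol, smul_eq_mul]
    field_simp

theorem lintegral_mul_sq_le {α : Type*} [MeasurableSpace α] {μ : Measure α} {f g : α → ℝ≥0∞}
    (hf : AEMeasurable f μ) (hg : AEMeasurable g μ) :
    (∫⁻ x, f x * g x ∂μ) ^ 2 ≤ (∫⁻ x, f x ^ 2 ∂μ) * ∫⁻ x, g x ^ 2 ∂μ := by
  have h := ENNReal.lintegral_mul_le_Lp_mul_Lq μ (p := 2) (q := 2)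
    (Real.holderConjugate_iff.mpr ⟨by norm_num, by norm_num⟩) hf hg
  simp only [ENNReal.rpow_two, Pi.mul_apply] at h
  calc (∫⁻ x, f x * g x ∂μ) ^ 2
      ≤ ((∫⁻ x, f x ^ 2 ∂μ) ^ (1/2 : ℝ) * (∫⁻ x, g x ^ 2 ∂μ) ^ (1/2 : ℝ)) ^ 2 := by gcongr
    _ = _ := by
      rw [mul_pow, ← ENNReal.rpow_natCast, ← ENNReal.rpow_natCast, ← ENNReal.rpow_mul,
        ← ENNReal.rpow_mul]
      norm_num

/-- A case of Young's inequality for the autocorrelation of a nonnegative function. -/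
theorem lintegral_autocorrelation_sq_le {G : E3 → ℝ≥0∞} (hG : Measurable G) :
    ∫⁻ y, (∫⁻ x, G x * G (x + y)) ^ 2 ≤ (∫⁻ x, G x ^ (4/3 : ℝ)) ^ 3 := by
  set J := ∫⁻ x, G x ^ (4/3 : ℝ) with hJ
  have hsh : ∀ y, ∫⁻ x, G (x + y) ^ (4/3 : ℝ) = J := fun y =>
    lintegral_add_right_eq_self (fun x => G x ^ (4/3 : ℝ)) y
  have hGm : ∀ y, Measurable fun x => G (x + y) := fun y => hG.comp (by fun_prop)
  have hpow : ∀ (a : ℝ≥0∞) (p : ℝ), (a ^ p) ^ 2 = a ^ (2 * p) := fun a p => by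
    rw [mul_comm, ENNReal.rpow_mul, ENNReal.rpow_two]
  have h1 : ∀ y, (∫⁻ x, G x * G (x + y)) ^ 2
      ≤ (∫⁻ x, G x ^ (4/3 : ℝ) * G (x + y) ^ (4/3 : ℝ)) * J := by
    intro y
    have e1 : ∀ x, G x * G (x + y)
        = (G x * G (x + y)) ^ (2/3 : ℝ) * (G x * G (x + y)) ^ (1/3 : ℝ) := by
      intro x
      rw [← ENNReal.rpow_add_of_nonneg _ _ (by norm_num) (by norm_num)]
      norm_num
    have e2 : ∫⁻ x, G x ^ (2/3 : ℝ) * G (x + y) ^ (2/3 : ℝ) ≤ J := by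
      have := lintegral_mul_sq_le (μ := volume) (hG.pow_const (2/3 : ℝ)).aemeasurable
        ((hGm y).pow_const (2/3 : ℝ)).aemeasurable
      simp only [hpow] at this
      norm_num at this
      rw [hsh y, ← hJ, ← sq] at this
      exact (ENNReal.pow_le_pow_left_iff two_ne_zero).1 this
    calc (∫⁻ x, G x * G (x + y)) ^ 2
        = (∫⁻ x, (G x * G (x + y)) ^ (2/3 : ℝ) * (G x * G (x + y)) ^ (1/3 : ℝ)) ^ 2 := by
          rw [lintegral_congr e1]
      _ ≤ (∫⁻ x, ((G x * G (x + y)) ^ (2/3 : ℝ)) ^ 2) *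
          ∫⁻ x, ((G x * G (x + y)) ^ (1/3 : ℝ)) ^ 2 :=
          lintegral_mul_sq_le ((hG.mul (hGm y)).pow_const _).aemeasurable
            ((hG.mul (hGm y)).pow_const _).aemeasurable
      _ ≤ _ := by
        simp only [hpow]
        norm_num
        simp only [ENNReal.mul_rpow_of_nonneg _ _ (show (0:ℝ) ≤ 4/3 by norm_num),
          ENNReal.mul_rpow_of_nonneg _ _ (show (0:ℝ) ≤ 2/3 by norm_num)]
        gcongr
  calc ∫⁻ y, (∫⁻ x, G x * G (x + y)) ^ 2
      ≤ ∫⁻ y, (∫⁻ x, G x ^ (4/3 : ℝ) * G (x + y) ^ (4/3 : ℝ)) * J := lintegral_mono h1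
    _ = (∫⁻ y, ∫⁻ x, G x ^ (4/3 : ℝ) * G (x + y) ^ (4/3 : ℝ)) * J := by
        refine lintegral_mul_const _ ?_
        refine Measurable.lintegral_prod_right' (f := fun p : E3 × E3 =>
          G p.2 ^ (4/3 : ℝ) * G (p.2 + p.1) ^ (4/3 : ℝ)) ?_
        exact ((hG.comp measurable_snd).pow_const _).mul
          ((hG.comp (measurable_snd.add measurable_fst)).pow_const _)
    _ = (∫⁻ x, ∫⁻ y, G x ^ (4/3 : ℝ) * G (x + y) ^ (4/3 : ℝ)) * J := by
        rw [lintegral_lintegral_swap]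
        exact (((hG.comp measurable_snd).pow_const _).mul
          ((hG.comp (measurable_snd.add measurable_fst)).pow_const _)).aemeasurable
    _ = J ^ 3 := by
        have : ∀ x, ∫⁻ y, G x ^ (4/3 : ℝ) * G (x + y) ^ (4/3 : ℝ) = G x ^ (4/3 : ℝ) * J := by
          intro x
          have hm : Measurable fun y => G (x + y) ^ (4/3 : ℝ) :=
            (hG.comp (measurable_const_add x)).pow_const _
          rw [lintegral_const_mul _ hm,
            lintegral_add_left_eq_self (fun y => G y ^ (4/3 : ℝ)) x]
        rw [lintegral_congr this, lintegral_mul_const _ (hG.pow_const _)]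
        ring

theorem integral_fourier_mul_eq_flip {f g : E3 → ℂ} (hf : Integrable f) (hg : Integrable g) :
    ∫ ξ, 𝓕 f ξ * g ξ = ∫ x, f x * 𝓕 g x := by
  have := VectorFourier.integral_fourierIntegral_smul_eq_flip (L := innerₗ E3)
    continuous_fourierChar continuous_inner hf hg
  rw [flip_innerₗ] at this
  exact this

/-- The complex conjugate of a Schwartz function. -/
def conjS (ψ : S3) : S3 := ψ.postcompCLM (Complex.conjCLE : ℂ →L[ℝ] ℂ)

@[simp] theorem conjS_apply (ψ : S3) (x : E3) : conjS ψ x = (starRingEnd ℂ) (ψ x) := rfl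

/-- The product of two Schwartz functions. -/
def mulS (φ ψ : S3) : S3 := SchwartzMap.smulLeftCLM ℂ φ ψ

@[simp] theorem mulS_apply (φ ψ : S3) (x : E3) : mulS φ ψ x = φ x * ψ x := by
  rw [mulS, SchwartzMap.smulLeftCLM_apply_apply φ.hasTemperateGrowth, smul_eq_mul]

theorem gaussSymbol_mul_conj (θ : ℝ) (ξ η : E3) :
    gaussSymbol (θ * I) ξ * (starRingEnd ℂ) (gaussSymbol (θ * I) (ξ - η))
      = cexp (θ * ‖η‖ ^ 2 * I) * Real.fourierChar (-inner ℝ ξ ((θ / π) • η)) := by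
  rw [Real.fourierChar_apply, gaussSymbol, gaussSymbol, ← Complex.exp_conj, ← Complex.exp_add,
    ← Complex.exp_add]
  congr 1
  rw [norm_sub_sq_real, inner_smul_right]
  have hπ : (π : ℂ) ≠ 0 := by exact_mod_cast Real.pi_ne_zero
  simp only [map_mul, map_neg, Complex.conj_ofReal, Complex.conj_I]
  push_cast
  field_simp
  ring

theorem enorm_fourier_normSq_gaussFlow_le (θ : ℝ) (ψ : S3) (η : E3) :
    ‖𝓕 (mulS (gaussFlow (θ * I) ψ) (conjS (gaussFlow (θ * I) ψ))) η‖ₑ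
      ≤ ∫⁻ x, ‖ψ x‖ₑ * ‖ψ (x + (θ / π) • η)‖ₑ := by
  have hre : 0 ≤ (θ * I : ℂ).re := by simp
  set v := gaussFlow (θ * I) ψ with hv
  set y := (θ / π) • η with hy
  have hchar : ∀ a : E3, Continuous fun x : E3 => (Real.fourierChar (-inner ℝ x a) : ℂ) := by
    intro a; fun_prop
  have hn1 : ∀ t : ℝ, ‖(Real.fourierChar t : ℂ)‖ = 1 := fun t => Circle.norm_coe _
  have hconj : ∀ t : ℝ, (starRingEnd ℂ) (Real.fourierChar t : ℂ) = Real.fourierChar (-t) := by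
    intro t
    rw [AddChar.map_neg_eq_inv, ← Circle.coe_inv_eq_conj]
  have hadd : ∀ s t : ℝ, (Real.fourierChar (s + t) : ℂ)
      = Real.fourierChar s * Real.fourierChar t := by
    intro s t
    rw [AddChar.map_add_eq_mul, Circle.coe_mul]
  let h : E3 → ℂ := fun x => (Real.fourierChar (-inner ℝ x η) : ℂ) * (starRingEnd ℂ) (v x)
  have hh : Integrable h := by
    refine (conjS v).integrable.bdd_mul (c := 1) (hchar η).aestronglyMeasurable
      (Filter.Eventually.of_forall fun x => (hn1 _).le)
  have hF1 : 𝓕 (mulS v (conjS v)) η = ∫ ξ, 𝓕 v ξ * (starRingEnd ℂ) (𝓕 v (ξ - η)) := by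
    have e1 : 𝓕 (mulS v (conjS v)) η = ∫ x, 𝓕 (𝓕⁻ v : S3) x * h x := by
      rw [FourierTransform.fourier_fourierInv_eq, SchwartzMap.fourier_coe, Real.fourier_eq]
      congr 1 with x
      simp only [Circle.smul_def, mulS_apply, conjS_apply, smul_eq_mul, h]
      ring
    have e2 : ∀ ξ, 𝓕 h ξ = (starRingEnd ℂ) (𝓕 v (-ξ - η)) := by
      intro ξ
      rw [SchwartzMap.fourier_coe, Real.fourier_eq, Real.fourier_eq, ← integral_conj]
      congr 1 with x
      simp only [Circle.smul_def, smul_eq_mul, map_mul, h, hconj, ← mul_assoc, ← hadd]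
      congr 3
      rw [inner_sub_right, inner_neg_right]
      ring
    rw [e1, SchwartzMap.fourier_coe, integral_fourier_mul_eq_flip (𝓕⁻ v : S3).integrable hh,
      ← integral_neg_eq_self]
    congr 1 with ξ
    rw [e2, neg_neg, SchwartzMap.fourierInv_coe, Real.fourierInv_eq_fourier_neg, neg_neg,
      SchwartzMap.fourier_coe]
  let k : E3 → ℂ := fun ξ => (Real.fourierChar (-inner ℝ ξ y) : ℂ) * (starRingEnd ℂ) (𝓕 ψ (ξ - η))
  have hk : Integrable k := by
    refine Integrable.bdd_mul (c := 1) ?_ (hchar y).aestronglyMeasurable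
      (Filter.Eventually.of_forall fun x => (hn1 _).le)
    exact (conjS (𝓕 ψ)).integrable.comp_sub_right η
  have hF2 : ∀ x, 𝓕 k x = (starRingEnd ℂ) (Real.fourierChar (inner ℝ η (x + y)) * ψ (x + y)) := by
    intro x
    have e1 : ψ (x + y) = ∫ ξ, (Real.fourierChar (inner ℝ ξ (x + y)) : ℂ) * 𝓕 ψ ξ := by
      conv_lhs => rw [← FourierTransform.fourierInv_fourier_eq (F := S3) ψ]
      rw [SchwartzMap.fourierInv_coe, Real.fourierInv_eq]
      rfl
    rw [e1, ← integral_const_mul, ← integral_sub_right_eq_self _ η, ← integral_conj,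
      Real.fourier_eq]
    congr 1 with ξ
    simp only [Circle.smul_def, smul_eq_mul, map_mul, k, hconj, ← mul_assoc, ← hadd]
    congr 3
    simp only [inner_sub_left, inner_add_right]
    ring
  have hF3 : 𝓕 (mulS v (conjS v)) η = cexp (θ * ‖η‖ ^ 2 * I) *
      ∫ x, ψ x * (starRingEnd ℂ) (Real.fourierChar (inner ℝ η (x + y)) * ψ (x + y)) := by
    simp only [← hF2]
    rw [hF1, ← integral_fourier_mul_eq_flip ψ.integrable hk, ← integral_const_mul]
    congr 1 with ξ
    rw [hv, fourier_gaussFlow hre, fourier_gaussFlow hre, map_mul, ← SchwartzMap.fourier_coe]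
    linear_combination (𝓕 ψ ξ * (starRingEnd ℂ) (𝓕 ψ (ξ - η))) * gaussSymbol_mul_conj θ ξ η
  rw [hF3, enorm_mul]
  have h1 : ‖cexp (θ * ‖η‖ ^ 2 * I)‖ₑ = 1 := by
    have : ‖cexp (((θ * ‖η‖ ^ 2 : ℝ) : ℂ) * I)‖ = 1 := Complex.norm_exp_ofReal_mul_I _
    push_cast at this
    rw [← ofReal_norm, this, ENNReal.ofReal_one]
  rw [h1, one_mul]
  refine (enorm_integral_le_lintegral_enorm _).trans (le_of_eq ?_)
  congr 1 with x
  rw [enorm_mul]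
  congr 1
  rw [← ofReal_norm, ← ofReal_norm, RCLike.norm_conj, norm_mul, hn1, one_mul]

theorem lintegral_enorm_pow_eq {f : E3 → ℂ} (n : ℕ) (hf : Integrable fun x => ‖f x‖ ^ n) :
    ∫⁻ x, ‖f x‖ₑ ^ n = ENNReal.ofReal (∫ x, ‖f x‖ ^ n) := by
  rw [ofReal_integral_eq_lintegral_ofReal hf (Filter.Eventually.of_forall fun x => by positivity)]
  congr 1 with x
  rw [← ofReal_norm, ENNReal.ofReal_pow (norm_nonneg _)]

theorem SchwartzMap.integrable_norm_rpow {V : Type*} [NormedAddCommGroup V] [NormedSpace ℝ V]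
    (ψ : SchwartzMap E3 V) {p : ℝ} (hp : 0 < p) : Integrable fun x => ‖ψ x‖ ^ p := by
  have := (ψ.memLp (ENNReal.ofReal p)).integrable_norm_rpow (by simpa using hp) (by simp)
  rwa [ENNReal.toReal_ofReal hp.le] at this

theorem SchwartzMap.integrable_norm_pow {V : Type*} [NormedAddCommGroup V] [NormedSpace ℝ V]
    (ψ : SchwartzMap E3 V) {n : ℕ} (hn : n ≠ 0) :
    Integrable fun x => ‖ψ x‖ ^ n := by
  simpa using ψ.integrable_norm_rpow (p := n) (by positivity)

theorem lintegral_enorm_gaussFlow_pow_four_le {θ : ℝ} (hθ : θ ≠ 0) (ψ : S3) :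
    ∫⁻ x, ‖gaussFlow (θ * I) ψ x‖ₑ ^ 4
      ≤ ENNReal.ofReal (|θ / π| ^ 3)⁻¹ * (∫⁻ x, ‖ψ x‖ₑ ^ (4/3 : ℝ)) ^ 3 := by
  set v := gaussFlow (θ * I) ψ with hv
  have hr : θ / π ≠ 0 := div_ne_zero hθ Real.pi_ne_zero
  have hG : Measurable fun x => ‖ψ x‖ₑ := ψ.continuous.measurable.enorm
  have hA : Measurable fun y => (∫⁻ x, ‖ψ x‖ₑ * ‖ψ (x + y)‖ₑ) ^ 2 := by
    refine Measurable.pow_const ?_ _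
    exact Measurable.lintegral_prod_right' (f := fun p : E3 × E3 => ‖ψ p.2‖ₑ * ‖ψ (p.2 + p.1)‖ₑ)
      ((hG.comp measurable_snd).mul (hG.comp (measurable_snd.add measurable_fst)))
  have e1 : ∫⁻ x, ‖v x‖ₑ ^ 4 = ∫⁻ ξ, ‖𝓕 (mulS v (conjS v)) ξ‖ₑ ^ 2 := by
    rw [lintegral_enorm_pow_eq 2 ((𝓕 (mulS v (conjS v))).integrable_norm_pow two_ne_zero),
      SchwartzMap.integral_norm_sq_fourier,
      ← lintegral_enorm_pow_eq 2 ((mulS v (conjS v)).integrable_norm_pow two_ne_zero)]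
    congr 1 with x
    rw [mulS_apply, conjS_apply, enorm_mul, RCLike.enorm_conj]
    ring
  calc ∫⁻ x, ‖v x‖ₑ ^ 4 = ∫⁻ ξ, ‖𝓕 (mulS v (conjS v)) ξ‖ₑ ^ 2 := e1
    _ ≤ ∫⁻ η, (∫⁻ x, ‖ψ x‖ₑ * ‖ψ (x + (θ / π) • η)‖ₑ) ^ 2 := by
        gcongr with η
        exact enorm_fourier_normSq_gaussFlow_le θ ψ η
    _ = ENNReal.ofReal (|θ / π| ^ 3)⁻¹ * ∫⁻ y, (∫⁻ x, ‖ψ x‖ₑ * ‖ψ (x + y)‖ₑ) ^ 2 := by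
        rw [← lintegral_map (f := fun y => (∫⁻ x, ‖ψ x‖ₑ * ‖ψ (x + y)‖ₑ) ^ 2)
          (g := fun η : E3 => (θ / π) • η) hA (by fun_prop),
          Measure.map_addHaar_smul _ hr, lintegral_smul_measure, smul_eq_mul]
        simp [abs_inv, abs_pow]
    _ ≤ _ := by
        gcongr
        exact lintegral_autocorrelation_sq_le hG

/-- The `j`-th partial derivative of a Schwartz function. -/
def dS (j : Fin 3) (ψ : S3) : S3 := ∂_{EuclideanSpace.single j (1 : ℝ)} ψ

theorem pd_coe (j : Fin 3) (ψ : S3) : pd j (ψ : E3 → ℂ) = dS j ψ := by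
  ext x
  exact (SchwartzMap.lineDerivOp_apply_eq_fderiv _ ψ x).symm

theorem hasLineDerivAt_dS (j : Fin 3) (ψ : S3) (x : E3) :
    HasLineDerivAt ℝ ψ (dS j ψ x) x (EuclideanSpace.single j 1) := by
  have h := (ψ.differentiableAt (x := x)).hasFDerivAt.hasLineDerivAt (EuclideanSpace.single j 1)
  rwa [← SchwartzMap.lineDerivOp_apply_eq_fderiv] at h

theorem hasDerivAt_dS (j : Fin 3) (ψ : S3) (x : E3) :
    HasDerivAt (fun t : ℝ => ψ (x + t • EuclideanSpace.single j 1)) (dS j ψ x) 0 :=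
  hasLineDerivAt_dS j ψ x

theorem dS_eq_of_hasDerivAt {j : Fin 3} {ψ : S3} {x : E3} {a : ℂ}
    (h : HasDerivAt (fun t : ℝ => ψ (x + t • EuclideanSpace.single j 1)) a 0) : dS j ψ x = a :=
  (hasDerivAt_dS j ψ x).unique h

theorem dS_mulS (j : Fin 3) (φ ψ : S3) :
    dS j (mulS φ ψ) = mulS (dS j φ) ψ + mulS φ (dS j ψ) := by
  ext x
  refine dS_eq_of_hasDerivAt ?_
  have h := (hasDerivAt_dS j φ x).mul (hasDerivAt_dS j ψ x)
  simp only [zero_smul, add_zero] at h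
  refine (h.congr_deriv ?_).congr_of_eventuallyEq (Filter.Eventually.of_forall fun t => ?_)
  · simp
  · simp

theorem dS_conjS (j : Fin 3) (ψ : S3) : dS j (conjS ψ) = conjS (dS j ψ) := by
  ext x
  refine dS_eq_of_hasDerivAt ?_
  exact (Complex.conjCLE : ℂ →L[ℝ] ℂ).hasFDerivAt.comp_hasDerivAt (0 : ℝ) (hasDerivAt_dS j ψ x)

theorem integral_mul_dS (j : Fin 3) (φ ψ : S3) :
    ∫ x, φ x * dS j ψ x = -∫ x, dS j φ x * ψ x :=
  SchwartzMap.integral_mul_lineDerivOp_right_eq_neg_left (μ := volume) φ ψ _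

theorem integral_mul_dS_dS (j : Fin 3) (φ ψ : S3) :
    ∫ x, φ x * dS j (dS j ψ) x = ∫ x, dS j (dS j φ) x * ψ x := by
  rw [integral_mul_dS, integral_mul_dS, neg_neg]

theorem integrable_mul (φ ψ : S3) : Integrable fun x => φ x * ψ x :=
  ((mulS φ ψ).integrable (μ := volume)).congr (Filter.Eventually.of_forall
    fun x => mulS_apply φ ψ x)

/-- The `L⁴` norm. -/
def nFour (f : E3 → ℂ) : ℝ := (∫ x, ‖f x‖ ^ 4) ^ (1/4 : ℝ)

/-- The `L^{4/3}` norm. -/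
def nFourThirds (f : E3 → ℂ) : ℝ := (∫ x, ‖f x‖ ^ (4/3 : ℝ)) ^ (3/4 : ℝ)

theorem nFour_nonneg (f : E3 → ℂ) : 0 ≤ nFour f :=
  Real.rpow_nonneg (integral_nonneg fun _ => by positivity) _

theorem nFourThirds_nonneg (f : E3 → ℂ) : 0 ≤ nFourThirds f :=
  Real.rpow_nonneg (integral_nonneg fun _ => by positivity) _

theorem nFour_pow_four (f : E3 → ℂ) : nFour f ^ 4 = ∫ x, ‖f x‖ ^ 4 := by
  rw [nFour, ← Real.rpow_natCast, ← Real.rpow_mul (integral_nonneg fun _ => by positivity)]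
  norm_num

theorem nFour_le_of_integral_le {f : E3 → ℂ} {K : ℝ} (hK : 0 ≤ K)
    (h : ∫ x, ‖f x‖ ^ 4 ≤ K ^ 4) : nFour f ≤ K :=
  (pow_le_pow_iff_left₀ (nFour_nonneg f) hK four_ne_zero).1 (by rwa [nFour_pow_four])

theorem integral_mul_sq_le {f g : E3 → ℝ} (hf : Continuous f) (hg : Continuous g)
    (hf0 : ∀ x, 0 ≤ f x) (hg0 : ∀ x, 0 ≤ g x)
    (hf2 : Integrable fun x => f x ^ 2) (hg2 : Integrable fun x => g x ^ 2) :
    (∫ x, f x * g x) ^ 2 ≤ (∫ x, f x ^ 2) * ∫ x, g x ^ 2 := by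
  have h := integral_mul_le_Lp_mul_Lq_of_nonneg (μ := (volume : Measure E3)) (p := 2) (q := 2)
    (Real.holderConjugate_iff.mpr ⟨by norm_num, by norm_num⟩)
    (Filter.Eventually.of_forall hf0) (Filter.Eventually.of_forall hg0)
    (by simpa using (memLp_two_iff_integrable_sq hf.aestronglyMeasurable).2 hf2)
    (by simpa using (memLp_two_iff_integrable_sq hg.aestronglyMeasurable).2 hg2)
  simp only [Real.rpow_two, ← Real.sqrt_eq_rpow] at h
  calc (∫ x, f x * g x) ^ 2 ≤ (√(∫ x, f x ^ 2) * √(∫ x, g x ^ 2)) ^ 2 := by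
        gcongr
        exact integral_nonneg fun x => mul_nonneg (hf0 x) (hg0 x)
    _ = _ := by
        rw [mul_pow, Real.sq_sqrt (integral_nonneg fun x => sq_nonneg _),
          Real.sq_sqrt (integral_nonneg fun x => sq_nonneg _)]

theorem integral_norm_sq_mul_le (φ ψ : S3) :
    ∫ x, ‖φ x‖ ^ 2 * ‖ψ x‖ ^ 2 ≤ nFour φ ^ 2 * nFour ψ ^ 2 := by
  have h := integral_mul_sq_le (f := fun x => ‖φ x‖ ^ 2) (g := fun x => ‖ψ x‖ ^ 2)
    (by fun_prop) (by fun_prop) (fun x => by positivity) (fun x => by positivity)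
    (by simpa only [← pow_mul] using φ.integrable_norm_pow (n := 4) (by norm_num))
    (by simpa only [← pow_mul] using ψ.integrable_norm_pow (n := 4) (by norm_num))
  simp only [← pow_mul] at h
  norm_num at h
  rw [← nFour_pow_four, ← nFour_pow_four] at h
  have h0 := nFour_nonneg φ
  have h1 := nFour_nonneg ψ
  refine le_of_sq_le_sq ?_ (by positivity)
  calc _ ≤ _ := h
    _ = _ := by ring

theorem integral_norm_sq_mul_mul_le (φ ψ χ : S3) :
    ∫ x, ‖φ x‖ ^ 2 * (‖ψ x‖ * ‖χ x‖) ≤ nFour φ ^ 2 * (nFour ψ * nFour χ) := by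
  have h := integral_mul_sq_le (f := fun x => ‖φ x‖ ^ 2) (g := fun x => ‖ψ x‖ * ‖χ x‖)
    (by fun_prop) (by fun_prop) (fun x => by positivity) (fun x => by positivity)
    (by simpa only [← pow_mul] using φ.integrable_norm_pow (n := 4) (by norm_num))
    (by simpa using (mulS ψ χ).integrable_norm_pow (n := 2) (by norm_num))
  have h2 := integral_norm_sq_mul_le ψ χ
  simp only [← pow_mul, mul_pow] at h
  norm_num at h
  rw [← nFour_pow_four] at h
  have h0 := nFour_nonneg φ
  have h1 := nFour_nonneg ψ
  have h3 := nFour_nonneg χ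
  refine le_of_sq_le_sq ?_ (by positivity)
  calc _ ≤ _ := h
    _ ≤ nFour φ ^ 4 * (nFour ψ ^ 2 * nFour χ ^ 2) := by gcongr
    _ = _ := by ring

theorem integral_norm_mul_le (φ ψ : S3) : ∫ x, ‖φ x‖ * ‖ψ x‖ ≤ nFour φ * nFourThirds ψ := by
  have h := integral_mul_le_Lp_mul_Lq_of_nonneg (μ := (volume : Measure E3)) (p := 4) (q := 4/3)
    (f := fun x => ‖φ x‖) (g := fun x => ‖ψ x‖)
    (Real.holderConjugate_iff.mpr ⟨by norm_num, by norm_num⟩)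
    (Filter.Eventually.of_forall fun x => norm_nonneg _)
    (Filter.Eventually.of_forall fun x => norm_nonneg _)
    (φ.memLp _).norm (ψ.memLp _).norm
  have e : ∀ x, ‖φ x‖ ^ (4 : ℝ) = ‖φ x‖ ^ 4 := fun x => by norm_cast
  simp only [e] at h
  norm_num at h
  exact h

/-- A Gagliardo-Nirenberg type interpolation inequality. -/
theorem nFour_dS_sq_le (j : Fin 3) (g : S3) :
    nFour (dS j g) ^ 2 ≤ 3 * (nFour g * nFour (dS j (dS j g))) := by
  set g1 := dS j g with hg1
  set g2 := dS j g1 with hg2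
  have e1 : ((∫ x, ‖g1 x‖ ^ 4 : ℝ) : ℂ)
      = -∫ x, g x * (g2 x * (starRingEnd ℂ) (g1 x) ^ 2
        + 2 * g1 x * (starRingEnd ℂ) (g1 x) * (starRingEnd ℂ) (g2 x)) := by
    have h := integral_mul_dS j g (mulS g1 (mulS (conjS g1) (conjS g1)))
    simp only [dS_mulS, dS_conjS, ← hg1, ← hg2] at h
    rw [← integral_complex_ofReal]
    simp only [add_apply, mulS_apply, conjS_apply] at h
    rw [eq_neg_iff_add_eq_zero, ← eq_neg_iff_add_eq_zero.1 h, add_comm]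
    congr 1
    · congr 1 with x
      ring
    · congr 1 with x
      have := Complex.mul_conj' (g1 x)
      push_cast
      linear_combination (-((‖g1 x‖ : ℂ) ^ 2) - g1 x * (starRingEnd ℂ) (g1 x)) * this
  have hi : Integrable fun x => 3 * (‖g x‖ * ‖g2 x‖ * ‖g1 x‖ ^ 2) := by
    exact ((mulS (mulS g g2) (mulS g1 g1)).integrable.norm.const_mul 3).congr
      (Filter.Eventually.of_forall fun x => by simp only [mulS_apply, norm_mul]; ring)
  have hi2 : Integrable fun x => 9 / 2 * (‖g x‖ ^ 2 * ‖g2 x‖ ^ 2) := by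
    simpa [mul_pow] using ((mulS g g2).integrable_norm_pow (n := 2) (by norm_num)).const_mul (9/2)
  have hi1 := (g1.integrable_norm_pow (n := 4) (by norm_num)).const_mul (1/2)
  have e2 : ∫ x, ‖g1 x‖ ^ 4 ≤ ∫ x, 3 * (‖g x‖ * ‖g2 x‖ * ‖g1 x‖ ^ 2) := by
    calc ∫ x, ‖g1 x‖ ^ 4 = ‖((∫ x, ‖g1 x‖ ^ 4 : ℝ) : ℂ)‖ := by
          rw [Complex.norm_real, Real.norm_of_nonneg (integral_nonneg fun _ => by positivity)]
      _ ≤ _ := by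
          rw [e1, norm_neg]
          refine norm_integral_le_of_norm_le hi (Filter.Eventually.of_forall fun x => ?_)
          rw [norm_mul]
          have : ‖g2 x * (starRingEnd ℂ) (g1 x) ^ 2
              + 2 * g1 x * (starRingEnd ℂ) (g1 x) * (starRingEnd ℂ) (g2 x)‖
              ≤ 3 * (‖g2 x‖ * ‖g1 x‖ ^ 2) := by
            refine (norm_add_le _ _).trans (le_of_eq ?_)
            simp only [norm_mul, norm_pow, RCLike.norm_conj]
            norm_num
            ring
          nlinarith [mul_le_mul_of_nonneg_left this (norm_nonneg (g x))]
  have e3 : ∫ x, 3 * (‖g x‖ * ‖g2 x‖ * ‖g1 x‖ ^ 2)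
      ≤ (1/2) * (∫ x, ‖g1 x‖ ^ 4) + (9/2) * ∫ x, ‖g x‖ ^ 2 * ‖g2 x‖ ^ 2 := by
    rw [← integral_const_mul, ← integral_const_mul, ← integral_add hi1 hi2]
    refine integral_mono hi (hi1.add hi2) fun x => ?_
    nlinarith [sq_nonneg (‖g1 x‖ ^ 2 - 3 * (‖g x‖ * ‖g2 x‖))]
  have e4 := integral_norm_sq_mul_le g g2
  have h1 := nFour_nonneg g1
  have h0 := nFour_nonneg g
  have h2 := nFour_nonneg g2
  refine le_of_sq_le_sq ?_ (by positivity)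
  have := nFour_pow_four g1
  nlinarith

/-- The free Schrödinger evolution `exp(isΔ)`. -/
def freeFlow (s : ℝ) (ψ : S3) : S3 := gaussFlow (((4 * π ^ 2 * s : ℝ) : ℂ) * I) ψ

theorem re_ofReal_mul_I_nonneg (a : ℝ) : 0 ≤ ((a : ℂ) * I).re := by simp

theorem norm_gaussSymbol_ofReal_mul_I (a : ℝ) (ξ : E3) : ‖gaussSymbol ((a : ℂ) * I) ξ‖ = 1 := by
  rw [norm_gaussSymbol, Complex.re_ofReal_mul, Complex.I_re]
  simp

theorem freeFlow_zero (ψ : S3) : freeFlow 0 ψ = ψ := by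
  rw [freeFlow]
  simp [gaussFlow_zero]

theorem freeFlow_dS (j : Fin 3) (s : ℝ) (ψ : S3) :
    freeFlow s (dS j ψ) = dS j (freeFlow s ψ) :=
  gaussFlow_lineDeriv (re_ofReal_mul_I_nonneg _) _ _

theorem freeFlow_lapS (s : ℝ) (ψ : S3) : freeFlow s (lapS ψ) = lapS (freeFlow s ψ) :=
  lapS_gaussFlow (re_ofReal_mul_I_nonneg _) _

theorem norm_fourier_freeFlow (s : ℝ) (ψ : S3) (ξ : E3) : ‖𝓕 (freeFlow s ψ) ξ‖ = ‖𝓕 ψ ξ‖ := by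
  rw [freeFlow, fourier_gaussFlow (re_ofReal_mul_I_nonneg _), norm_mul,
    norm_gaussSymbol_ofReal_mul_I, one_mul]

theorem norm_freeFlow_le (s : ℝ) (ψ : S3) (x : E3) : ‖freeFlow s ψ x‖ ≤ ∫ ξ, ‖𝓕 ψ ξ‖ := by
  conv_lhs => rw [← FourierTransform.fourierInv_fourier_eq (F := S3) (freeFlow s ψ),
    SchwartzMap.fourierInv_coe, Real.fourierInv_eq]
  refine (norm_integral_le_integral_norm _).trans (le_of_eq ?_)
  congr 1 with ξ
  rw [Circle.norm_smul, norm_fourier_freeFlow]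

theorem integral_norm_sq_freeFlow (s : ℝ) (ψ : S3) :
    ∫ x, ‖freeFlow s ψ x‖ ^ 2 = ∫ x, ‖ψ x‖ ^ 2 := by
  rw [← SchwartzMap.integral_norm_sq_fourier, ← SchwartzMap.integral_norm_sq_fourier ψ]
  simp only [norm_fourier_freeFlow]

theorem continuous_freeFlow {X : Type*} [TopologicalSpace X] [FirstCountableTopology X]
    {θ : X → ℝ} {γ : X → E3} (hθ : Continuous θ) (hγ : Continuous γ) (ψ : S3) :
    Continuous fun p => freeFlow (θ p) ψ (γ p) :=
  continuous_gaussFlow (by fun_prop) hγ (fun _ => re_ofReal_mul_I_nonneg _) ψ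

theorem hasDerivAt_freeFlow {θ : ℝ → ℝ} {a : ℝ} (hθ : ∀ s, HasDerivAt θ a s) (ψ : S3) (x : E3)
    (s : ℝ) : HasDerivAt (fun s => freeFlow (θ s) ψ x) (a * I * lapS (freeFlow (θ s) ψ) x) s := by
  have h := hasDerivAt_gaussFlow (θ := fun s => ((4 * π ^ 2 * θ s : ℝ) : ℂ) * I)
    (θ' := fun _ => ((4 * π ^ 2 * a : ℝ) : ℂ) * I)
    (fun s => (((hθ s).const_mul _).ofReal_comp).mul_const I) continuous_const
    (fun _ => re_ofReal_mul_I_nonneg _) ψ x s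
  refine h.congr_deriv ?_
  rw [← freeFlow_lapS, freeFlow]
  have hπ : (π : ℂ) ≠ 0 := by exact_mod_cast Real.pi_ne_zero
  push_cast
  field_simp

/-- The dispersive estimate from `L^{4/3}` to `L⁴`. -/
theorem nFour_freeFlow_le {s : ℝ} (hs : s ≠ 0) (ψ : S3) :
    nFour (freeFlow s ψ) ≤ |s| ^ (-(3/4) : ℝ) * nFourThirds ψ := by
  have hπ := Real.pi_pos
  have h := lintegral_enorm_gaussFlow_pow_four_le (θ := 4 * π ^ 2 * s) (by positivity) ψ
  have e2 : ∫⁻ x, ‖ψ x‖ₑ ^ (4/3 : ℝ) = ENNReal.ofReal (∫ x, ‖ψ x‖ ^ (4/3 : ℝ)) := by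
    rw [ofReal_integral_eq_lintegral_ofReal (ψ.integrable_norm_rpow (by norm_num))
      (Filter.Eventually.of_forall fun x => by positivity)]
    congr 1 with x
    rw [← ofReal_norm, ENNReal.ofReal_rpow_of_nonneg (norm_nonneg _) (by norm_num)]
  have hJ : 0 ≤ ∫ x, ‖ψ x‖ ^ (4/3 : ℝ) := integral_nonneg fun _ => by positivity
  rw [lintegral_enorm_pow_eq 4 ((gaussFlow _ ψ).integrable_norm_pow (by norm_num)), e2,
    ← ENNReal.ofReal_pow hJ, ← ENNReal.ofReal_mul (by positivity),
    ENNReal.ofReal_le_ofReal_iff (by positivity)] at h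
  refine nFour_le_of_integral_le (by have := nFourThirds_nonneg ψ; positivity) (h.trans ?_)
  have e3 : nFourThirds ψ ^ 4 = (∫ x, ‖ψ x‖ ^ (4/3 : ℝ)) ^ 3 := by
    rw [nFourThirds, ← Real.rpow_natCast, ← Real.rpow_mul hJ]
    norm_num
  have e4 : (|s| ^ (-(3/4) : ℝ)) ^ 4 = (|s| ^ 3)⁻¹ := by
    rw [← Real.rpow_natCast, ← Real.rpow_mul (abs_nonneg s)]
    norm_num
  rw [mul_pow, e3, e4]
  have e5 : |s| ≤ |4 * π ^ 2 * s / π| := by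
    rw [show 4 * π ^ 2 * s / π = 4 * π * s by field_simp, abs_mul (4 * π),
      abs_of_pos (show 0 < 4 * π by positivity)]
    nlinarith [Real.pi_gt_three, abs_nonneg s]
  gcongr

/-- `g` pairs with free evolutions as if all its own free evolutions had `L⁴` norm at most `K`. -/
def FreeBound (g : S3) (K : ℝ) : Prop :=
  ∀ (s : ℝ) (ψ : S3), ‖∫ x, g x * freeFlow s ψ x‖ ≤ K * nFourThirds ψ

theorem FreeBound.mono {g : S3} {K L : ℝ} (h : FreeBound g K) (hKL : K ≤ L) : FreeBound g L :=
  fun s ψ => (h s ψ).trans (mul_le_mul_of_nonneg_right hKL (nFourThirds_nonneg ψ))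

theorem FreeBound.nFour_le {g : S3} {K : ℝ} (h : FreeBound g K) (hK : 0 ≤ K) : nFour g ≤ K := by
  set ψ := mulS (conjS g) (mulS g (conjS g)) with hψ
  have h0 := h 0 ψ
  rw [freeFlow_zero] at h0
  have e1 : ∫ x, g x * ψ x = ((nFour g ^ 4 : ℝ) : ℂ) := by
    rw [nFour_pow_four, ← integral_complex_ofReal]
    congr 1 with x
    have := Complex.mul_conj' (g x)
    simp only [hψ, mulS_apply, conjS_apply]
    push_cast
    linear_combination ((‖g x‖ : ℂ) ^ 2 + g x * (starRingEnd ℂ) (g x)) * this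
  have e2 : nFourThirds ψ = nFour g ^ 3 := by
    rw [nFourThirds, nFour, ← Real.rpow_natCast,
      ← Real.rpow_mul (integral_nonneg fun _ => by positivity)]
    norm_num
    congr 1
    congr 1 with x
    have : ‖ψ x‖ = ‖g x‖ ^ 3 := by
      simp only [hψ, mulS_apply, conjS_apply, norm_mul, RCLike.norm_conj]
      ring
    rw [this, ← Real.rpow_natCast, ← Real.rpow_mul (norm_nonneg _)]
    norm_num
  have hn := nFour_nonneg g
  rw [e1, e2, Complex.norm_real, Real.norm_of_nonneg (by positivity)] at h0
  by_contra! hlt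
  have h3 : 0 < nFour g ^ 3 := pow_pos (hK.trans_lt hlt) 3
  nlinarith

theorem exists_freeBound (g : S3) : ∃ K, FreeBound g K := by
  set A := ∫ ξ, ‖𝓕⁻ g ξ‖
  set B := ∫ x, ‖g x‖ ^ 2
  refine ⟨(A ^ 2 * B) ^ (1/4 : ℝ), fun s ψ => ?_⟩
  set m := gaussSymbol (((4 * π ^ 2 * s : ℝ) : ℂ) * I) with hm
  have hmt : m.HasTemperateGrowth := hasTemperateGrowth_gaussSymbol (re_ofReal_mul_I_nonneg _)
  have hm1 : ∀ ξ, ‖m ξ‖ = 1 := fun ξ => norm_gaussSymbol_ofReal_mul_I _ ξ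
  set w : S3 := SchwartzMap.smulLeftCLM ℂ m (𝓕⁻ g) with hw
  have hwn : ∀ ξ, ‖w ξ‖ = ‖𝓕⁻ g ξ‖ := fun ξ => by
    rw [hw, SchwartzMap.smulLeftCLM_apply_apply hmt, smul_eq_mul, norm_mul, hm1, one_mul]
  set W : S3 := 𝓕 w with hW
  have e1 : ∫ x, g x * freeFlow s ψ x = ∫ x, W x * ψ x := by
    have h1 : ∫ x, g x * freeFlow s ψ x = ∫ x, 𝓕 (𝓕⁻ g : S3) x * freeFlow s ψ x := by
      rw [FourierTransform.fourier_fourierInv_eq]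
    rw [h1, SchwartzMap.fourier_coe,
      integral_fourier_mul_eq_flip (𝓕⁻ g : S3).integrable (freeFlow s ψ).integrable,
      hW, SchwartzMap.fourier_coe, integral_fourier_mul_eq_flip w.integrable ψ.integrable]
    congr 1 with ξ
    rw [← SchwartzMap.fourier_coe, freeFlow, fourier_gaussFlow (re_ofReal_mul_I_nonneg _), hw,
      SchwartzMap.smulLeftCLM_apply_apply hmt, smul_eq_mul, ← SchwartzMap.fourier_coe]
    ring
  have hA : ∀ x, ‖W x‖ ≤ A := fun x => by
    rw [hW, SchwartzMap.fourier_coe, Real.fourier_eq]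
    refine (norm_integral_le_integral_norm _).trans (le_of_eq ?_)
    simp only [Circle.norm_smul, hwn]
    rfl
  have hB : ∫ x, ‖W x‖ ^ 2 = B := by
    rw [hW, SchwartzMap.integral_norm_sq_fourier]
    simp only [hwn]
    rw [← SchwartzMap.integral_norm_sq_fourier, FourierTransform.fourier_fourierInv_eq]
  have h4 : nFour W ≤ (A ^ 2 * B) ^ (1/4 : ℝ) := by
    refine Real.rpow_le_rpow (integral_nonneg fun _ => by positivity) ?_ (by norm_num)
    rw [← hB, ← integral_const_mul]
    refine integral_mono (W.integrable_norm_pow (by norm_num))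
      ((W.integrable_norm_pow (by norm_num)).const_mul _) fun x => ?_
    have := pow_le_pow_left₀ (norm_nonneg _) (hA x) 2
    have h2 := sq_nonneg ‖W x‖
    nlinarith
  calc ‖∫ x, g x * freeFlow s ψ x‖ ≤ ∫ x, ‖W x‖ * ‖ψ x‖ := by
        rw [e1]
        refine (norm_integral_le_integral_norm _).trans (le_of_eq ?_)
        simp only [norm_mul]
    _ ≤ nFour W * nFourThirds ψ := integral_norm_mul_le _ _
    _ ≤ _ := mul_le_mul_of_nonneg_right h4 (nFourThirds_nonneg ψ)

/-- Joint smoothness in time and space. -/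
def SpaceTimeSmooth (u : ℝ → E3 → ℂ) : Prop := ContDiff ℝ ∞ (Function.uncurry u)

/-- The time derivative. -/
def pt (u : ℝ → E3 → ℂ) (t : ℝ) (x : E3) : ℂ := deriv (fun s => u s x) t

/-- The spatial partial derivative of a function of time and space. -/
def px (j : Fin 3) (u : ℝ → E3 → ℂ) (t : ℝ) : E3 → ℂ := pd j (u t)

theorem hasLineDerivAt_re {f : E3 → ℂ} {a : ℂ} {x v : E3} (h : HasLineDerivAt ℝ f a x v) :
    HasLineDerivAt ℝ (fun x => (f x).re) a.re x v :=
  Complex.reCLM.hasFDerivAt.comp_hasDerivAt (0 : ℝ) h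

theorem hasLineDerivAt_im {f : E3 → ℂ} {a : ℂ} {x v : E3} (h : HasLineDerivAt ℝ f a x v) :
    HasLineDerivAt ℝ (fun x => (f x).im) a.im x v :=
  Complex.imCLM.hasFDerivAt.comp_hasDerivAt (0 : ℝ) h

theorem hasLineDerivAt_mul {E 𝔸 : Type*} [NormedAddCommGroup E] [NormedSpace ℝ E]
    [NormedRing 𝔸] [NormedAlgebra ℝ 𝔸] {f g : E → 𝔸} {a b : 𝔸} {x v : E}
    (hf : HasLineDerivAt ℝ f a x v) (hg : HasLineDerivAt ℝ g b x v) :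
    HasLineDerivAt ℝ (fun x => f x * g x) (a * g x + f x * b) x v := by
  have h := HasDerivAt.mul (𝕜 := ℝ) hf hg
  simp only [zero_smul, add_zero] at h
  exact h

theorem hasLineDerivAt_add {E 𝔸 : Type*} [NormedAddCommGroup E] [NormedSpace ℝ E]
    [NormedAddCommGroup 𝔸] [NormedSpace ℝ 𝔸] {f g : E → 𝔸} {a b : 𝔸} {x v : E}
    (hf : HasLineDerivAt ℝ f a x v) (hg : HasLineDerivAt ℝ g b x v) :
    HasLineDerivAt ℝ (fun x => f x + g x) (a + b) x v :=
  HasDerivAt.add (𝕜 := ℝ) hf hg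

theorem hasLineDerivAt_sub {E 𝔸 : Type*} [NormedAddCommGroup E] [NormedSpace ℝ E]
    [NormedAddCommGroup 𝔸] [NormedSpace ℝ 𝔸] {f g : E → 𝔸} {a b : 𝔸} {x v : E}
    (hf : HasLineDerivAt ℝ f a x v) (hg : HasLineDerivAt ℝ g b x v) :
    HasLineDerivAt ℝ (fun x => f x - g x) (a - b) x v :=
  HasDerivAt.sub (𝕜 := ℝ) hf hg

theorem hasLineDerivAt_const_mul {E 𝔸 : Type*} [NormedAddCommGroup E] [NormedSpace ℝ E]
    [NormedRing 𝔸] [NormedAlgebra ℝ 𝔸] {f : E → 𝔸} {a : 𝔸} {x v : E} (c : 𝔸)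
    (hf : HasLineDerivAt ℝ f a x v) : HasLineDerivAt ℝ (fun x => c * f x) (c * a) x v :=
  HasDerivAt.const_mul (𝕜 := ℝ) c hf

theorem contDiff_fderiv_apply {E F : Type*} [NormedAddCommGroup E] [NormedSpace ℝ E]
    [NormedAddCommGroup F] [NormedSpace ℝ F] {f : E → F} (hf : ContDiff ℝ ∞ f) (v : E) :
    ContDiff ℝ ∞ fun p => fderiv ℝ f p v :=
  (hf.fderiv_right (m := ∞) (by norm_num)).clm_apply contDiff_const

theorem fderiv_fderiv_apply_comm {E F : Type*} [NormedAddCommGroup E] [NormedSpace ℝ E]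
    [NormedAddCommGroup F] [NormedSpace ℝ F] {f : E → F} (hf : ContDiff ℝ ∞ f) (v w p : E) :
    fderiv ℝ (fun p => fderiv ℝ f p v) p w = fderiv ℝ (fun p => fderiv ℝ f p w) p v := by
  have hd : DifferentiableAt ℝ (fderiv ℝ f) p :=
    (hf.fderiv_right (m := ∞) (by norm_num)).contDiffAt.differentiableAt (by norm_num)
  rw [fderiv_clm_apply hd (differentiableAt_const _),
    fderiv_clm_apply hd (differentiableAt_const _)]
  have := (hf.contDiffAt (x := p)).isSymmSndFDerivAt
    (by rw [minSmoothness_of_isRCLikeNormedField]; exact WithTop.coe_le_coe.2 le_top)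
  simpa using this w v

namespace SpaceTimeSmooth

variable {u : ℝ → E3 → ℂ}

theorem hasFDerivAt (hu : SpaceTimeSmooth u) (p : ℝ × E3) :
    HasFDerivAt (Function.uncurry u) (fderiv ℝ (Function.uncurry u) p) p :=
  (ContDiff.differentiable hu (by norm_num) p).hasFDerivAt

theorem hasDerivAt' (hu : SpaceTimeSmooth u) (t : ℝ) (x : E3) :
    HasDerivAt (fun s => u s x) (fderiv ℝ (Function.uncurry u) (t, x) (1, 0)) t :=
  (hu.hasFDerivAt (t, x)).comp_hasDerivAt (f := fun s : ℝ => (s, x)) t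
    ((hasDerivAt_id t).prodMk (hasDerivAt_const t x))

theorem pt_eq (hu : SpaceTimeSmooth u) (t : ℝ) (x : E3) :
    pt u t x = fderiv ℝ (Function.uncurry u) (t, x) (1, 0) :=
  (hu.hasDerivAt' t x).deriv

theorem hasDerivAt (hu : SpaceTimeSmooth u) (t : ℝ) (x : E3) :
    HasDerivAt (fun s => u s x) (pt u t x) t := by
  rw [hu.pt_eq]
  exact hu.hasDerivAt' t x

theorem slice_hasFDerivAt (hu : SpaceTimeSmooth u) (t : ℝ) (x : E3) :
    HasFDerivAt (u t) ((fderiv ℝ (Function.uncurry u) (t, x)).comp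
      (ContinuousLinearMap.inr ℝ ℝ E3)) x :=
  (hu.hasFDerivAt (t, x)).comp x (hasFDerivAt_prodMk_right t x)

theorem px_eq (hu : SpaceTimeSmooth u) (j : Fin 3) (t : ℝ) (x : E3) :
    px j u t x = fderiv ℝ (Function.uncurry u) (t, x) (0, EuclideanSpace.single j 1) := by
  rw [px, pd, (hu.slice_hasFDerivAt t x).fderiv]
  rfl

theorem hasLineDerivAt (hu : SpaceTimeSmooth u) (j : Fin 3) (t : ℝ) (x : E3) :
    HasLineDerivAt ℝ (u t) (px j u t x) x (EuclideanSpace.single j 1) := by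
  rw [px, pd]
  exact (hu.slice_hasFDerivAt t x).differentiableAt.hasFDerivAt.hasLineDerivAt _

theorem uncurry_pt (hu : SpaceTimeSmooth u) : Function.uncurry (pt u) =
    fun p => fderiv ℝ (Function.uncurry u) p (1, 0) := by
  ext ⟨t, x⟩
  exact hu.pt_eq t x

theorem uncurry_px (hu : SpaceTimeSmooth u) (j : Fin 3) : Function.uncurry (px j u) =
    fun p => fderiv ℝ (Function.uncurry u) p (0, EuclideanSpace.single j 1) := by
  ext ⟨t, x⟩
  exact hu.px_eq j t x

theorem pt (hu : SpaceTimeSmooth u) : SpaceTimeSmooth (pt u) := by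
  rw [SpaceTimeSmooth, hu.uncurry_pt]
  exact contDiff_fderiv_apply hu _

theorem px (hu : SpaceTimeSmooth u) (j : Fin 3) : SpaceTimeSmooth (px j u) := by
  rw [SpaceTimeSmooth, hu.uncurry_px]
  exact contDiff_fderiv_apply hu _

theorem pt_px (hu : SpaceTimeSmooth u) (j : Fin 3) (t : ℝ) (x : E3) :
    _root_.pt (_root_.px j u) t x = _root_.px j (_root_.pt u) t x := by
  rw [(hu.px j).pt_eq, hu.pt.px_eq, hu.uncurry_px, hu.uncurry_pt]
  exact fderiv_fderiv_apply_comm hu _ _ _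

theorem px_px (hu : SpaceTimeSmooth u) (j k : Fin 3) (t : ℝ) (x : E3) :
    _root_.px k (_root_.px j u) t x = _root_.px j (_root_.px k u) t x := by
  rw [(hu.px j).px_eq, (hu.px k).px_eq, hu.uncurry_px, hu.uncurry_px]
  exact fderiv_fderiv_apply_comm hu _ _ _

theorem continuous (hu : SpaceTimeSmooth u) : Continuous fun p : ℝ × E3 => u p.1 p.2 :=
  ContDiff.continuous hu

theorem continuous_comp (hu : SpaceTimeSmooth u) {X : Type*} [TopologicalSpace X] {a : X → ℝ}
    {b : X → E3} (ha : Continuous a) (hb : Continuous b) : Continuous fun p => u (a p) (b p) :=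
  hu.continuous.comp (ha.prodMk hb)

theorem hasDerivAt_re (hu : SpaceTimeSmooth u) (t : ℝ) (x : E3) :
    HasDerivAt (fun s => (u s x).re) (_root_.pt u t x).re t :=
  Complex.reCLM.hasFDerivAt.comp_hasDerivAt t (hu.hasDerivAt t x)

theorem hasDerivAt_im (hu : SpaceTimeSmooth u) (t : ℝ) (x : E3) :
    HasDerivAt (fun s => (u s x).im) (_root_.pt u t x).im t :=
  Complex.imCLM.hasFDerivAt.comp_hasDerivAt t (hu.hasDerivAt t x)

end SpaceTimeSmooth

theorem norm_sq_eq_re_add_im (z : ℂ) : ‖z‖ ^ 2 = z.re ^ 2 + z.im ^ 2 := by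
  rw [Complex.sq_norm, Complex.normSq_apply]
  ring

/-- A solution of the cubic NLS together with its spatial slices as Schwartz functions. -/
structure SchwartzSolution (T : ℝ) (u : ℝ → E3 → ℂ) (U : ℝ → S3) : Prop where
  smooth : SpaceTimeSmooth u
  coe : ∀ t ∈ Set.Icc 0 T, u t = U t
  eq : ∀ t ∈ Set.Icc 0 T, ∀ x,
    pt u t x = I * (∑ j, px j (px j u) t x - (‖u t x‖ : ℂ) ^ 2 * u t x)

theorem IsNLSSolution.exists_schwartzSolution {T : ℝ} {u : ℝ → E3 → ℂ}
    (h : IsNLSSolution 3 T u) : ∃ U, SchwartzSolution T u U := by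
  obtain ⟨h1, h2, h3⟩ := h
  choose! U hU using h2
  refine ⟨U, h1, fun t ht => (hU t ht).symm, fun t ht x => ?_⟩
  have h := h3 t ht x
  simp only [pt, px]
  simp only [lap] at h
  linear_combination (-I) * h + deriv (fun s => u s x) t * Complex.I_mul_I

namespace SchwartzSolution

variable {T : ℝ} {u : ℝ → E3 → ℂ} {U : ℝ → S3}

theorem px_coe (h : SchwartzSolution T u U) {t : ℝ} (ht : t ∈ Set.Icc 0 T) (j : Fin 3) :
    px j u t = dS j (U t) := by
  rw [px, h.coe t ht, pd_coe]

theorem px_px_coe (h : SchwartzSolution T u U) {t : ℝ} (ht : t ∈ Set.Icc 0 T) (j k : Fin 3) :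
    px k (px j u) t = dS k (dS j (U t)) := by
  rw [px, h.px_coe ht, pd_coe]

theorem pt_re (h : SchwartzSolution T u U) {t : ℝ} (ht : t ∈ Set.Icc 0 T) (x : E3) :
    (pt u t x).re = -∑ j, (px j (px j u) t x).im
      + ((u t x).re ^ 2 + (u t x).im ^ 2) * (u t x).im := by
  rw [h.eq t ht x, ← norm_sq_eq_re_add_im, ← Complex.ofReal_pow]
  simp only [Complex.I_mul_re, Complex.sub_im, Complex.im_sum, Complex.im_ofReal_mul]
  ring

theorem pt_im (h : SchwartzSolution T u U) {t : ℝ} (ht : t ∈ Set.Icc 0 T) (x : E3) :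
    (pt u t x).im = ∑ j, (px j (px j u) t x).re
      - ((u t x).re ^ 2 + (u t x).im ^ 2) * (u t x).re := by
  rw [h.eq t ht x, ← norm_sq_eq_re_add_im, ← Complex.ofReal_pow]
  simp only [Complex.I_mul_im, Complex.sub_re, Complex.re_sum, Complex.re_ofReal_mul]

end SchwartzSolution

/-- A quantitative bound on the size of a Schwartz function. -/
structure RegBound (g : S3) (K : ℝ) : Prop where
  mass : ∫ x, ‖g x‖ ^ 2 ≤ K
  energy : energy g ≤ K
  free : ∀ j, FreeBound (dS j (dS j g)) K

theorem integral_sq_pd_le_energy (g : S3) (j : Fin 3) : ∫ x, ‖dS j g x‖ ^ 2 ≤ 2 * energy g := by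
  rw [energy, integral_finsetSum _ fun j _ => by
    rw [pd_coe]; exact (dS j g).integrable_norm_pow two_ne_zero]
  have h4 : 0 ≤ ∫ x, ‖g x‖ ^ 4 := integral_nonneg fun _ => by positivity
  have h2 := Finset.single_le_sum (f := fun i => ∫ x, ‖pd i g x‖ ^ 2)
    (fun i _ => integral_nonneg fun _ => by positivity) (Finset.mem_univ j)
  simp only [pd_coe] at h2 ⊢
  linarith

theorem integral_pow_four_le_energy (g : S3) : ∫ x, ‖g x‖ ^ 4 ≤ 4 * energy g := by
  rw [energy]
  have h2 : 0 ≤ ∫ x, ∑ j, ‖pd j g x‖ ^ 2 :=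
    integral_nonneg fun _ => Finset.sum_nonneg fun _ _ => by positivity
  linarith

theorem energy_nonneg (g : S3) : 0 ≤ energy g := by
  have h1 := integral_pow_four_le_energy g
  have h4 : 0 ≤ ∫ x, ‖g x‖ ^ 4 := integral_nonneg fun _ => by positivity
  linarith

theorem RegBound.nonneg {g : S3} {K : ℝ} (h : RegBound g K) : 0 ≤ K :=
  le_trans (integral_nonneg fun _ => by positivity) h.mass

theorem RegBound.mono {g : S3} {K L : ℝ} (h : RegBound g K) (hKL : K ≤ L) : RegBound g L :=
  ⟨h.mass.trans hKL, h.energy.trans hKL, fun j => (h.free j).mono hKL⟩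

theorem exists_regBound (g : S3) : ∃ K, RegBound g K := by
  choose k hk using fun j => exists_freeBound (dS j (dS j g))
  refine ⟨max (max (∫ x, ‖g x‖ ^ 2) (_root_.energy g)) (max (k 0) (max (k 1) (k 2))), by simp,
    by simp, fun j => (hk j).mono ?_⟩
  fin_cases j <;> simp

theorem integral_pow_four_le_of_nFour_le {f : E3 → ℂ} {K : ℝ} (h : nFour f ≤ K) :
    ∫ x, ‖f x‖ ^ 4 ≤ K ^ 4 := by
  rw [← nFour_pow_four]
  exact pow_le_pow_left₀ (nFour_nonneg f) h 4

/-- A bound for `L⁴` norms up to second order. -/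
theorem RegBound.nFour_le {g : S3} {K : ℝ} (h : RegBound g K) (j : Fin 3) :
    nFour g ≤ 4 * (1 + K) ∧ nFour (dS j (dS j g)) ≤ 4 * (1 + K) ∧ nFour (dS j g) ≤ 8 * (1 + K) := by
  have hK := h.nonneg
  have h1 : nFour g ≤ 1 + K := by
    refine nFour_le_of_integral_le (by positivity) ?_
    have := integral_pow_four_le_energy g
    nlinarith [h.energy, mul_nonneg hK hK, pow_nonneg hK 3, pow_nonneg hK 4]
  have h2 := (h.free j).nFour_le hK
  have h3 := nFour_dS_sq_le j g
  have h4 := nFour_nonneg g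
  refine ⟨by linarith, by linarith, ?_⟩
  refine le_of_sq_le_sq ?_ (by positivity)
  nlinarith [mul_le_mul h1 h2 (nFour_nonneg _) (by positivity)]

theorem setIntegral_le_integral_of_norm_le {E F : Type*} [MeasurableSpace E] {μ : Measure E}
    [NormedAddCommGroup F] {f : E → F} {g : E → ℝ} {s : Set E}
    (hg : Integrable g μ) (h : ∀ x, ‖f x‖ ≤ g x) : ∫ x in s, ‖f x‖ ∂μ ≤ ∫ x, g x ∂μ := by
  have h0 : ∀ x, 0 ≤ g x := fun x => (norm_nonneg _).trans (h x)
  calc ∫ x in s, ‖f x‖ ∂μ ≤ ∫ x in s, g x ∂μ :=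
        integral_mono_of_nonneg (Filter.Eventually.of_forall fun x => norm_nonneg _)
          hg.integrableOn (Filter.Eventually.of_forall h)
    _ ≤ _ := setIntegral_le_integral hg (Filter.Eventually.of_forall h0)

theorem one_le_rpow_three_fourths {R : ℝ} (hR : 1 ≤ R) : 1 ≤ R ^ (3/4 : ℝ) :=
  Real.one_le_rpow hR (by norm_num)

theorem setIntegral_ball_mul_le {a b : E3 → ℝ} (ha0 : ∀ x, 0 ≤ a x) (hb0 : ∀ x, 0 ≤ b x)
    (ha : Integrable fun x => a x ^ 4) (hb : Integrable fun x => b x ^ 2) {R : ℝ} (hR : 1 ≤ R) :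
    ∫ x in Metric.ball 0 (2 * R), a x * b x
      ≤ ((∫ x, a x ^ 4) + (∫ x, b x ^ 2) + 8 * volume.real (Metric.ball (0 : E3) 1))
        * R ^ (3/4 : ℝ) := by
  set L := R ^ (3/4 : ℝ) with hL
  have hL0 : 0 < L := by positivity
  have hL4 : L ^ 4 = R ^ 3 := by
    rw [hL, ← Real.rpow_natCast, ← Real.rpow_mul (by positivity)]
    norm_num
  have hpt : ∀ x, a x * b x ≤ L * (a x ^ 4 + b x ^ 2 + (R ^ 3)⁻¹) := fun x => by
    have h2 : a x * b x = L * (a x * L⁻¹ * b x) := by field_simp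
    rw [h2, ← hL4]
    gcongr
    have e : (L ^ 4)⁻¹ = (L⁻¹) ^ 4 := by rw [inv_pow]
    rw [e]
    nlinarith [sq_nonneg (a x * L⁻¹ - b x), sq_nonneg (a x ^ 2 - L⁻¹ ^ 2), sq_nonneg (b x),
      sq_nonneg (a x ^ 2), sq_nonneg (L⁻¹ ^ 2)]
  have hc : IntegrableOn (fun _ : E3 => (R ^ 3)⁻¹) (Metric.ball 0 (2 * R)) :=
    integrableOn_const measure_ball_lt_top.ne
  have hA := ha.integrableOn (s := Metric.ball 0 (2 * R))
  have hB := hb.integrableOn (s := Metric.ball 0 (2 * R))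
  have hR3 : volume.real (Metric.ball (0 : E3) (2 * R))
      = 8 * R ^ 3 * volume.real (Metric.ball (0 : E3) 1) := by
    rw [measureReal_def, Measure.addHaar_ball_of_pos _ _ (by positivity), ENNReal.toReal_mul,
      ENNReal.toReal_ofReal (by positivity), finrank_euclideanSpace, Fintype.card_fin,
      measureReal_def]
    ring
  calc ∫ x in Metric.ball 0 (2 * R), a x * b x
      ≤ ∫ x in Metric.ball 0 (2 * R), L * (a x ^ 4 + b x ^ 2 + (R ^ 3)⁻¹) :=
        integral_mono_of_nonneg (Filter.Eventually.of_forall fun x => mul_nonneg (ha0 x) (hb0 x))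
          (((hA.add hB).add hc).const_mul L) (Filter.Eventually.of_forall hpt)
    _ = L * ((∫ x in Metric.ball 0 (2 * R), a x ^ 4) + (∫ x in Metric.ball 0 (2 * R), b x ^ 2)
          + 8 * volume.real (Metric.ball (0 : E3) 1)) := by
        have e := integral_add (hA.add hB) hc
        simp only [Pi.add_apply] at e
        rw [integral_const_mul, e, integral_add hA hB, setIntegral_const, hR3, smul_eq_mul]
        field_simp
    _ ≤ _ := by
        rw [mul_comm]
        gcongr
        · exact Filter.Eventually.of_forall fun x => by have := ha0 x; positivity
        · exact Measure.restrict_le_self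
        · exact Filter.Eventually.of_forall fun x => by positivity
        · exact Measure.restrict_le_self

theorem RegBound.integral_sq_dS_le {g : S3} {K : ℝ} (h : RegBound g K) (j : Fin 3) :
    ∫ x, ‖dS j g x‖ ^ 2 ≤ 2 * K :=
  (integral_sq_pd_le_energy g j).trans (by linarith [h.energy])

theorem abs_re_mul_re_add_le (z w : ℂ) : |z.re * w.re + z.im * w.im| ≤ ‖z‖ * ‖w‖ := by
  refine abs_le_of_sq_le_sq ?_ (by positivity)
  rw [mul_pow, norm_sq_eq_re_add_im, norm_sq_eq_re_add_im]
  nlinarith [sq_nonneg (z.re * w.im - z.im * w.re)]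

theorem abs_im_mul_re_sub_le (z w : ℂ) : |z.im * w.re - z.re * w.im| ≤ ‖z‖ * ‖w‖ := by
  refine abs_le_of_sq_le_sq ?_ (by positivity)
  rw [mul_pow, norm_sq_eq_re_add_im, norm_sq_eq_re_add_im]
  nlinarith [sq_nonneg (z.re * w.re + z.im * w.im)]

namespace SchwartzSolution

variable {T : ℝ} {u : ℝ → E3 → ℂ} {U : ℝ → S3}

theorem mass_eq (h : SchwartzSolution T u U) {c d K : ℝ} (hcd : Set.uIcc c d ⊆ Set.Icc 0 T)
    (hK : ∀ t ∈ Set.uIcc c d, RegBound (U t) K) :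
    ∫ x, ‖U d x‖ ^ 2 = ∫ x, ‖U c x‖ ^ 2 := by
  have hu := h.smooth
  have hI : ∀ t ∈ Set.uIcc c d, Integrable
      fun x => (u t x).re * (u t x).re + (u t x).im * (u t x).im := by
    intro t ht
    refine ((U t).integrable_norm_pow two_ne_zero).congr (Filter.Eventually.of_forall fun x => ?_)
    simp only
    rw [← h.coe t (hcd ht), norm_sq_eq_re_add_im]
    ring
  have key := integral_sub_integral_of_conservation_law (volume : Measure E3)
    (v := fun j : Fin 3 => EuclideanSpace.single j (1 : ℝ))
    (q := fun t x => (u t x).re * (u t x).re + (u t x).im * (u t x).im)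
    (q' := fun t x => (pt u t x).re * (u t x).re + (u t x).re * (pt u t x).re
      + ((pt u t x).im * (u t x).im + (u t x).im * (pt u t x).im))
    (r := fun _ _ => 0)
    (V := fun j t x => 2 * ((u t x).im * (px j u t x).re - (u t x).re * (px j u t x).im))
    (V' := fun j t x => 2 * (((px j u t x).im * (px j u t x).re
        + (u t x).im * (px j (px j u) t x).re)
      - ((px j u t x).re * (px j u t x).im + (u t x).re * (px j (px j u) t x).im)))
    (c := c) (d := d) (K := 3 * K) ?_ ?_ ?_ ?_ ?_ ?_ ?_ ?_ ?_ ?_ ?_ ?_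
  · have e : ∀ t ∈ Set.uIcc c d,
        ∫ x, ((u t x).re * (u t x).re + (u t x).im * (u t x).im) = ∫ x, ‖U t x‖ ^ 2 := by
      intro t ht
      congr 1 with x
      rw [← h.coe t (hcd ht), norm_sq_eq_re_add_im]
      ring
    simp only [integral_zero, intervalIntegral.integral_zero] at key
    rw [e c Set.left_mem_uIcc, e d Set.right_mem_uIcc] at key
    linarith
  · have := hu.continuous
    simp only [Function.uncurry_def]
    fun_prop
  · have := hu.continuous
    have := hu.pt.continuous
    simp only [Function.uncurry_def]
    fun_prop
  · intro t x
    exact ((hu.hasDerivAt_re t x).mul (hu.hasDerivAt_re t x)).add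
      ((hu.hasDerivAt_im t x).mul (hu.hasDerivAt_im t x))
  · intro j t _
    have h1 := hu.continuous_comp (continuous_const (y := t)) continuous_id
    have h2 := (hu.px j).continuous_comp (continuous_const (y := t)) continuous_id
    simp only [id] at h1 h2
    fun_prop
  · intro j t _
    have h1 := hu.continuous_comp (continuous_const (y := t)) continuous_id
    have h2 := (hu.px j).continuous_comp (continuous_const (y := t)) continuous_id
    have h3 := ((hu.px j).px j).continuous_comp (continuous_const (y := t)) continuous_id
    simp only [id] at h1 h2 h3
    fun_prop
  · intro j t _ x
    have h1 := hu.hasLineDerivAt j t x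
    have h2 := (hu.px j).hasLineDerivAt j t x
    exact hasLineDerivAt_const_mul _ (hasLineDerivAt_sub
      (hasLineDerivAt_mul (hasLineDerivAt_im h1) (hasLineDerivAt_re h2))
      (hasLineDerivAt_mul (hasLineDerivAt_re h1) (hasLineDerivAt_im h2)))
  · intro t ht x
    rw [h.pt_re (hcd ht), h.pt_im (hcd ht)]
    simp only [Fin.sum_univ_three]
    ring
  · exact hI c Set.left_mem_uIcc
  · exact hI d Set.right_mem_uIcc
  · exact fun _ _ => integrable_zero _ _ _
  · intro t ht
    have := (hK t ht).nonneg
    simpa using this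
  · intro j t ht R hR
    have hg : Integrable fun x => ‖U t x‖ ^ 2 + ‖dS j (U t) x‖ ^ 2 :=
      ((U t).integrable_norm_pow two_ne_zero).add ((dS j (U t)).integrable_norm_pow two_ne_zero)
    refine (setIntegral_le_integral_of_norm_le hg fun x => ?_).trans ?_
    · rw [← h.px_coe (hcd ht), ← h.coe t (hcd ht), norm_mul, Real.norm_eq_abs, Real.norm_eq_abs,
        abs_two]
      nlinarith [abs_im_mul_re_sub_le (u t x) (px j u t x), sq_nonneg (‖u t x‖ - ‖px j u t x‖)]
    · rw [integral_add ((U t).integrable_norm_pow two_ne_zero)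
        ((dS j (U t)).integrable_norm_pow two_ne_zero)]
      have h1 := (hK t ht).mass
      have h2 := (hK t ht).integral_sq_dS_le j
      have h3 := (hK t ht).nonneg
      nlinarith [one_le_rpow_three_fourths hR]

theorem energy_eq (h : SchwartzSolution T u U) {c d K : ℝ} (hcd : Set.uIcc c d ⊆ Set.Icc 0 T)
    (hK : ∀ t ∈ Set.uIcc c d, RegBound (U t) K) : energy (U d) = energy (U c) := by
  have hu := h.smooth
  have hI4 : ∀ t, Integrable fun x => ‖U t x‖ ^ 4 := fun t =>
    (U t).integrable_norm_pow (by norm_num)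
  have hI2 : ∀ j t, Integrable fun x => ‖dS j (U t) x‖ ^ 2 := fun j t =>
    (dS j (U t)).integrable_norm_pow two_ne_zero
  have hq : ∀ t ∈ Set.uIcc c d, ∀ x,
      2⁻¹ * (∑ j, ‖dS j (U t) x‖ ^ 2) + 4⁻¹ * ‖U t x‖ ^ 4
      = 2⁻¹ * (∑ j, ((px j u t x).re * (px j u t x).re + (px j u t x).im * (px j u t x).im))
        + 4⁻¹ * (((u t x).re * (u t x).re + (u t x).im * (u t x).im)
          * ((u t x).re * (u t x).re + (u t x).im * (u t x).im)) := by
    intro t ht x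
    have e : ‖U t x‖ ^ 4 = (‖U t x‖ ^ 2) ^ 2 := by ring
    rw [e, ← h.coe t (hcd ht), norm_sq_eq_re_add_im]
    simp only [← h.px_coe (hcd ht), norm_sq_eq_re_add_im, Fin.sum_univ_three]
    ring
  have hI : ∀ t, Integrable
      fun x => 2⁻¹ * (∑ j, ‖dS j (U t) x‖ ^ 2) + 4⁻¹ * ‖U t x‖ ^ 4 := fun t =>
    ((integrable_finsetSum _ fun j _ => hI2 j t).const_mul _).add ((hI4 t).const_mul _)
  have hE : ∀ t ∈ Set.uIcc c d, ∫ x,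
      (2⁻¹ * (∑ j, ((px j u t x).re * (px j u t x).re + (px j u t x).im * (px j u t x).im))
        + 4⁻¹ * (((u t x).re * (u t x).re + (u t x).im * (u t x).im)
          * ((u t x).re * (u t x).re + (u t x).im * (u t x).im))) = energy (U t) := by
    intro t ht
    simp only [← hq t ht]
    rw [integral_add ((integrable_finsetSum _ fun j _ => hI2 j t).const_mul _)
      ((hI4 t).const_mul _), integral_const_mul, integral_const_mul, energy]
    simp only [pd_coe]
    norm_num
  have key := integral_sub_integral_of_conservation_law (volume : Measure E3)
    (v := fun j : Fin 3 => EuclideanSpace.single j (1 : ℝ))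
    (q := fun t x => 2⁻¹ * (∑ j, ((px j u t x).re * (px j u t x).re
          + (px j u t x).im * (px j u t x).im))
        + 4⁻¹ * (((u t x).re * (u t x).re + (u t x).im * (u t x).im)
          * ((u t x).re * (u t x).re + (u t x).im * (u t x).im)))
    (q' := fun t x => (∑ j, ((px j u t x).re * (px j (pt u) t x).re
          + (px j u t x).im * (px j (pt u) t x).im))
        + ((u t x).re * (u t x).re + (u t x).im * (u t x).im)
          * ((u t x).re * (pt u t x).re + (u t x).im * (pt u t x).im))
    (r := fun _ _ => 0)
    (V := fun j t x => (pt u t x).re * (px j u t x).re + (pt u t x).im * (px j u t x).im)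
    (V' := fun j t x => ((px j (pt u) t x).re * (px j u t x).re
        + (pt u t x).re * (px j (px j u) t x).re)
      + ((px j (pt u) t x).im * (px j u t x).im + (pt u t x).im * (px j (px j u) t x).im))
    (c := c) (d := d)
    (K := 3 * ((4 * (1 + K)) ^ 4 + 2 * K + 8 * volume.real (Metric.ball (0 : E3) 1))
      + (4 * (1 + K)) ^ 4 + (8 * (1 + K)) ^ 4) ?_ ?_ ?_ ?_ ?_ ?_ ?_ ?_ ?_ ?_ ?_ ?_
  · simp only [integral_zero, intervalIntegral.integral_zero] at key
    rw [hE c Set.left_mem_uIcc, hE d Set.right_mem_uIcc] at key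
    linarith
  · have := hu.continuous
    have := fun j => (hu.px j).continuous
    simp only [Function.uncurry_def]
    fun_prop
  · have := hu.continuous
    have := hu.pt.continuous
    have := fun j => (hu.px j).continuous
    have := fun j => (hu.pt.px j).continuous
    simp only [Function.uncurry_def]
    fun_prop
  · intro t x
    have h1 : ∀ j, HasDerivAt (fun t => (px j u t x).re * (px j u t x).re
        + (px j u t x).im * (px j u t x).im)
        (2 * ((px j u t x).re * (px j (pt u) t x).re
          + (px j u t x).im * (px j (pt u) t x).im)) t := by
      intro j
      refine ((((hu.px j).hasDerivAt_re t x).mul ((hu.px j).hasDerivAt_re t x)).add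
        (((hu.px j).hasDerivAt_im t x).mul ((hu.px j).hasDerivAt_im t x))).congr_deriv ?_
      rw [hu.pt_px]
      ring
    have h2 : HasDerivAt (fun t => (u t x).re * (u t x).re + (u t x).im * (u t x).im)
        (2 * ((u t x).re * (pt u t x).re + (u t x).im * (pt u t x).im)) t := by
      refine (((hu.hasDerivAt_re t x).mul (hu.hasDerivAt_re t x)).add
        ((hu.hasDerivAt_im t x).mul (hu.hasDerivAt_im t x))).congr_deriv ?_
      ring
    refine (((HasDerivAt.fun_sum fun j _ => h1 j).const_mul 2⁻¹).add
      ((h2.mul h2).const_mul 4⁻¹)).congr_deriv ?_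
    rw [← Finset.mul_sum]
    ring
  · intro j t _
    have h1 := hu.pt.continuous_comp (continuous_const (y := t)) continuous_id
    have h2 := (hu.px j).continuous_comp (continuous_const (y := t)) continuous_id
    simp only [id] at h1 h2
    fun_prop
  · intro j t _
    have h1 := hu.pt.continuous_comp (continuous_const (y := t)) continuous_id
    have h2 := (hu.px j).continuous_comp (continuous_const (y := t)) continuous_id
    have h3 := ((hu.px j).px j).continuous_comp (continuous_const (y := t)) continuous_id
    have h4 := (hu.pt.px j).continuous_comp (continuous_const (y := t)) continuous_id
    simp only [id] at h1 h2 h3 h4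
    fun_prop
  · intro j t _ x
    have h1 := hu.pt.hasLineDerivAt j t x
    have h2 := (hu.px j).hasLineDerivAt j t x
    exact hasLineDerivAt_add
      (hasLineDerivAt_mul (hasLineDerivAt_re h1) (hasLineDerivAt_re h2))
      (hasLineDerivAt_mul (hasLineDerivAt_im h1) (hasLineDerivAt_im h2))
  · intro t ht x
    have e1 := h.pt_re (hcd ht) x
    have e2 := h.pt_im (hcd ht) x
    simp only [Fin.sum_univ_three] at e1 e2 ⊢
    linear_combination (-(pt u t x).im) * e1 + (pt u t x).re * e2
  · exact (hI c).congr (Filter.Eventually.of_forall (hq c Set.left_mem_uIcc))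
  · exact (hI d).congr (Filter.Eventually.of_forall (hq d Set.right_mem_uIcc))
  · exact fun _ _ => integrable_zero _ _ _
  · intro t ht
    have := (hK t ht).nonneg
    simp only [norm_zero, integral_zero]
    positivity
  · intro j t ht R hR
    have hL := one_le_rpow_three_fourths hR
    have hK0 := (hK t ht).nonneg
    have hb : ∀ k, ∫ x in Metric.ball 0 (2 * R), ‖dS k (dS k (U t)) x‖ * ‖dS j (U t) x‖
        ≤ ((4 * (1 + K)) ^ 4 + 2 * K + 8 * volume.real (Metric.ball (0 : E3) 1))
          * R ^ (3/4 : ℝ) := fun k => by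
      refine (setIntegral_ball_mul_le (fun x => norm_nonneg _) (fun x => norm_nonneg _)
        ((dS k (dS k (U t))).integrable_norm_pow (by norm_num)) (hI2 j t) hR).trans ?_
      gcongr
      · exact integral_pow_four_le_of_nFour_le ((hK t ht).nFour_le k).2.1
      · exact (hK t ht).integral_sq_dS_le j
    have hi : ∀ k, Integrable fun x => ‖dS k (dS k (U t)) x‖ * ‖dS j (U t) x‖ := fun k => by
      simpa using (mulS (dS k (dS k (U t))) (dS j (U t))).integrable.norm
    have hg : Integrable fun x => ‖U t x‖ ^ 4 + ‖dS j (U t) x‖ ^ 4 :=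
      (hI4 t).add ((dS j (U t)).integrable_norm_pow (by norm_num))
    have hpt : ∀ x, ‖pt u t x‖ ≤ (∑ k, ‖dS k (dS k (U t)) x‖) + ‖U t x‖ ^ 3 := fun x => by
      rw [h.eq t (hcd ht), norm_mul, Complex.norm_I, one_mul]
      refine (norm_sub_le _ _).trans (add_le_add ?_ ?_)
      · simp only [h.px_px_coe (hcd ht)]
        exact norm_sum_le _ _
      · rw [norm_mul, norm_pow, Complex.norm_real, norm_norm, ← h.coe t (hcd ht)]
        exact (pow_succ _ 2).ge
    have hbd : ∀ x, ‖(pt u t x).re * (px j u t x).re + (pt u t x).im * (px j u t x).im‖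
        ≤ (∑ k, ‖dS k (dS k (U t)) x‖ * ‖dS j (U t) x‖)
          + (‖U t x‖ ^ 4 + ‖dS j (U t) x‖ ^ 4) := fun x => by
      refine (abs_re_mul_re_add_le _ _).trans ?_
      rw [h.px_coe (hcd ht)]
      refine (mul_le_mul_of_nonneg_right (hpt x) (norm_nonneg _)).trans ?_
      rw [add_mul, Finset.sum_mul]
      gcongr
      have e1 := norm_nonneg (U t x)
      have e2 := norm_nonneg (dS j (U t) x)
      rcases le_total ‖U t x‖ ‖dS j (U t) x‖ with e | e
      · have := mul_le_mul_of_nonneg_right (pow_le_pow_left₀ e1 e 3) e2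
        nlinarith [pow_nonneg e1 4]
      · have := mul_le_mul_of_nonneg_left e (pow_nonneg e1 3)
        nlinarith [pow_nonneg e2 4]
    have hs : Integrable (fun x => ∑ k, ‖dS k (dS k (U t)) x‖ * ‖dS j (U t) x‖) :=
      integrable_finsetSum _ fun k _ => hi k
    have hg4 : ∫ x in Metric.ball 0 (2 * R), (‖U t x‖ ^ 4 + ‖dS j (U t) x‖ ^ 4)
        ≤ (4 * (1 + K)) ^ 4 + (8 * (1 + K)) ^ 4 := by
      refine (setIntegral_le_integral hg
        (Filter.Eventually.of_forall fun x => by positivity)).trans ?_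
      rw [integral_add (hI4 t) ((dS j (U t)).integrable_norm_pow (by norm_num))]
      exact add_le_add (integral_pow_four_le_of_nFour_le ((hK t ht).nFour_le j).1)
        (integral_pow_four_le_of_nFour_le ((hK t ht).nFour_le j).2.2)
    have hsg : IntegrableOn (fun x => (∑ k, ‖dS k (dS k (U t)) x‖ * ‖dS j (U t) x‖)
        + (‖U t x‖ ^ 4 + ‖dS j (U t) x‖ ^ 4)) (Metric.ball 0 (2 * R)) := (hs.add hg).integrableOn
    calc _ ≤ ∫ x in Metric.ball 0 (2 * R), ((∑ k, ‖dS k (dS k (U t)) x‖ * ‖dS j (U t) x‖)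
          + (‖U t x‖ ^ 4 + ‖dS j (U t) x‖ ^ 4)) :=
          integral_mono_of_nonneg (Filter.Eventually.of_forall fun x => norm_nonneg _)
            hsg (Filter.Eventually.of_forall hbd)
      _ = (∑ k, ∫ x in Metric.ball 0 (2 * R), ‖dS k (dS k (U t)) x‖ * ‖dS j (U t) x‖)
          + ∫ x in Metric.ball 0 (2 * R), (‖U t x‖ ^ 4 + ‖dS j (U t) x‖ ^ 4) := by
          rw [integral_add hs.integrableOn hg.integrableOn,
            integral_finsetSum _ fun k _ => (hi k).integrableOn]
      _ ≤ (∑ _k : Fin 3, ((4 * (1 + K)) ^ 4 + 2 * K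
            + 8 * volume.real (Metric.ball (0 : E3) 1)) * R ^ (3/4 : ℝ))
          + ((4 * (1 + K)) ^ 4 + (8 * (1 + K)) ^ 4) :=
          add_le_add (Finset.sum_le_sum fun k _ => hb k) hg4
      _ ≤ _ := by
          have h0 : 0 ≤ (4 * (1 + K)) ^ 4 + (8 * (1 + K)) ^ 4 := by positivity
          simp only [Finset.sum_const, Finset.card_univ, Fintype.card_fin, nsmul_eq_mul]
          push_cast
          nlinarith [mul_le_mul_of_nonneg_left hL h0]

end SchwartzSolution

namespace SchwartzSolution

variable {T : ℝ} {u : ℝ → E3 → ℂ} {U : ℝ → S3}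

theorem integral_mul_freeFlow_sub (h : SchwartzSolution T u U) {c d K : ℝ}
    (hcd : Set.uIcc c d ⊆ Set.Icc 0 T) (hK : ∀ t ∈ Set.uIcc c d, RegBound (U t) K)
    (σ : ℝ) (ψ : S3) :
    (∫ x, U d x * freeFlow (σ - d) ψ x) - ∫ x, U c x * freeFlow (σ - c) ψ x
      = ∫ t in c..d, ∫ x, -(I * (mulS (mulS (U t) (U t)) (conjS (U t)) x
          * freeFlow (σ - t) ψ x)) := by
  have hu := h.smooth
  have hK0 : 0 ≤ K := (hK c Set.left_mem_uIcc).nonneg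
  have hN : ∀ t x, mulS (mulS (U t) (U t)) (conjS (U t)) x = (‖U t x‖ : ℂ) ^ 2 * U t x := by
    intro t x
    rw [mulS_apply, mulS_apply, conjS_apply, mul_assoc, Complex.mul_conj', mul_comm]
  have hθ : ∀ s : ℝ, HasDerivAt (fun s => σ - s) (-1) s := fun s => by
    simpa using (hasDerivAt_id s).const_sub σ
  have hφc : Continuous fun p : ℝ × E3 => freeFlow (σ - p.1) ψ p.2 :=
    continuous_freeFlow (by fun_prop) continuous_snd ψ
  have hlc : Continuous fun p : ℝ × E3 => lapS (freeFlow (σ - p.1) ψ) p.2 := by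
    simp only [← freeFlow_lapS]
    exact continuous_freeFlow (by fun_prop) continuous_snd _
  have hM := (ψ.integrable_norm_pow two_ne_zero)
  set A := ∫ ξ, ‖𝓕 ψ ξ‖ with hA
  have hA0 : 0 ≤ A := integral_nonneg fun _ => norm_nonneg _
  set M := ∫ x, ‖ψ x‖ ^ 2 with hMd
  have hM0 : 0 ≤ M := integral_nonneg fun _ => by positivity
  set M' := ∑ j, ∫ x, ‖dS j ψ x‖ ^ 2 with hMd'
  have hM0' : 0 ≤ M' := Finset.sum_nonneg fun j _ => integral_nonneg fun _ => by positivity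
  have hI2 : ∀ f : S3, Integrable fun x => ‖f x‖ ^ 2 := fun f => f.integrable_norm_pow two_ne_zero
  have hIadd : ∀ f g : S3, Integrable fun x => ‖f x‖ ^ 2 + ‖g x‖ ^ 2 := fun f g =>
    (hI2 f).add (hI2 g)
  have hI4 : ∀ f : S3, Integrable fun x => ‖f x‖ ^ 4 := fun f =>
    f.integrable_norm_pow (by norm_num)
  have key := integral_sub_integral_of_conservation_law (volume : Measure E3)
    (v := fun j : Fin 3 => EuclideanSpace.single j (1 : ℝ))
    (q := fun t x => u t x * freeFlow (σ - t) ψ x)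
    (q' := fun t x => pt u t x * freeFlow (σ - t) ψ x
      + u t x * (((-1 : ℝ) : ℂ) * I * lapS (freeFlow (σ - t) ψ) x))
    (r := fun t x => -(I * (mulS (mulS (U t) (U t)) (conjS (U t)) x * freeFlow (σ - t) ψ x)))
    (V := fun j t x => I * (px j u t x * freeFlow (σ - t) ψ x
      - u t x * dS j (freeFlow (σ - t) ψ) x))
    (V' := fun j t x => I * ((px j (px j u) t x * freeFlow (σ - t) ψ x
        + px j u t x * dS j (freeFlow (σ - t) ψ) x)
      - (px j u t x * dS j (freeFlow (σ - t) ψ) x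
        + u t x * dS j (dS j (freeFlow (σ - t) ψ)) x)))
    (c := c) (d := d) (K := 5 * A * K + (3 * K + M + M')) ?_ ?_ ?_ ?_ ?_ ?_ ?_ ?_ ?_ ?_ ?_ ?_
  · simpa only [h.coe c (hcd Set.left_mem_uIcc), h.coe d (hcd Set.right_mem_uIcc)] using key
  · have := hu.continuous
    simp only [Function.uncurry_def]
    fun_prop
  · have := hu.continuous
    have := hu.pt.continuous
    simp only [Function.uncurry_def]
    fun_prop
  · intro t x
    exact (hu.hasDerivAt t x).mul (hasDerivAt_freeFlow hθ ψ x t)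
  · intro j t _
    have h1 := hu.continuous_comp (continuous_const (y := t)) continuous_id
    have h2 := (hu.px j).continuous_comp (continuous_const (y := t)) continuous_id
    simp only [id] at h1 h2
    fun_prop
  · intro j t _
    have h1 := hu.continuous_comp (continuous_const (y := t)) continuous_id
    have h2 := (hu.px j).continuous_comp (continuous_const (y := t)) continuous_id
    have h3 := ((hu.px j).px j).continuous_comp (continuous_const (y := t)) continuous_id
    simp only [id] at h1 h2 h3
    fun_prop
  · intro j t _ x
    exact hasLineDerivAt_const_mul _ (hasLineDerivAt_sub
      (hasLineDerivAt_mul ((hu.px j).hasLineDerivAt j t x) (hasLineDerivAt_dS j _ x))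
      (hasLineDerivAt_mul (hu.hasLineDerivAt j t x) (hasLineDerivAt_dS j _ x)))
  · intro t ht x
    have e : lapS (freeFlow (σ - t) ψ) x = ∑ j, dS j (dS j (freeFlow (σ - t) ψ)) x :=
      sum_apply _ _ _
    rw [h.eq t (hcd ht), hN, e, h.coe t (hcd ht)]
    simp only [Fin.sum_univ_three]
    push_cast
    ring
  · rw [h.coe c (hcd Set.left_mem_uIcc)]
    exact integrable_mul _ _
  · rw [h.coe d (hcd Set.right_mem_uIcc)]
    exact integrable_mul _ _
  · intro t _
    exact ((integrable_mul _ _).const_mul _).neg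
  · intro t ht
    have hb : ∀ x, ‖-(I * (mulS (mulS (U t) (U t)) (conjS (U t)) x * freeFlow (σ - t) ψ x))‖
        ≤ A * (‖U t x‖ ^ 2 + ‖U t x‖ ^ 4) := fun x => by
      rw [norm_neg, norm_mul, Complex.norm_I, one_mul, hN, norm_mul, norm_mul, norm_pow,
        Complex.norm_real, norm_norm, mul_comm]
      refine mul_le_mul (norm_freeFlow_le _ _ _) ?_ (by positivity) hA0
      nlinarith [norm_nonneg (U t x), sq_nonneg (‖U t x‖ * (‖U t x‖ - 1)), sq_nonneg (‖U t x‖),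
        pow_nonneg (norm_nonneg (U t x)) 4]
    refine (integral_mono_of_nonneg (Filter.Eventually.of_forall fun x => norm_nonneg _)
      (((hI2 (U t)).add (hI4 (U t))).const_mul A) (Filter.Eventually.of_forall hb)).trans ?_
    simp only [Pi.add_apply]
    rw [integral_const_mul, integral_add (hI2 _) (hI4 _)]
    have h1 := (hK t ht).mass
    have h2 := integral_pow_four_le_energy (U t)
    have h3 := (hK t ht).energy
    have : (∫ x, ‖U t x‖ ^ 2) + ∫ x, ‖U t x‖ ^ 4 ≤ 5 * K := by linarith
    nlinarith [mul_le_mul_of_nonneg_left this hA0]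
  · intro j t ht R hR
    have hg : Integrable fun x => (‖U t x‖ ^ 2 + ‖dS j (U t) x‖ ^ 2)
        + (‖freeFlow (σ - t) ψ x‖ ^ 2 + ‖dS j (freeFlow (σ - t) ψ) x‖ ^ 2) :=
      (hIadd _ _).add (hIadd _ _)
    refine (setIntegral_le_integral_of_norm_le hg fun x => ?_).trans ?_
    · rw [h.px_coe (hcd ht), h.coe t (hcd ht), norm_mul, Complex.norm_I, one_mul]
      refine (norm_sub_le _ _).trans ?_
      rw [norm_mul, norm_mul]
      nlinarith [sq_nonneg (‖U t x‖ - ‖dS j (freeFlow (σ - t) ψ) x‖),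
        sq_nonneg (‖dS j (U t) x‖ - ‖freeFlow (σ - t) ψ x‖), sq_nonneg (‖U t x‖),
        sq_nonneg (‖dS j (U t) x‖), sq_nonneg ‖freeFlow (σ - t) ψ x‖,
        sq_nonneg ‖dS j (freeFlow (σ - t) ψ) x‖]
    · rw [integral_add (hIadd _ _) (hIadd _ _),
        integral_add (hI2 _) (hI2 _), integral_add (hI2 _) (hI2 _), ← freeFlow_dS,
        integral_norm_sq_freeFlow, integral_norm_sq_freeFlow]
      have h1 := (hK t ht).mass
      have h2 := (hK t ht).integral_sq_dS_le j
      have h3 : ∫ x, ‖dS j ψ x‖ ^ 2 ≤ M' :=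
        Finset.single_le_sum (f := fun j => ∫ x, ‖dS j ψ x‖ ^ 2)
          (fun i _ => integral_nonneg fun _ => by positivity) (Finset.mem_univ j)
      have h4 : 0 ≤ 5 * A * K := by positivity
      nlinarith [one_le_rpow_three_fourths hR]

end SchwartzSolution

theorem norm_dS_dS_cube_le (j : Fin 3) (g : S3) (x : E3) :
    ‖dS j (dS j (mulS (mulS g g) (conjS g))) x‖
      ≤ 3 * (‖g x‖ ^ 2 * ‖dS j (dS j g) x‖) + 6 * (‖dS j g x‖ ^ 2 * ‖g x‖) := by
  have e : dS j (dS j (mulS (mulS g g) (conjS g))) x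
      = 2 * (g x * dS j (dS j g) x * (starRingEnd ℂ) (g x))
        + g x * g x * (starRingEnd ℂ) (dS j (dS j g) x)
        + (2 * (dS j g x * dS j g x * (starRingEnd ℂ) (g x))
        + 4 * (g x * dS j g x * (starRingEnd ℂ) (dS j g x))) := by
    have hadd : ∀ a b : S3, dS j (a + b) = dS j a + dS j b := fun a b =>
      LineDeriv.lineDerivOp_add _ a b
    simp only [dS_mulS, dS_conjS, hadd, add_apply, mulS_apply, conjS_apply]
    ring
  rw [e]
  refine (norm_add_le _ _).trans (add_le_add ((norm_add_le _ _).trans ?_)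
    ((norm_add_le _ _).trans ?_))
  · simp only [norm_mul, RCLike.norm_conj, Complex.norm_ofNat]
    linarith
  · simp only [norm_mul, RCLike.norm_conj, Complex.norm_ofNat]
    linarith

theorem norm_integral_dS_dS_cube_mul_le (j : Fin 3) (g φ : S3) :
    ‖∫ x, dS j (dS j (mulS (mulS g g) (conjS g))) x * φ x‖
      ≤ 21 * (nFour g ^ 2 * (nFour (dS j (dS j g)) * nFour φ)) := by
  have hi : ∀ a b c : S3, Integrable fun x => ‖a x‖ ^ 2 * (‖b x‖ * ‖c x‖) := fun a b c => by
    simpa [pow_two] using ((mulS (mulS a a) (mulS b c)).integrable (μ := volume)).norm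
  calc ‖∫ x, dS j (dS j (mulS (mulS g g) (conjS g))) x * φ x‖
      ≤ ∫ x, (3 * (‖g x‖ ^ 2 * (‖dS j (dS j g) x‖ * ‖φ x‖))
          + 6 * (‖dS j g x‖ ^ 2 * (‖g x‖ * ‖φ x‖))) := by
        refine norm_integral_le_of_norm_le (((hi _ _ _).const_mul 3).add ((hi _ _ _).const_mul 6))
          (Filter.Eventually.of_forall fun x => ?_)
        rw [norm_mul]
        refine (mul_le_mul_of_nonneg_right (norm_dS_dS_cube_le j g x) (norm_nonneg _)).trans ?_
        linarith
    _ ≤ 3 * (nFour g ^ 2 * (nFour (dS j (dS j g)) * nFour φ))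
          + 6 * (nFour (dS j g) ^ 2 * (nFour g * nFour φ)) := by
        rw [integral_add ((hi _ _ _).const_mul 3) ((hi _ _ _).const_mul 6), integral_const_mul,
          integral_const_mul]
        gcongr
        · exact integral_norm_sq_mul_mul_le _ _ _
        · exact integral_norm_sq_mul_mul_le _ _ _
    _ ≤ _ := by
        have := mul_le_mul_of_nonneg_right (nFour_dS_sq_le j g)
          (mul_nonneg (nFour_nonneg g) (nFour_nonneg φ))
        linarith

theorem intervalIntegrable_abs_rpow {r : ℝ} (hr : -1 < r) (a b : ℝ) :
    IntervalIntegrable (fun t : ℝ => |t| ^ r) volume a b := by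
  have hpos : ∀ c : ℝ, 0 ≤ c → IntervalIntegrable (fun t : ℝ => |t| ^ r) volume 0 c := by
    intro c hc
    refine (intervalIntegral.intervalIntegrable_rpow' hr (a := 0) (b := c)).congr ?_
    intro t ht
    rw [Set.uIoc_of_le hc] at ht
    simp only [abs_of_pos ht.1]
  have h0 : ∀ c : ℝ, IntervalIntegrable (fun t : ℝ => |t| ^ r) volume 0 c := by
    intro c
    rcases le_total 0 c with hc | hc
    · exact hpos c hc
    · simpa using (hpos (-c) (by linarith)).comp_sub_left 0
  exact (h0 a).symm.trans (h0 b)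

theorem integral_abs_rpow_le_of_nonneg {a b : ℝ} (ha : 0 ≤ a) (hab : a ≤ b) :
    ∫ t in a..b, |t| ^ (-(3/4) : ℝ) ≤ 4 * (b - a) ^ (1/4 : ℝ) := by
  have e : ∫ t in a..b, |t| ^ (-(3/4) : ℝ) = ∫ t in a..b, t ^ (-(3/4) : ℝ) := by
    refine intervalIntegral.integral_congr fun t ht => ?_
    rw [Set.uIcc_of_le hab] at ht
    simp only [abs_of_nonneg (ha.trans ht.1)]
  rw [e, integral_rpow (Or.inl (by norm_num))]
  have h := Real.rpow_add_le_add_rpow ha (sub_nonneg.2 hab) (p := 1/4) (by norm_num) (by norm_num)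
  rw [add_sub_cancel] at h
  norm_num at h ⊢
  linarith

theorem integral_abs_rpow_le {a b : ℝ} (hab : a ≤ b) :
    ∫ t in a..b, |t| ^ (-(3/4) : ℝ) ≤ 8 * (b - a) ^ (1/4 : ℝ) := by
  have hneg : ∀ a b : ℝ, ∫ t in a..b, |t| ^ (-(3/4) : ℝ) = ∫ t in -b..-a, |t| ^ (-(3/4) : ℝ) := by
    intro a b
    rw [← intervalIntegral.integral_comp_neg]
    simp only [abs_neg]
  have hL : 0 ≤ (b - a) ^ (1/4 : ℝ) := Real.rpow_nonneg (by linarith) _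
  rcases le_total 0 a with ha | ha
  · exact (integral_abs_rpow_le_of_nonneg ha hab).trans (by linarith)
  rcases le_total b 0 with hb | hb
  · rw [hneg]
    have := integral_abs_rpow_le_of_nonneg (a := -b) (b := -a) (by linarith) (by linarith)
    rw [neg_sub_neg] at this
    linarith
  · rw [← intervalIntegral.integral_add_adjacent_intervals
      (intervalIntegrable_abs_rpow (by norm_num) a 0)
      (intervalIntegrable_abs_rpow (by norm_num) 0 b),
      hneg a 0]
    have h1 := integral_abs_rpow_le_of_nonneg (a := -0) (b := -a) (by simp) (by linarith)
    have h2 := integral_abs_rpow_le_of_nonneg le_rfl hb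
    have h3 : (-a - -0) ^ (1/4 : ℝ) ≤ (b - a) ^ (1/4 : ℝ) :=
      Real.rpow_le_rpow (by linarith) (by linarith) (by norm_num)
    have h4 : (b - 0) ^ (1/4 : ℝ) ≤ (b - a) ^ (1/4 : ℝ) :=
      Real.rpow_le_rpow (by linarith) (by linarith) (by norm_num)
    linarith

theorem norm_integral_le_of_norm_le_abs_sub_rpow {F : Type*} [NormedAddCommGroup F]
    [NormedSpace ℝ F] {f : ℝ → F} {c d x B : ℝ} (hB : 0 ≤ B)
    (h : ∀ t ∈ Set.uIcc c d, t ≠ x → ‖f t‖ ≤ B * |x - t| ^ (-(3/4) : ℝ)) :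
    ‖∫ t in c..d, f t‖ ≤ B * (8 * |d - c| ^ (1/4 : ℝ)) := by
  wlog hcd : c ≤ d generalizing c d
  · rw [intervalIntegral.integral_symm, norm_neg, abs_sub_comm]
    exact this (by rwa [Set.uIcc_comm]) (le_of_not_ge hcd)
  have hi : IntervalIntegrable (fun t => |x - t| ^ (-(3/4) : ℝ)) volume c d := by
    simpa using (intervalIntegrable_abs_rpow (r := -(3/4)) (by norm_num)
      (x - c) (x - d)).comp_sub_left x
  refine (intervalIntegral.norm_integral_le_of_norm_le hcd (g := fun t =>
    B * |x - t| ^ (-(3/4) : ℝ)) ?_ (hi.const_mul B)).trans ?_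
  · have hx : ∀ᵐ t : ℝ, t ≠ x := by simp [ae_iff]
    filter_upwards [hx] with t ht hI
    exact h t (Set.Ioc_subset_Icc_self.trans Set.Icc_subset_uIcc hI) ht
  · rw [intervalIntegral.integral_const_mul, abs_of_nonneg (sub_nonneg.2 hcd)]
    refine mul_le_mul_of_nonneg_left ?_ hB
    have := integral_abs_rpow_le (a := x - d) (b := x - c) (by linarith)
    rw [intervalIntegral.integral_comp_sub_left (fun t => |t| ^ (-(3/4) : ℝ))]
    rwa [sub_sub_sub_cancel_left] at this

theorem nFour_sq_le_of_energy_le {g : S3} {e : ℝ} (h : energy g ≤ e) :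
    nFour g ^ 2 ≤ 2 * (1 + e) := by
  have h0 := (energy_nonneg g).trans h
  refine le_of_sq_le_sq ?_ (by positivity)
  rw [← pow_mul, nFour_pow_four]
  have := integral_pow_four_le_energy g
  nlinarith

namespace SchwartzSolution

variable {T : ℝ} {u : ℝ → E3 → ℂ} {U : ℝ → S3}

theorem freeBound_of_freeBound (h : SchwartzSolution T u U) {c d K e B k : ℝ}
    (hcd : Set.uIcc c d ⊆ Set.Icc 0 T) (hK : ∀ t ∈ Set.uIcc c d, RegBound (U t) K)
    (he : ∀ t ∈ Set.uIcc c d, _root_.energy (U t) ≤ e) (hB0 : 0 ≤ B) (j : Fin 3)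
    (hB : ∀ t ∈ Set.uIcc c d, FreeBound (dS j (dS j (U t))) B)
    (hk : FreeBound (dS j (dS j (U c))) k) :
    FreeBound (dS j (dS j (U d))) (k + 336 * (1 + e) * |d - c| ^ (1/4 : ℝ) * B) := by
  intro s ψ
  have he0 : 0 ≤ e := (energy_nonneg _).trans (he c Set.left_mem_uIcc)
  have key := h.integral_mul_freeFlow_sub hcd hK (s + d) (dS j (dS j ψ))
  simp only [freeFlow_dS, integral_mul_dS_dS] at key
  rw [add_sub_cancel_right, sub_eq_iff_eq_add] at key
  rw [key]
  have hI : ‖∫ t in c..d, ∫ x, -(I * (mulS (mulS (U t) (U t)) (conjS (U t)) x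
      * dS j (dS j (freeFlow (s + d - t) ψ)) x))‖
      ≤ 42 * (1 + e) * B * nFourThirds ψ * (8 * |d - c| ^ (1/4 : ℝ)) := by
    have hψ := nFourThirds_nonneg ψ
    refine norm_integral_le_of_norm_le_abs_sub_rpow (x := s + d) (by positivity) fun t ht hts => ?_
    rw [integral_neg, norm_neg, integral_const_mul, norm_mul, Complex.norm_I, one_mul,
      integral_mul_dS_dS]
    refine (norm_integral_dS_dS_cube_mul_le j _ _).trans ?_
    have h1 := nFour_sq_le_of_energy_le (he t ht)
    have h2 := (hB t ht).nFour_le hB0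
    have h3 := nFour_freeFlow_le (sub_ne_zero.2 (Ne.symm hts)) ψ
    calc 21 * (nFour (U t) ^ 2 * (nFour (dS j (dS j (U t))) * nFour (freeFlow (s + d - t) ψ)))
        ≤ 21 * ((2 * (1 + e)) * (B * (|s + d - t| ^ (-(3/4) : ℝ) * nFourThirds ψ))) := by
          have := nFour_nonneg (dS j (dS j (U t)))
          have := nFour_nonneg (freeFlow (s + d - t) ψ)
          gcongr
      _ = _ := by ring
  refine (norm_add_le _ _).trans ((add_le_add hI (hk _ ψ)).trans (le_of_eq ?_))
  ring

end SchwartzSolution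

/-- A time step on which the regularity bound at most doubles, in terms of the energy. -/
def stepSize (e : ℝ) : ℝ := (1 / (672 * (1 + e))) ^ 4

theorem stepSize_pos {e : ℝ} (he : 0 ≤ e) : 0 < stepSize e := by
  unfold stepSize
  positivity

theorem mul_rpow_le_of_le_stepSize {e L : ℝ} (he : 0 ≤ e) (hL0 : 0 ≤ L) (hL : L ≤ stepSize e) :
    336 * (1 + e) * L ^ (1/4 : ℝ) ≤ 1 / 2 := by
  have h1 : L ^ (1/4 : ℝ) ≤ 1 / (672 * (1 + e)) := by
    refine (Real.rpow_le_rpow hL0 hL (by norm_num)).trans (le_of_eq ?_)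
    rw [stepSize, ← Real.rpow_natCast, ← Real.rpow_mul (by positivity)]
    norm_num
  calc 336 * (1 + e) * L ^ (1/4 : ℝ) ≤ 336 * (1 + e) * (1 / (672 * (1 + e))) := by gcongr
    _ = 1 / 2 := by
      field_simp
      norm_num

theorem FreeBound.of_forall_pow {g : S3} {k K : ℝ} (h : ∀ n : ℕ, FreeBound g (k + (1/2) ^ n * K)) :
    FreeBound g k := by
  intro s ψ
  have ht : Filter.Tendsto (fun n : ℕ => (k + (1/2 : ℝ) ^ n * K) * nFourThirds ψ) Filter.atTop
      (nhds ((k + 0 * K) * nFourThirds ψ)) :=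
    (((tendsto_pow_atTop_nhds_zero_of_lt_one (by norm_num) (by norm_num)).mul_const K).const_add
      k).mul_const _
  rw [zero_mul, add_zero] at ht
  exact ge_of_tendsto' ht fun n => h n s ψ

namespace SchwartzSolution

variable {T : ℝ} {u : ℝ → E3 → ℂ} {U : ℝ → S3}

theorem regBound_two_mul (h : SchwartzSolution T u U) {c d K K' e : ℝ}
    (hcd : Set.uIcc c d ⊆ Set.Icc 0 T) (hK' : ∀ t ∈ Set.uIcc c d, RegBound (U t) K')
    (he : _root_.energy (U c) ≤ e) (hK : RegBound (U c) K) (hl : |d - c| ≤ stepSize e) :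
    RegBound (U d) (2 * K) := by
  have hsub : ∀ t ∈ Set.uIcc c d, Set.uIcc c t ⊆ Set.uIcc c d := fun t ht =>
    Set.uIcc_subset_uIcc Set.left_mem_uIcc ht
  have hE : ∀ t ∈ Set.uIcc c d, _root_.energy (U t) = _root_.energy (U c) := fun t ht =>
    h.energy_eq ((hsub t ht).trans hcd) fun s hs => hK' s (hsub t ht hs)
  have he0 : 0 ≤ e := (energy_nonneg _).trans he
  have hK0 := hK.nonneg
  have hK0' := (hK' c Set.left_mem_uIcc).nonneg
  refine ⟨?_, ?_, fun j => ?_⟩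
  · rw [h.mass_eq hcd hK']
    linarith [hK.mass]
  · rw [h.energy_eq hcd hK']
    linarith [hK.energy]
  · have hind : ∀ n : ℕ, ∀ t ∈ Set.uIcc c d,
        FreeBound (dS j (dS j (U t))) (2 * K + (1/2) ^ n * K') := by
      intro n
      induction n with
      | zero =>
        intro t ht
        exact ((hK' t ht).free j).mono (by linarith)
      | succ n ih =>
        intro t ht
        have hb := h.freeBound_of_freeBound (B := 2 * K + (1/2) ^ n * K')
          ((hsub t ht).trans hcd) (fun s hs => hK' s (hsub t ht hs))
          (fun s hs => (hE s (hsub t ht hs)).trans_le he) (by positivity) j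
          (fun s hs => ih s (hsub t ht hs)) (hK.free j)
        refine hb.mono ?_
        have h1 : |t - c| ≤ |d - c| := Set.abs_sub_left_of_mem_uIcc ht
        have h2 := mul_rpow_le_of_le_stepSize he0 (abs_nonneg (t - c)) (h1.trans hl)
        have h3 : 0 ≤ 2 * K + (1/2) ^ n * K' := by positivity
        rw [pow_succ]
        nlinarith [mul_le_mul_of_nonneg_right h2 h3]
    exact FreeBound.of_forall_pow fun n => hind n d Set.right_mem_uIcc

end SchwartzSolution

theorem integral_le_of_tendsto_of_nonneg {E : Type*} [MeasurableSpace E] {μ : Measure E}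
    {f : ℕ → E → ℝ} {g : E → ℝ} {C : ℝ} (hf0 : ∀ n x, 0 ≤ f n x) (hf : ∀ n, Integrable (f n) μ)
    (hg : Integrable g μ) (hfg : ∀ x, Filter.Tendsto (fun n => f n x) Filter.atTop (nhds (g x)))
    (hC : ∀ n, ∫ x, f n x ∂μ ≤ C) : ∫ x, g x ∂μ ≤ C := by
  have hC0 : 0 ≤ C := (integral_nonneg (hf0 0)).trans (hC 0)
  have hg0 : ∀ x, 0 ≤ g x := fun x => ge_of_tendsto' (hfg x) fun n => hf0 n x
  rw [← ENNReal.ofReal_le_ofReal_iff hC0,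
    ofReal_integral_eq_lintegral_ofReal hg (Filter.Eventually.of_forall hg0)]
  calc ∫⁻ x, ENNReal.ofReal (g x) ∂μ
      = ∫⁻ x, Filter.liminf (fun n => ENNReal.ofReal (f n x)) Filter.atTop ∂μ := by
        congr 1 with x
        exact ((ENNReal.continuous_ofReal.tendsto _).comp (hfg x)).liminf_eq.symm
    _ ≤ Filter.liminf (fun n => ∫⁻ x, ENNReal.ofReal (f n x) ∂μ) Filter.atTop :=
        lintegral_liminf_le' fun n => (hf n).aemeasurable.ennreal_ofReal
    _ ≤ ENNReal.ofReal C := by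
        refine Filter.liminf_le_of_le (by isBoundedDefault) fun b hb => ?_
        obtain ⟨n, hn⟩ := hb.exists
        refine hn.trans ?_
        rw [← ofReal_integral_eq_lintegral_ofReal (hf n) (Filter.Eventually.of_forall (hf0 n))]
        exact ENNReal.ofReal_le_ofReal (hC n)

theorem norm_integral_mul_le_of_tendsto {f : ℕ → S3} {g Φ : S3} {K L : ℝ}
    (hfg : ∀ x, Filter.Tendsto (fun n => f n x) Filter.atTop (nhds (g x)))
    (hK : ∀ n, ∫ x, ‖f n x‖ ^ 2 ≤ K) (hL : ∀ n, ‖∫ x, f n x * Φ x‖ ≤ L) :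
    ‖∫ x, g x * Φ x‖ ≤ L := by
  set w := ∫ x, g x * Φ x with hw
  obtain ⟨c, hc, hcw⟩ : ∃ c : ℂ, ‖c‖ ≤ 1 ∧ (c * w).re = ‖w‖ := by
    rcases eq_or_ne w 0 with h0 | h0
    · exact ⟨0, by simp, by simp [h0]⟩
    · have hn : ‖w‖ ≠ 0 := norm_ne_zero_iff.2 h0
      refine ⟨(starRingEnd ℂ) w / (‖w‖ : ℂ), ?_, ?_⟩
      · rw [norm_div, RCLike.norm_conj, Complex.norm_real, norm_norm, div_self hn]
      · rw [div_mul_eq_mul_div, Complex.conj_mul', pow_two, mul_div_assoc,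
          div_self (by exact_mod_cast hn), mul_one, Complex.ofReal_re]
  have hK0 : 0 ≤ K := le_trans (integral_nonneg fun _ => by positivity) (hK 0)
  have hI2 : ∀ f : S3, Integrable fun x => ‖f x‖ ^ 2 := fun f => f.integrable_norm_pow two_ne_zero
  have hre : ∀ f : S3, Integrable fun x => (c * (f x * Φ x)).re := fun f =>
    ((integrable_mul f Φ).const_mul c).re
  have hre' : ∀ f : S3, ∫ x, (c * (f x * Φ x)).re = (c * ∫ x, f x * Φ x).re := fun f => by
    rw [← integral_const_mul]
    exact integral_re (𝕜 := ℂ) ((integrable_mul f Φ).const_mul c)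
  have key : ∀ ε > 0, ‖w‖ ≤ L + ε * K := fun ε hε => by
    have hI : ∀ f : S3, Integrable fun x =>
        (c * (f x * Φ x)).re + (ε * ‖f x‖ ^ 2 + (4 * ε)⁻¹ * ‖Φ x‖ ^ 2) := fun f =>
      (hre f).add (((hI2 f).const_mul _).add ((hI2 Φ).const_mul _))
    have hv : ∀ f : S3, ∫ x, ((c * (f x * Φ x)).re + (ε * ‖f x‖ ^ 2 + (4 * ε)⁻¹ * ‖Φ x‖ ^ 2))
        = (c * ∫ x, f x * Φ x).re + (ε * (∫ x, ‖f x‖ ^ 2) + (4 * ε)⁻¹ * ∫ x, ‖Φ x‖ ^ 2) :=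
      fun f => by
        have e := integral_add (hre f) (((hI2 f).const_mul ε).add ((hI2 Φ).const_mul (4 * ε)⁻¹))
        simp only [Pi.add_apply] at e
        rw [e, integral_add ((hI2 f).const_mul _) ((hI2 Φ).const_mul _), integral_const_mul,
          integral_const_mul, hre']
    have h := integral_le_of_tendsto_of_nonneg (μ := volume)
      (f := fun n x => (c * (f n x * Φ x)).re + (ε * ‖f n x‖ ^ 2 + (4 * ε)⁻¹ * ‖Φ x‖ ^ 2))
      (g := fun x => (c * (g x * Φ x)).re + (ε * ‖g x‖ ^ 2 + (4 * ε)⁻¹ * ‖Φ x‖ ^ 2))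
      (C := L + (ε * K + (4 * ε)⁻¹ * ∫ x, ‖Φ x‖ ^ 2)) ?_ (fun n => hI (f n)) (hI g) ?_ ?_
    · rw [hv, ← hw, hcw] at h
      have : 0 ≤ ε * ∫ x, ‖g x‖ ^ 2 := by positivity
      linarith
    · intro n x
      have h1 : -(‖f n x‖ * ‖Φ x‖) ≤ (c * (f n x * Φ x)).re := by
        refine neg_le_of_abs_le ((Complex.abs_re_le_norm _).trans ?_)
        rw [norm_mul, norm_mul]
        exact mul_le_of_le_one_left (by positivity) hc
      have h2 : ‖f n x‖ * ‖Φ x‖ ≤ ε * ‖f n x‖ ^ 2 + (4 * ε)⁻¹ * ‖Φ x‖ ^ 2 := by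
        have : ε * ‖f n x‖ ^ 2 + (4 * ε)⁻¹ * ‖Φ x‖ ^ 2 - ‖f n x‖ * ‖Φ x‖
            = ε * (‖f n x‖ - (2 * ε)⁻¹ * ‖Φ x‖) ^ 2 := by
          field_simp
          ring
        have h3 : 0 ≤ ε * (‖f n x‖ - (2 * ε)⁻¹ * ‖Φ x‖) ^ 2 := by positivity
        linarith
      linarith
    · intro x
      have h1 := ((hfg x).mul_const (Φ x)).const_mul c
      have h2 := ((hfg x).norm.pow 2).const_mul ε
      exact ((Complex.continuous_re.tendsto _).comp h1).add (h2.add_const _)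
    · intro n
      rw [hv]
      have h1 : (c * ∫ x, f n x * Φ x).re ≤ L := by
        refine (Complex.re_le_norm _).trans ?_
        rw [norm_mul]
        exact (mul_le_of_le_one_left (norm_nonneg _) hc).trans (hL n)
      have h2 := mul_le_mul_of_nonneg_left (hK n) hε.le
      linarith
  refine le_of_forall_pos_le_add fun η hη => ?_
  refine (key (η / (K + 1)) (by positivity)).trans ?_
  gcongr
  rw [div_mul_eq_mul_div, div_le_iff₀ (by positivity)]
  nlinarith

theorem RegBound.of_tendsto {f : ℕ → S3} {g : S3} {K : ℝ}
    (hfg : ∀ x, Filter.Tendsto (fun n => f n x) Filter.atTop (nhds (g x)))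
    (hfg' : ∀ j x, Filter.Tendsto (fun n => dS j (f n) x) Filter.atTop (nhds (dS j g x)))
    (hf : ∀ n, RegBound (f n) K) : RegBound g K := by
  have hI2 : ∀ f : S3, Integrable fun x => ‖f x‖ ^ 2 := fun f => f.integrable_norm_pow two_ne_zero
  have hI4 : ∀ f : S3, Integrable fun x => ‖f x‖ ^ 4 := fun f =>
    f.integrable_norm_pow (by norm_num)
  have hIs : ∀ f : S3, Integrable fun x => ∑ j, ‖dS j f x‖ ^ 2 := fun f =>
    integrable_finsetSum _ fun j _ => hI2 _
  have hIE : ∀ f : S3, Integrable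
      fun x => 1/2 * (∑ j, ‖dS j f x‖ ^ 2) + 1/4 * ‖f x‖ ^ 4 := fun f =>
    ((hIs f).const_mul _).add ((hI4 f).const_mul _)
  have hE : ∀ f : S3, ∫ x, (1/2 * (∑ j, ‖dS j f x‖ ^ 2) + 1/4 * ‖f x‖ ^ 4) = _root_.energy f :=
    fun f => by
      rw [integral_add ((hIs f).const_mul _) ((hI4 f).const_mul _), integral_const_mul,
        integral_const_mul, _root_.energy]
      simp only [pd_coe]
  refine ⟨?_, ?_, fun j s ψ => ?_⟩
  · exact integral_le_of_tendsto_of_nonneg (fun n x => by positivity) (fun n => hI2 (f n)) (hI2 g)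
      (fun x => (hfg x).norm.pow 2) fun n => (hf n).mass
  · rw [← hE]
    exact integral_le_of_tendsto_of_nonneg (fun n x => by positivity) (fun n => hIE (f n)) (hIE g)
      (fun x => ((tendsto_finsetSum _ fun j _ => (hfg' j x).norm.pow 2).const_mul _).add
        (((hfg x).norm.pow 4).const_mul _)) fun n => (hE (f n)).trans_le (hf n).energy
  · rw [← integral_mul_dS_dS]
    refine norm_integral_mul_le_of_tendsto hfg (fun n => (hf n).mass) fun n => ?_
    rw [integral_mul_dS_dS]
    exact (hf n).free j s ψ

namespace SchwartzSolution

variable {T : ℝ} {u : ℝ → E3 → ℂ} {U : ℝ → S3}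

theorem isClosed_setOf_regBound (h : SchwartzSolution T u U) (K : ℝ) :
    IsClosed {t | t ∈ Set.Icc 0 T ∧ RegBound (U t) K} := by
  refine IsSeqClosed.isClosed fun τ t hτ hτt => ?_
  have ht : t ∈ Set.Icc 0 T := isClosed_Icc.mem_of_tendsto hτt
    (Filter.Eventually.of_forall fun n => (hτ n).1)
  refine ⟨ht, RegBound.of_tendsto (f := fun n => U (τ n)) (fun x => ?_) (fun j x => ?_)
    fun n => (hτ n).2⟩
  · simp only [← h.coe t ht, ← h.coe _ (hτ _).1]
    exact ((h.smooth.continuous_comp continuous_id (continuous_const (y := x))).tendsto t).comp hτt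
  · simp only [← h.px_coe ht, ← h.px_coe (hτ _).1]
    exact (((h.smooth.px j).continuous_comp continuous_id
      (continuous_const (y := x))).tendsto t).comp hτt

end SchwartzSolution

namespace SchwartzSolution

variable {T : ℝ} {u : ℝ → E3 → ℂ} {U : ℝ → S3}

/-- The times near which the solution is uniformly regular. -/
def goodTimes (T : ℝ) (U : ℝ → S3) : Set ℝ :=
  {t | ∃ δ > 0, ∃ K, ∀ s ∈ Set.Icc 0 T, |s - t| < δ → RegBound (U s) K}

theorem isOpen_goodTimes (T : ℝ) (U : ℝ → S3) : IsOpen (goodTimes T U) := by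
  refine Metric.isOpen_iff.2 ?_
  rintro t ⟨δ, hδ, K, hK⟩
  refine ⟨δ / 2, by positivity, fun t' ht' => ⟨δ / 2, by positivity, K, fun s hs hst => hK s hs ?_⟩⟩
  rw [Metric.mem_ball, Real.dist_eq] at ht'
  linarith [abs_sub_le s t' t]

theorem exists_regBound_of_subset_goodTimes {S : Set ℝ} (hS : IsCompact S)
    (hT : S ⊆ Set.Icc 0 T) (hG : S ⊆ goodTimes T U) : ∃ K, ∀ t ∈ S, RegBound (U t) K := by
  refine hS.induction_on (p := fun S => ∃ K, ∀ t ∈ S, t ∈ Set.Icc 0 T → RegBound (U t) K)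
    ⟨0, by simp⟩ ?_ ?_ ?_ |>.imp fun K hK t ht => hK t ht (hT ht)
  · rintro s t hst ⟨K, hK⟩
    exact ⟨K, fun x hx => hK x (hst hx)⟩
  · rintro s t ⟨K, hK⟩ ⟨L, hL⟩
    refine ⟨max K L, fun x hx hxT => hx.elim (fun h => ?_) fun h => ?_⟩
    · exact (hK x h hxT).mono (le_max_left _ _)
    · exact (hL x h hxT).mono (le_max_right _ _)
  · intro t ht
    obtain ⟨δ, hδ, K, hK⟩ := hG ht
    refine ⟨Metric.ball t δ, mem_nhdsWithin_of_mem_nhds (Metric.ball_mem_nhds t hδ), K,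
      fun s hs hsT => hK s hsT ?_⟩
    rwa [Metric.mem_ball, Real.dist_eq] at hs

theorem exists_regBound_uIcc (h : SchwartzSolution T u U) {a s : ℝ} (has : a ≠ s)
    (hT : Set.uIcc a s ⊆ Set.Icc 0 T) (hG : ∀ t ∈ Set.uIcc a s, t ≠ a → t ∈ goodTimes T U) :
    ∃ K, ∀ t ∈ Set.uIcc a s, RegBound (U t) K := by
  have hsub : ∀ t ∈ Set.uIcc a s, t ≠ a → Set.uIcc t s ⊆ Set.uIcc a s ∧ a ∉ Set.uIcc t s := by
    intro t ht hta
    refine ⟨Set.uIcc_subset_uIcc ht Set.right_mem_uIcc, fun ha => ?_⟩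
    rcases Set.mem_uIcc.1 ht with ⟨h1, h2⟩ | ⟨h1, h2⟩ <;>
      rcases Set.mem_uIcc.1 ha with ⟨h3, h4⟩ | ⟨h3, h4⟩
    · exact hta (le_antisymm h3 h1)
    · exact has (le_antisymm (h1.trans h2) h3)
    · exact has (le_antisymm h4 (h1.trans h2))
    · exact hta (le_antisymm h2 h4)
  have hbd : ∀ t ∈ Set.uIcc a s, t ≠ a → ∃ K, ∀ r ∈ Set.uIcc t s, RegBound (U r) K := by
    intro t ht hta
    obtain ⟨h1, h2⟩ := hsub t ht hta
    refine exists_regBound_of_subset_goodTimes isCompact_uIcc (h1.trans hT) fun r hr => ?_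
    exact hG r (h1 hr) fun hra => h2 (hra ▸ hr)
  set e := _root_.energy (U s) with he
  have hE : ∀ t ∈ Set.uIcc a s, t ≠ a → _root_.energy (U t) = e := by
    intro t ht hta
    obtain ⟨K, hK⟩ := hbd t ht hta
    exact (h.energy_eq ((hsub t ht hta).1.trans hT) hK).symm
  have hl := stepSize_pos (energy_nonneg (U s))
  obtain ⟨s₁, hs₁, hs₁a, hs₁l⟩ : ∃ s₁ ∈ Set.uIcc a s, s₁ ≠ a ∧ |s₁ - a| ≤ stepSize e := by
    have hd : 0 < |s - a| := abs_pos.2 (sub_ne_zero.2 has.symm)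
    set θ := min 1 (stepSize e / |s - a|) with hθ
    have hθ0 : 0 < θ := lt_min one_pos (by positivity)
    have hθ1 : θ ≤ 1 := min_le_left _ _
    refine ⟨a + θ * (s - a), ?_, ?_, ?_⟩
    · rcases le_total a s with h1 | h1
      · rw [Set.uIcc_of_le h1]
        constructor <;> nlinarith
      · rw [Set.uIcc_of_ge h1]
        constructor <;> nlinarith
    · simpa [hθ0.ne'] using sub_ne_zero.2 has.symm
    · rw [add_sub_cancel_left, abs_mul, abs_of_pos hθ0]
      calc θ * |s - a| ≤ stepSize e / |s - a| * |s - a| := by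
            gcongr
            exact min_le_right _ _
        _ = stepSize e := by field_simp
  obtain ⟨K₀, hK₀⟩ := exists_regBound (U a)
  obtain ⟨K₁, hK₁⟩ := exists_regBound (U s₁)
  obtain ⟨K₂, hK₂⟩ := hbd s₁ hs₁ hs₁a
  have hK₁' : ∀ t ∈ Set.uIcc a s₁, t ≠ a → RegBound (U t) (2 * K₁) := by
    intro t ht hta
    have ht' : t ∈ Set.uIcc a s := Set.uIcc_subset_uIcc Set.left_mem_uIcc hs₁ ht
    obtain ⟨K', hK'⟩ := hbd t ht' hta
    by_cases hts : Set.uIcc s₁ t ⊆ Set.uIcc t s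
    · refine h.regBound_two_mul ((hts.trans (hsub t ht' hta).1).trans hT)
        (fun r hr => hK' r (hts hr)) (hE s₁ hs₁ hs₁a).le hK₁ ?_
      have := Set.abs_sub_right_of_mem_uIcc ht
      rw [abs_sub_comm]
      exact this.trans hs₁l
    · refine absurd (Set.uIcc_subset_uIcc ?_ Set.left_mem_uIcc) hts
      rcases Set.mem_uIcc.1 ht with ⟨h1, h2⟩ | ⟨h1, h2⟩ <;>
        rcases Set.mem_uIcc.1 hs₁ with ⟨h3, h4⟩ | ⟨h3, h4⟩
      · exact Set.mem_uIcc.2 (Or.inl ⟨h2, h4⟩)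
      · exact absurd (le_antisymm h4 (h1.trans h2)) hs₁a
      · exact absurd (le_antisymm (h1.trans h2) h3) hs₁a
      · exact Set.mem_uIcc.2 (Or.inr ⟨h3, h1⟩)
  refine ⟨max K₀ (max (2 * K₁) K₂), fun t ht => ?_⟩
  by_cases hta : t = a
  · rw [hta]
    exact hK₀.mono (le_max_left _ _)
  · rcases Set.uIcc_subset_uIcc_union_uIcc (b := s₁) ht with ht1 | ht1
    · exact (hK₁' t ht1 hta).mono ((le_max_left _ _).trans (le_max_right _ _))
    · exact (hK₂ t ht1).mono ((le_max_right _ _).trans (le_max_right _ _))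

theorem Icc_subset_goodTimes (h : SchwartzSolution T u U) : Set.Icc 0 T ⊆ goodTimes T U := by
  by_contra hne
  set P := Set.Icc 0 T \ goodTimes T U with hP
  have hPc : IsClosed P := isClosed_Icc.sdiff (isOpen_goodTimes T U)
  have hPn : Nonempty P := (Set.sdiff_nonempty.2 hne).to_subtype
  have : CompleteSpace P := hPc.completeSpace_coe
  obtain ⟨n, p, hp⟩ := nonempty_interior_of_iUnion_of_closed
    (f := fun n : ℕ => {t : P | (t : ℝ) ∈ Set.Icc 0 T ∧ RegBound (U t) n})
    (fun n => (h.isClosed_setOf_regBound n).preimage continuous_subtype_val) (by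
      refine Set.eq_univ_of_forall fun t => Set.mem_iUnion.2 ?_
      obtain ⟨K, hK⟩ := exists_regBound (U t)
      obtain ⟨n, hn⟩ := exists_nat_ge K
      exact ⟨n, t.2.1, hK.mono hn⟩)
  obtain ⟨δ, hδ, hball⟩ := Metric.mem_nhds_iff.1 (mem_interior_iff_mem_nhds.1 hp)
  set K : ℝ := (n : ℝ)
  have hK : ∀ s ∈ P, |s - p| < δ → RegBound (U s) K := fun s hs hsp =>
    (hball (show (⟨s, hs⟩ : P) ∈ Metric.ball p δ from hsp)).2
  have hl : 0 < stepSize K := stepSize_pos (Nat.cast_nonneg n)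
  refine p.2.2 ⟨min δ (stepSize K), lt_min hδ hl, 2 * K, fun s hs hsp => ?_⟩
  by_cases hsP : s ∈ P
  · exact (hK s hsP (hsp.trans_le (min_le_left _ _))).mono (by
      have : 0 ≤ K := Nat.cast_nonneg n
      linarith)
  have hC : IsCompact (P ∩ Set.uIcc (p : ℝ) s) := isCompact_uIcc.inter_left hPc
  obtain ⟨a, ⟨haP, haI⟩, hmin⟩ := hC.exists_isMinOn ⟨p, p.2, Set.left_mem_uIcc⟩
    (f := fun x => |x - s|) (by fun_prop)
  have hps : Set.uIcc (p : ℝ) s ⊆ Set.Icc 0 T :=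
    Set.ordConnected_Icc.uIcc_subset p.2.1 hs
  have has : Set.uIcc a s ⊆ Set.uIcc (p : ℝ) s := Set.uIcc_subset_uIcc haI Set.right_mem_uIcc
  have hane : a ≠ s := fun e => hsP (e ▸ haP)
  have hG : ∀ t ∈ Set.uIcc a s, t ≠ a → t ∈ goodTimes T U := by
    intro t ht hta
    by_contra htG
    have hm : |a - s| ≤ |t - s| := hmin (show t ∈ P ∩ Set.uIcc (p : ℝ) s from
      ⟨⟨hps (has ht), htG⟩, has ht⟩)
    refine hta ?_
    rcases Set.mem_uIcc.1 ht with ⟨h1, h2⟩ | ⟨h1, h2⟩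
    · rw [abs_of_nonpos (by linarith), abs_of_nonpos (by linarith)] at hm
      linarith
    · rw [abs_of_nonneg (by linarith), abs_of_nonneg (by linarith)] at hm
      linarith
  obtain ⟨K', hK'⟩ := h.exists_regBound_uIcc hane (has.trans hps) hG
  have h1 : |a - p| ≤ |s - p| := Set.abs_sub_left_of_mem_uIcc haI
  have h2 : |s - a| ≤ |s - p| := Set.abs_sub_right_of_mem_uIcc haI
  have hKa := hK a haP (h1.trans_lt (hsp.trans_le (min_le_left _ _)))
  exact h.regBound_two_mul (has.trans hps) hK' hKa.energy hKa
    (h2.trans (hsp.le.trans (min_le_right _ _)))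

/-- Solutions are uniformly regular on the whole time interval. -/
theorem exists_forall_regBound (h : SchwartzSolution T u U) :
    ∃ K, ∀ t ∈ Set.Icc 0 T, RegBound (U t) K :=
  exists_regBound_of_subset_goodTimes isCompact_Icc subset_rfl h.Icc_subset_goodTimes

end SchwartzSolution

/-- A regularised inverse distance to the origin. -/
def invDist (e : ℝ) (w : E3) : ℝ := (√(e ^ 2 + ‖w‖ ^ 2))⁻¹

theorem continuous_invDist {e : ℝ} (he : 0 < e) : Continuous (invDist e) := by
  unfold invDist
  exact Continuous.inv₀ (by fun_prop) fun w => by positivity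

theorem invDist_pos {e : ℝ} (he : 0 < e) (w : E3) : 0 < invDist e w := by
  unfold invDist
  positivity

theorem invDist_sq_mul {e : ℝ} (he : 0 < e) (w : E3) :
    invDist e w ^ 2 * (e ^ 2 + ‖w‖ ^ 2) = 1 := by
  rw [invDist, inv_pow, Real.sq_sqrt (by positivity), inv_mul_cancel₀ (by positivity)]

theorem invDist_sq_mul_sum {e : ℝ} (he : 0 < e) (w : E3) :
    invDist e w ^ 2 * (e ^ 2 + (w 0 ^ 2 + w 1 ^ 2 + w 2 ^ 2)) = 1 := by
  have h := invDist_sq_mul he w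
  rw [EuclideanSpace.norm_sq_eq] at h
  simpa only [Fin.sum_univ_three, Real.norm_eq_abs, sq_abs] using h

theorem invDist_neg (e : ℝ) (w : E3) : invDist e (-w) = invDist e w := by
  rw [invDist, norm_neg, invDist]

theorem abs_coord_mul_invDist_le {e : ℝ} (he : 0 < e) (w : E3) (j : Fin 3) :
    |w j * invDist e w| ≤ 1 := by
  refine abs_le_of_sq_le_sq ?_ zero_le_one
  rw [one_pow, ← invDist_sq_mul_sum he w, mul_pow, mul_comm]
  refine mul_le_mul_of_nonneg_left ?_ (sq_nonneg _)
  fin_cases j <;> simp <;>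
    nlinarith [sq_nonneg (w 0), sq_nonneg (w 1), sq_nonneg (w 2), sq_nonneg e]

theorem mul_invDist_le {e : ℝ} (he : 0 < e) (w : E3) : e * invDist e w ≤ 1 := by
  refine le_of_sq_le_sq ?_ zero_le_one
  rw [one_pow, ← invDist_sq_mul he w, mul_pow, mul_comm]
  exact mul_le_mul_of_nonneg_left (by nlinarith [sq_nonneg ‖w‖]) (sq_nonneg _)

theorem hasLineDerivAt_coord (w : E3) (j k : Fin 3) :
    HasLineDerivAt ℝ (fun w : E3 => w k) (if k = j then 1 else 0) w
      (EuclideanSpace.single j 1) := by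
  have h := ((EuclideanSpace.proj k : E3 →L[ℝ] ℝ).hasFDerivAt (x := w)).hasLineDerivAt
    (EuclideanSpace.single j 1)
  simpa [Pi.single_apply] using h

theorem hasLineDerivAt_invDist {e : ℝ} (he : 0 < e) (w : E3) (j : Fin 3) :
    HasLineDerivAt ℝ (invDist e) (-(w j * invDist e w ^ 3)) w (EuclideanSpace.single j 1) := by
  have hn : ∀ t : ℝ, e ^ 2 + ‖w + t • EuclideanSpace.single j (1 : ℝ)‖ ^ 2
      = e ^ 2 + ‖w‖ ^ 2 + t * (2 * w j) + t ^ 2 := fun t => by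
    rw [norm_add_sq_real, real_inner_smul_right, EuclideanSpace.inner_single_right, norm_smul]
    simp
    ring
  have h1 : HasDerivAt (fun t : ℝ => e ^ 2 + ‖w + t • EuclideanSpace.single j (1 : ℝ)‖ ^ 2)
      (2 * w j) 0 := by
    simp only [hn]
    have h3 : HasDerivAt (fun t : ℝ => t * (2 * w j)) (1 * (2 * w j)) 0 :=
      HasDerivAt.mul_const (hasDerivAt_id' 0) _
    have h4 : HasDerivAt (fun t : ℝ => t ^ 2) (((2 : ℕ) : ℝ) * 0 ^ (2 - 1)) 0 := hasDerivAt_pow 2 0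
    exact ((h3.const_add (e ^ 2 + ‖w‖ ^ 2)).fun_add h4).congr_deriv (by simp)
  have hpos : 0 < e ^ 2 + ‖w‖ ^ 2 := by positivity
  have h2 := (h1.sqrt (by simpa using hpos.ne')).inv (by
    simpa using (Real.sqrt_pos.2 hpos).ne')
  refine HasDerivAt.congr_deriv (f := fun t : ℝ => invDist e (w + t • EuclideanSpace.single j 1))
    h2 ?_
  simp only [zero_smul, add_zero, invDist]
  have := (Real.sqrt_pos.2 hpos).ne'
  field_simp

theorem hasLineDerivAt_pow {E : Type*} [NormedAddCommGroup E] [NormedSpace ℝ E] {f : E → ℝ}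
    {a : ℝ} {x v : E} (h : HasLineDerivAt ℝ f a x v) (n : ℕ) :
    HasLineDerivAt ℝ (fun x => f x ^ n) (n * f x ^ (n - 1) * a) x v := by
  have := HasDerivAt.fun_pow h n
  simp only [zero_smul, add_zero] at this
  exact this

theorem HasLineDerivAt.congr_val {E : Type*} [NormedAddCommGroup E] [NormedSpace ℝ E]
    {f : E → ℝ} {a b : ℝ} {x v : E} (h : HasLineDerivAt ℝ f a x v) (hab : a = b) :
    HasLineDerivAt ℝ f b x v :=
  hab ▸ h

/-- The gradient of the regularised distance. -/
def gradDist (e : ℝ) (j : Fin 3) (w : E3) : ℝ := w j * invDist e w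

/-- The Hessian of the regularised distance. -/
def hessDist (e : ℝ) (j k : Fin 3) (w : E3) : ℝ :=
  (if j = k then 1 else 0) * invDist e w - w j * w k * invDist e w ^ 3

/-- The Laplacian of the regularised distance. -/
def lapDist (e : ℝ) (w : E3) : ℝ := 2 * invDist e w + e ^ 2 * invDist e w ^ 3

/-- The gradient of the Laplacian of the regularised distance. -/
def gradLapDist (e : ℝ) (k : Fin 3) (w : E3) : ℝ :=
  -(2 * (w k * invDist e w ^ 3) + 3 * e ^ 2 * (w k * invDist e w ^ 5))

/-- The second derivatives of the Laplacian of the regularised distance. -/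
def hessLapDist (e : ℝ) (k : Fin 3) (w : E3) : ℝ :=
  -(2 * (invDist e w ^ 3 - 3 * w k ^ 2 * invDist e w ^ 5)
    + 3 * e ^ 2 * (invDist e w ^ 5 - 5 * w k ^ 2 * invDist e w ^ 7))

theorem hasLineDerivAt_coord_mul_invDist_pow {e : ℝ} (he : 0 < e) (w : E3) (j k : Fin 3) (n : ℕ) :
    HasLineDerivAt ℝ (fun w => w j * invDist e w ^ (n + 1))
      ((if j = k then 1 else 0) * invDist e w ^ (n + 1)
        - (n + 1) * (w j * w k) * invDist e w ^ (n + 3)) w (EuclideanSpace.single k 1) := by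
  have h := hasLineDerivAt_mul (hasLineDerivAt_coord w k j)
    (hasLineDerivAt_pow (hasLineDerivAt_invDist he w k) (n + 1))
  refine h.congr_val ?_
  push_cast
  ring

theorem hasLineDerivAt_gradDist {e : ℝ} (he : 0 < e) (w : E3) (j k : Fin 3) :
    HasLineDerivAt ℝ (gradDist e j) (hessDist e j k w) w (EuclideanSpace.single k 1) := by
  have h := hasLineDerivAt_coord_mul_invDist_pow he w j k 0
  simp only [zero_add, pow_one, Nat.cast_zero, one_mul] at h
  exact h

theorem hasLineDerivAt_lapDist {e : ℝ} (he : 0 < e) (w : E3) (k : Fin 3) :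
    HasLineDerivAt ℝ (lapDist e) (gradLapDist e k w) w (EuclideanSpace.single k 1) := by
  have h := hasLineDerivAt_add
    (hasLineDerivAt_const_mul 2 (hasLineDerivAt_invDist he w k))
    (hasLineDerivAt_const_mul (e ^ 2) (hasLineDerivAt_pow (hasLineDerivAt_invDist he w k) 3))
  refine HasLineDerivAt.congr_val (f := lapDist e) h ?_
  unfold gradLapDist
  push_cast
  ring

theorem hasLineDerivAt_gradLapDist {e : ℝ} (he : 0 < e) (w : E3) (k : Fin 3) :
    HasLineDerivAt ℝ (gradLapDist e k) (hessLapDist e k w) w (EuclideanSpace.single k 1) := by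
  have h := hasLineDerivAt_const_mul (-1) (hasLineDerivAt_add
    (hasLineDerivAt_const_mul 2 (hasLineDerivAt_coord_mul_invDist_pow he w k k 2))
    (hasLineDerivAt_const_mul (3 * e ^ 2) (hasLineDerivAt_coord_mul_invDist_pow he w k k 4)))
  have hfun : gradLapDist e k = fun w => -1 * (2 * (w k * invDist e w ^ (2 + 1))
      + 3 * e ^ 2 * (w k * invDist e w ^ (4 + 1))) := by
    ext w
    unfold gradLapDist
    ring
  rw [hfun]
  refine h.congr_val ?_
  unfold hessLapDist
  push_cast
  simp only [if_true]
  ring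

theorem sum_hessDist {e : ℝ} (he : 0 < e) (w : E3) : ∑ j, hessDist e j j w = lapDist e w := by
  simp only [hessDist, lapDist, Fin.sum_univ_three, if_true]
  linear_combination (-invDist e w) * invDist_sq_mul_sum he w

theorem sum_hessLapDist {e : ℝ} (he : 0 < e) (w : E3) :
    ∑ k, hessLapDist e k w = -(15 * e ^ 4 * invDist e w ^ 7) := by
  simp only [hessLapDist, Fin.sum_univ_three]
  linear_combination (6 * invDist e w ^ 3 + 15 * e ^ 2 * invDist e w ^ 5) * invDist_sq_mul_sum he w

theorem lapDist_nonneg {e : ℝ} (he : 0 < e) (w : E3) : 0 ≤ lapDist e w := by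
  have := invDist_pos he w
  unfold lapDist
  positivity

theorem lapDist_le {e : ℝ} (he : 0 < e) (w : E3) : lapDist e w ≤ 3 * invDist e w := by
  have h1 := invDist_pos he w
  have h2 := mul_invDist_le he w
  have h3 : (e * invDist e w) ^ 2 ≤ 1 := pow_le_one₀ (by positivity) h2
  unfold lapDist
  nlinarith

theorem hessDist_nonneg {e : ℝ} (he : 0 < e) (w : E3) (a b c : ℝ) :
    0 ≤ hessDist e 0 0 w * a ^ 2 + hessDist e 1 1 w * b ^ 2 + hessDist e 2 2 w * c ^ 2
      + 2 * (hessDist e 0 1 w * (a * b) + hessDist e 0 2 w * (a * c)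
        + hessDist e 1 2 w * (b * c)) := by
  have h1 := invDist_pos he w
  have h2 := invDist_sq_mul_sum he w
  simp only [hessDist, if_true, if_neg (show (0 : Fin 3) ≠ 1 by decide),
    if_neg (show (0 : Fin 3) ≠ 2 by decide), if_neg (show (1 : Fin 3) ≠ 2 by decide)]
  set s := invDist e w
  have key : 0 ≤ s ^ 3 * ((e ^ 2) * (a ^ 2 + b ^ 2 + c ^ 2) + ((w 0 * b - w 1 * a) ^ 2
    + (w 0 * c - w 2 * a) ^ 2 + (w 1 * c - w 2 * b) ^ 2)) := by positivity
  linear_combination key + s * (a ^ 2 + b ^ 2 + c ^ 2) * h2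

theorem continuous_gradDist {e : ℝ} (he : 0 < e) (j : Fin 3) : Continuous (gradDist e j) := by
  have := continuous_invDist he
  unfold gradDist
  fun_prop

theorem continuous_hessDist {e : ℝ} (he : 0 < e) (j k : Fin 3) : Continuous (hessDist e j k) := by
  have := continuous_invDist he
  unfold hessDist
  fun_prop

theorem continuous_lapDist {e : ℝ} (he : 0 < e) : Continuous (lapDist e) := by
  have := continuous_invDist he
  unfold lapDist
  fun_prop

theorem continuous_gradLapDist {e : ℝ} (he : 0 < e) (k : Fin 3) : Continuous (gradLapDist e k) := by
  have := continuous_invDist he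
  unfold gradLapDist
  fun_prop

theorem continuous_hessLapDist {e : ℝ} (he : 0 < e) (k : Fin 3) : Continuous (hessLapDist e k) := by
  have := continuous_invDist he
  unfold hessLapDist
  fun_prop

theorem hasLineDerivAt_sum {E ι : Type*} [NormedAddCommGroup E] [NormedSpace ℝ E] {s : Finset ι}
    {f : ι → E → ℝ} {a : ι → ℝ} {x v : E} (h : ∀ j ∈ s, HasLineDerivAt ℝ (f j) (a j) x v) :
    HasLineDerivAt ℝ (fun x => ∑ j ∈ s, f j x) (∑ j ∈ s, a j) x v :=
  HasDerivAt.fun_sum h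

theorem HasLineDerivAt.comp_sub_right {E : Type*} [NormedAddCommGroup E] [NormedSpace ℝ E]
    {b : E → ℝ} {a : ℝ} {x y v : E} (h : HasLineDerivAt ℝ b a (x - y) v) :
    HasLineDerivAt ℝ (fun x => b (x - y)) a x v := by
  simpa only [HasLineDerivAt, sub_add_eq_add_sub] using h

theorem HasLineDerivAt.comp_sub_left {E : Type*} [NormedAddCommGroup E] [NormedSpace ℝ E]
    {b : E → ℝ} {a : ℝ} {x y v : E} (h : HasLineDerivAt ℝ b a (x - y) v) :
    HasLineDerivAt ℝ (fun y => b (x - y)) (-a) y v := by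
  have h1 : HasDerivAt (fun t : ℝ => b (x - y + t • v)) a (-0) := by
    rw [neg_zero]
    exact h
  have h2 := h1.scomp (0 : ℝ) (hasDerivAt_neg (0 : ℝ))
  rw [neg_one_smul] at h2
  refine HasDerivAt.congr_of_eventuallyEq h2 (Filter.Eventually.of_forall fun t => ?_)
  simp only [Function.comp_apply, neg_smul]
  congr 1
  abel

theorem hasLineDerivAt_prod_fst {E F : Type*} [NormedAddCommGroup E] [NormedSpace ℝ E]
    [NormedAddCommGroup F] [NormedSpace ℝ F] {f : E × F → ℝ} {a : ℝ} {p : E × F} {v : E}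
    (h : HasLineDerivAt ℝ (fun x => f (x, p.2)) a p.1 v) : HasLineDerivAt ℝ f a p (v, 0) := by
  refine HasDerivAt.congr_of_eventuallyEq h (Filter.Eventually.of_forall fun t => ?_)
  simp only
  congr 1
  ext1 <;> simp

theorem hasLineDerivAt_prod_snd {E F : Type*} [NormedAddCommGroup E] [NormedSpace ℝ E]
    [NormedAddCommGroup F] [NormedSpace ℝ F] {f : E × F → ℝ} {a : ℝ} {p : E × F} {v : F}
    (h : HasLineDerivAt ℝ (fun y => f (p.1, y)) a p.2 v) : HasLineDerivAt ℝ f a p (0, v) := by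
  refine HasDerivAt.congr_of_eventuallyEq h (Filter.Eventually.of_forall fun t => ?_)
  simp only
  congr 1
  ext1 <;> simp

/-- The mass density. -/
def massDens (u : ℝ → E3 → ℂ) (t : ℝ) (x : E3) : ℝ :=
  (u t x).re * (u t x).re + (u t x).im * (u t x).im

/-- The components of the momentum density. -/
def momDens (u : ℝ → E3 → ℂ) (j : Fin 3) (t : ℝ) (x : E3) : ℝ :=
  (u t x).re * (px j u t x).im - (u t x).im * (px j u t x).re

/-- The real part of the product of two derivatives. -/
def gradProd (u : ℝ → E3 → ℂ) (j k : Fin 3) (t : ℝ) (x : E3) : ℝ :=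
  (px j u t x).re * (px k u t x).re + (px j u t x).im * (px k u t x).im

/-- The momentum in the direction away from `y`. -/
def virialDens (e : ℝ) (u : ℝ → E3 → ℂ) (y : E3) (t : ℝ) (x : E3) : ℝ :=
  ∑ j, gradDist e j (x - y) * momDens u j t x

/-- The time derivative of `virialDens`. -/
def virialRate (e : ℝ) (u : ℝ → E3 → ℂ) (y : E3) (t : ℝ) (x : E3) : ℝ :=
  ∑ j, gradDist e j (x - y) *
    (((pt u t x).re * (px j u t x).im + (u t x).re * (px j (pt u) t x).im)
      - ((pt u t x).im * (px j u t x).re + (u t x).im * (px j (pt u) t x).re))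

/-- The flux of `virialDens`. -/
def virialFlux (e : ℝ) (u : ℝ → E3 → ℂ) (k : Fin 3) (y : E3) (t : ℝ) (x : E3) : ℝ :=
  gradDist e k (x - y) * ((u t x).re * (pt u t x).im - (u t x).im * (pt u t x).re
      + ∑ j, gradProd u j j t x + 2⁻¹ * (massDens u t x * massDens u t x))
    - lapDist e (x - y) * ((u t x).re * (px k u t x).re + (u t x).im * (px k u t x).im)
    + 2⁻¹ * (gradLapDist e k (x - y) * massDens u t x)
    - 2 * ∑ j, gradDist e j (x - y) * gradProd u j k t x

/-- The divergence of `virialFlux`, summand by summand. -/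
def virialFluxDeriv (e : ℝ) (u : ℝ → E3 → ℂ) (k : Fin 3) (y : E3) (t : ℝ) (x : E3) : ℝ :=
  hessDist e k k (x - y) * ((u t x).re * (pt u t x).im - (u t x).im * (pt u t x).re
      + ∑ j, gradProd u j j t x + 2⁻¹ * (massDens u t x * massDens u t x))
    + gradDist e k (x - y) * ((px k u t x).re * (pt u t x).im + (u t x).re * (px k (pt u) t x).im
      - ((px k u t x).im * (pt u t x).re + (u t x).im * (px k (pt u) t x).re)
      + ∑ j, 2 * ((px k (px j u) t x).re * (px j u t x).re
        + (px k (px j u) t x).im * (px j u t x).im)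
      + 2 * (massDens u t x
        * ((u t x).re * (px k u t x).re + (u t x).im * (px k u t x).im)))
    - lapDist e (x - y) * (gradProd u k k t x + (u t x).re * (px k (px k u) t x).re
      + (u t x).im * (px k (px k u) t x).im)
    + 2⁻¹ * (hessLapDist e k (x - y) * massDens u t x)
    - 2 * ∑ j, (hessDist e j k (x - y) * gradProd u j k t x
      + gradDist e j (x - y) * ((px k (px j u) t x).re * (px k u t x).re
        + (px j u t x).re * (px k (px k u) t x).re
        + ((px k (px j u) t x).im * (px k u t x).im
        + (px j u t x).im * (px k (px k u) t x).im)))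

/-- The source term in the local virial identity. -/
def virialSource (e : ℝ) (u : ℝ → E3 → ℂ) (y : E3) (t : ℝ) (x : E3) : ℝ :=
  2 * (∑ j, ∑ k, hessDist e j k (x - y) * gradProd u j k t x)
    + 2⁻¹ * (lapDist e (x - y) * (massDens u t x * massDens u t x))
    + 15 / 2 * (e ^ 4 * invDist e (x - y) ^ 7 * massDens u t x)

theorem hasLineDerivAt_massDens {u : ℝ → E3 → ℂ} (hu : SpaceTimeSmooth u)
    (k : Fin 3) (t : ℝ) (x : E3) : HasLineDerivAt ℝ (massDens u t)
      (2 * ((u t x).re * (px k u t x).re + (u t x).im * (px k u t x).im)) x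
      (EuclideanSpace.single k 1) := by
  have h := hu.hasLineDerivAt k t x
  refine HasLineDerivAt.congr_val (f := massDens u t) (hasLineDerivAt_add
    (hasLineDerivAt_mul (hasLineDerivAt_re h) (hasLineDerivAt_re h))
    (hasLineDerivAt_mul (hasLineDerivAt_im h) (hasLineDerivAt_im h))) ?_
  ring

theorem hasLineDerivAt_momDens {u : ℝ → E3 → ℂ} (hu : SpaceTimeSmooth u)
    (k : Fin 3) (t : ℝ) (x : E3) : HasLineDerivAt ℝ (momDens u k t)
      ((u t x).re * (px k (px k u) t x).im - (u t x).im * (px k (px k u) t x).re) x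
      (EuclideanSpace.single k 1) := by
  have h := hu.hasLineDerivAt k t x
  have h' := (hu.px k).hasLineDerivAt k t x
  refine HasLineDerivAt.congr_val (f := momDens u k t) (hasLineDerivAt_sub
    (hasLineDerivAt_mul (hasLineDerivAt_re h) (hasLineDerivAt_im h'))
    (hasLineDerivAt_mul (hasLineDerivAt_im h) (hasLineDerivAt_re h'))) ?_
  ring

theorem hasLineDerivAt_gradProd {u : ℝ → E3 → ℂ} (hu : SpaceTimeSmooth u)
    (i j k : Fin 3) (t : ℝ) (x : E3) : HasLineDerivAt ℝ (gradProd u i j t)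
      ((px k (px i u) t x).re * (px j u t x).re + (px i u t x).re * (px k (px j u) t x).re
        + ((px k (px i u) t x).im * (px j u t x).im + (px i u t x).im * (px k (px j u) t x).im)) x
      (EuclideanSpace.single k 1) := by
  have h := (hu.px i).hasLineDerivAt k t x
  have h' := (hu.px j).hasLineDerivAt k t x
  exact hasLineDerivAt_add
    (hasLineDerivAt_mul (hasLineDerivAt_re h) (hasLineDerivAt_re h'))
    (hasLineDerivAt_mul (hasLineDerivAt_im h) (hasLineDerivAt_im h'))

theorem hasDerivAt_massDens {u : ℝ → E3 → ℂ} (hu : SpaceTimeSmooth u)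
    (t : ℝ) (x : E3) : HasDerivAt (fun t => massDens u t x)
      (2 * ((u t x).re * (pt u t x).re + (u t x).im * (pt u t x).im)) t := by
  refine HasDerivAt.congr_deriv (((hu.hasDerivAt_re t x).mul (hu.hasDerivAt_re t x)).add
    ((hu.hasDerivAt_im t x).mul (hu.hasDerivAt_im t x))) ?_
  ring

theorem hasDerivAt_virialDens {u : ℝ → E3 → ℂ} (hu : SpaceTimeSmooth u)
    (e : ℝ) (y : E3) (t : ℝ) (x : E3) : HasDerivAt (fun t => virialDens e u y t x)
      (virialRate e u y t x) t := by
  refine HasDerivAt.fun_sum fun j _ => HasDerivAt.const_mul _ ?_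
  simp only [← hu.pt_px]
  exact ((hu.hasDerivAt_re t x).mul ((hu.px j).hasDerivAt_im t x)).sub
    ((hu.hasDerivAt_im t x).mul ((hu.px j).hasDerivAt_re t x))

theorem hasLineDerivAt_virialFlux {u : ℝ → E3 → ℂ} (hu : SpaceTimeSmooth u)
    {e : ℝ} (he : 0 < e) (k : Fin 3) (y : E3) (t : ℝ) (x : E3) :
    HasLineDerivAt ℝ (virialFlux e u k y t) (virialFluxDeriv e u k y t x) x
      (EuclideanSpace.single k 1) := by
  have h := hu.hasLineDerivAt k t x
  have ht := hu.pt.hasLineDerivAt k t x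
  have hk := (hu.px k).hasLineDerivAt k t x
  have hm := hasLineDerivAt_massDens hu k t x
  refine HasLineDerivAt.congr_val (f := virialFlux e u k y t) (hasLineDerivAt_sub
    (hasLineDerivAt_add
      (hasLineDerivAt_sub
        (hasLineDerivAt_mul (hasLineDerivAt_gradDist he (x - y) k k).comp_sub_right
          (hasLineDerivAt_add (hasLineDerivAt_add
            (hasLineDerivAt_sub (hasLineDerivAt_mul (hasLineDerivAt_re h) (hasLineDerivAt_im ht))
              (hasLineDerivAt_mul (hasLineDerivAt_im h) (hasLineDerivAt_re ht)))
            (hasLineDerivAt_sum fun j _ => hasLineDerivAt_gradProd hu j j k t x))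
            (hasLineDerivAt_const_mul _ (hasLineDerivAt_mul hm hm))))
        (hasLineDerivAt_mul (hasLineDerivAt_lapDist he (x - y) k).comp_sub_right
          (hasLineDerivAt_add
            (hasLineDerivAt_mul (hasLineDerivAt_re h) (hasLineDerivAt_re hk))
            (hasLineDerivAt_mul (hasLineDerivAt_im h) (hasLineDerivAt_im hk)))))
      (hasLineDerivAt_const_mul _
        (hasLineDerivAt_mul (hasLineDerivAt_gradLapDist he (x - y) k).comp_sub_right hm)))
    (hasLineDerivAt_const_mul _ (hasLineDerivAt_sum fun j _ =>
      hasLineDerivAt_mul (hasLineDerivAt_gradDist he (x - y) j k).comp_sub_right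
        (hasLineDerivAt_gradProd hu j k k t x)))) ?_
  simp only [virialFluxDeriv, Fin.sum_univ_three]
  simp only [gradProd]
  ring

theorem hessDist_comm (e : ℝ) (j k : Fin 3) (w : E3) : hessDist e j k w = hessDist e k j w := by
  simp only [hessDist, eq_comm (a := j)]
  ring

theorem SchwartzSolution.virialRate_eq {T : ℝ} {u : ℝ → E3 → ℂ} {U : ℝ → S3}
    (h : SchwartzSolution T u U) {e : ℝ} (he : 0 < e) (y : E3) {t : ℝ} (ht : t ∈ Set.Icc 0 T)
    (x : E3) :
    virialRate e u y t x = ∑ k, virialFluxDeriv e u k y t x + virialSource e u y t x := by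
  have hu := h.smooth
  have h1 := h.pt_re ht x
  have h2 := h.pt_im ht x
  have h3 := sum_hessDist he (x - y)
  have h4 := sum_hessLapDist he (x - y)
  have c1 := hu.px_px 0 1 t x
  have c2 := hu.px_px 0 2 t x
  have c3 := hu.px_px 1 2 t x
  simp only [virialRate, virialFluxDeriv, virialSource, gradProd, massDens, Fin.sum_univ_three,
    hessDist_comm e 1 0, hessDist_comm e 2 0, hessDist_comm e 2 1, c1, c2, c3] at h1 h2 h3 h4 ⊢
  linear_combination
    (2 * (gradDist e 0 (x - y) * (px 0 u t x).im + gradDist e 1 (x - y) * (px 1 u t x).im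
        + gradDist e 2 (x - y) * (px 2 u t x).im)
      + (hessDist e 0 0 (x - y) + hessDist e 1 1 (x - y) + hessDist e 2 2 (x - y)) * (u t x).im)
      * h1
    - (2 * (gradDist e 0 (x - y) * (px 0 u t x).re + gradDist e 1 (x - y) * (px 1 u t x).re
        + gradDist e 2 (x - y) * (px 2 u t x).re)
      + (hessDist e 0 0 (x - y) + hessDist e 1 1 (x - y) + hessDist e 2 2 (x - y)) * (u t x).re)
      * h2
    - ((u t x).re * ((px 0 (px 0 u) t x).re + (px 1 (px 1 u) t x).re + (px 2 (px 2 u) t x).re)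
      + (u t x).im * ((px 0 (px 0 u) t x).im + (px 1 (px 1 u) t x).im + (px 2 (px 2 u) t x).im)
      - ((u t x).re ^ 2 + (u t x).im ^ 2) ^ 2 / 2
      + ((px 0 u t x).re ^ 2 + (px 0 u t x).im ^ 2 + ((px 1 u t x).re ^ 2 + (px 1 u t x).im ^ 2)
        + ((px 2 u t x).re ^ 2 + (px 2 u t x).im ^ 2))) * h3
    - ((u t x).re ^ 2 + (u t x).im ^ 2) / 2 * h4

theorem SchwartzSolution.massDens_rate_eq {T : ℝ} {u : ℝ → E3 → ℂ} {U : ℝ → S3}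
    (h : SchwartzSolution T u U) {t : ℝ} (ht : t ∈ Set.Icc 0 T) (x : E3) :
    (u t x).re * (pt u t x).re + (u t x).im * (pt u t x).im = -∑ k,
      ((u t x).re * (px k (px k u) t x).im - (u t x).im * (px k (px k u) t x).re) := by
  rw [h.pt_re ht, h.pt_im ht]
  simp only [Fin.sum_univ_three]
  ring

theorem invDist_le {e : ℝ} (he : 0 < e) (w : E3) : invDist e w ≤ e⁻¹ := by
  rw [← one_div, le_div_iff₀' he]
  exact mul_invDist_le he w

theorem abs_gradDist_le {e : ℝ} (he : 0 < e) (j : Fin 3) (w : E3) : |gradDist e j w| ≤ 1 :=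
  abs_coord_mul_invDist_le he w j

theorem abs_hessDist_le {e : ℝ} (he : 0 < e) (j k : Fin 3) (w : E3) :
    |hessDist e j k w| ≤ 2 * e⁻¹ := by
  have h0 := invDist_pos he w
  have h1 := invDist_le he w
  have h2 := abs_gradDist_le he j w
  have h3 := abs_gradDist_le he k w
  have h4 : hessDist e j k w
      = ((if j = k then 1 else 0) - gradDist e j w * gradDist e k w) * invDist e w := by
    rw [hessDist, gradDist, gradDist]
    ring
  rw [h4, abs_mul, abs_of_pos h0]
  refine mul_le_mul ?_ h1 h0.le zero_le_two
  refine (abs_sub _ _).trans ?_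
  rw [abs_mul]
  have h5 : |(if j = k then (1 : ℝ) else 0)| ≤ 1 := by split_ifs <;> simp
  have h6 := mul_le_one₀ h2 (abs_nonneg _) h3
  linarith

theorem abs_lapDist_le {e : ℝ} (he : 0 < e) (w : E3) : |lapDist e w| ≤ 3 * e⁻¹ := by
  rw [abs_of_nonneg (lapDist_nonneg he w)]
  exact (lapDist_le he w).trans (by linarith [invDist_le he w])

theorem abs_gradLapDist_le {e : ℝ} (he : 0 < e) (k : Fin 3) (w : E3) :
    |gradLapDist e k w| ≤ 5 * e⁻¹ ^ 2 := by
  have h0 := invDist_pos he w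
  have h1 := invDist_le he w
  have h2 := abs_gradDist_le he k w
  have h3 := mul_invDist_le he w
  have h4 : gradLapDist e k w
      = -(gradDist e k w * ((2 + 3 * (e * invDist e w) ^ 2) * invDist e w ^ 2)) := by
    rw [gradLapDist, gradDist]
    ring
  have h5 : (e * invDist e w) ^ 2 ≤ 1 := pow_le_one₀ (by positivity) h3
  rw [h4, abs_neg, abs_mul, abs_of_nonneg (a := (2 + _) * _) (by positivity)]
  refine (mul_le_of_le_one_left (by positivity) h2).trans ?_
  gcongr
  linarith

theorem pow_four_mul_invDist_pow_le {e : ℝ} (he : 0 < e) (w : E3) :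
    e ^ 4 * invDist e w ^ 7 ≤ e⁻¹ ^ 3 := by
  have h0 := invDist_pos he w
  have h1 := invDist_le he w
  have h3 := mul_invDist_le he w
  have h4 : e ^ 4 * invDist e w ^ 7 = (e * invDist e w) ^ 4 * invDist e w ^ 3 := by ring
  rw [h4]
  exact (mul_le_of_le_one_left (by positivity) (pow_le_one₀ (by positivity) h3)).trans
    (by gcongr)

/-- The density of the inhomogeneous Sobolev norm of order one. -/
def sobolevDens (u : ℝ → E3 → ℂ) (t : ℝ) (x : E3) : ℝ :=
  ‖u t x‖ ^ 2 + ∑ j, ‖px j u t x‖ ^ 2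

/-- A majorant for the fluxes in the virial identity. -/
def fluxDens (u : ℝ → E3 → ℂ) (t : ℝ) (x : E3) : ℝ :=
  sobolevDens u t x + ‖u t x‖ ^ 4 + ∑ j, ‖px j (px j u) t x‖ * ‖u t x‖

theorem massDens_eq (u : ℝ → E3 → ℂ) (t : ℝ) (x : E3) : massDens u t x = ‖u t x‖ ^ 2 := by
  rw [massDens, norm_sq_eq_re_add_im]
  ring

theorem massDens_nonneg (u : ℝ → E3 → ℂ) (t : ℝ) (x : E3) : 0 ≤ massDens u t x := by
  rw [massDens_eq]
  positivity

theorem sobolevDens_nonneg (u : ℝ → E3 → ℂ) (t : ℝ) (x : E3) : 0 ≤ sobolevDens u t x := by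
  unfold sobolevDens
  positivity

theorem norm_mul_norm_px_le (u : ℝ → E3 → ℂ) (j : Fin 3) (t : ℝ) (x : E3) :
    ‖u t x‖ * ‖px j u t x‖ ≤ sobolevDens u t x := by
  have h := Finset.single_le_sum (f := fun j => ‖px j u t x‖ ^ 2) (fun i _ => sq_nonneg _)
    (Finset.mem_univ j)
  rw [sobolevDens]
  nlinarith [sq_nonneg (‖u t x‖ - ‖px j u t x‖), sq_nonneg (‖u t x‖ + ‖px j u t x‖)]

theorem massDens_le (u : ℝ → E3 → ℂ) (t : ℝ) (x : E3) : massDens u t x ≤ sobolevDens u t x := by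
  rw [massDens_eq, sobolevDens]
  have : 0 ≤ ∑ j, ‖px j u t x‖ ^ 2 := by positivity
  linarith

theorem abs_momDens_le (u : ℝ → E3 → ℂ) (j : Fin 3) (t : ℝ) (x : E3) :
    |momDens u j t x| ≤ sobolevDens u t x := by
  refine le_trans ?_ (norm_mul_norm_px_le u j t x)
  rw [momDens, ← abs_neg, neg_sub]
  exact abs_im_mul_re_sub_le _ _

theorem abs_gradProd_le (u : ℝ → E3 → ℂ) (j k : Fin 3) (t : ℝ) (x : E3) :
    |gradProd u j k t x| ≤ sobolevDens u t x := by
  refine (abs_re_mul_re_add_le _ _).trans ?_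
  have h1 := Finset.single_le_sum (f := fun j => ‖px j u t x‖ ^ 2) (fun i _ => sq_nonneg _)
    (Finset.mem_univ j)
  have h2 := Finset.single_le_sum (f := fun j => ‖px j u t x‖ ^ 2) (fun i _ => sq_nonneg _)
    (Finset.mem_univ k)
  rw [sobolevDens]
  nlinarith [sq_nonneg (‖px j u t x‖ - ‖px k u t x‖), sq_nonneg ‖u t x‖]

theorem abs_virialDens_le {e : ℝ} (he : 0 < e) (u : ℝ → E3 → ℂ) (y : E3) (t : ℝ) (x : E3) :
    |virialDens e u y t x| ≤ 3 * sobolevDens u t x := by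
  refine (Finset.abs_sum_le_sum_abs _ _).trans ?_
  have h : ∀ j, |gradDist e j (x - y) * momDens u j t x| ≤ sobolevDens u t x := fun j => by
    rw [abs_mul]
    exact (mul_le_of_le_one_left (abs_nonneg _) (abs_gradDist_le he j _)).trans
      (abs_momDens_le u j t x)
  refine (Finset.sum_le_sum fun j _ => h j).trans ?_
  simp

theorem SchwartzSolution.abs_mul_pt_sub_le {T : ℝ} {u : ℝ → E3 → ℂ} {U : ℝ → S3}
    (h : SchwartzSolution T u U) {t : ℝ} (ht : t ∈ Set.Icc 0 T) (x : E3) :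
    |(u t x).re * (pt u t x).im - (u t x).im * (pt u t x).re| ≤ fluxDens u t x := by
  have h1 : (u t x).re * (pt u t x).im - (u t x).im * (pt u t x).re
      = ∑ j, ((px j (px j u) t x).re * (u t x).re + (px j (px j u) t x).im * (u t x).im)
        - ‖u t x‖ ^ 4 := by
    have h4 : ‖u t x‖ ^ 4 = (‖u t x‖ ^ 2) ^ 2 := by ring
    rw [h.pt_re ht, h.pt_im ht, h4, norm_sq_eq_re_add_im]
    simp only [Fin.sum_univ_three]
    ring
  rw [h1, fluxDens]
  refine (abs_sub _ _).trans ?_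
  have h2 : |∑ j, ((px j (px j u) t x).re * (u t x).re + (px j (px j u) t x).im * (u t x).im)|
      ≤ ∑ j, ‖px j (px j u) t x‖ * ‖u t x‖ :=
    (Finset.abs_sum_le_sum_abs _ _).trans
      (Finset.sum_le_sum fun j _ => abs_re_mul_re_add_le _ _)
  rw [abs_of_nonneg (a := ‖u t x‖ ^ 4) (by positivity)]
  linarith [sobolevDens_nonneg u t x]

theorem sobolevDens_le_fluxDens (u : ℝ → E3 → ℂ) (t : ℝ) (x : E3) :
    sobolevDens u t x + ‖u t x‖ ^ 4 ≤ fluxDens u t x := by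
  unfold fluxDens
  have : 0 ≤ ∑ j, ‖px j (px j u) t x‖ * ‖u t x‖ := by positivity
  linarith

theorem SchwartzSolution.abs_virialFlux_le {T : ℝ} {u : ℝ → E3 → ℂ} {U : ℝ → S3}
    (h : SchwartzSolution T u U) {e : ℝ} (he : 0 < e) (k : Fin 3) (y : E3) {t : ℝ}
    (ht : t ∈ Set.Icc 0 T) (x : E3) :
    |virialFlux e u k y t x| ≤ (11 + 3 * e⁻¹ + 5 * e⁻¹ ^ 2) * fluxDens u t x := by
  have hS := sobolevDens_nonneg u t x
  have hG := sobolevDens_le_fluxDens u t x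
  have h4 : 0 ≤ ‖u t x‖ ^ 4 := by positivity
  have hSG : sobolevDens u t x ≤ fluxDens u t x := by linarith
  have hG0 : 0 ≤ fluxDens u t x := hS.trans hSG
  have hQ : ∀ j k, |gradProd u j k t x| ≤ fluxDens u t x := fun j k =>
    (abs_gradProd_le u j k t x).trans hSG
  have a1 : |gradDist e k (x - y) * ((u t x).re * (pt u t x).im - (u t x).im * (pt u t x).re
      + ∑ j, gradProd u j j t x + 2⁻¹ * (massDens u t x * massDens u t x))|
      ≤ 5 * fluxDens u t x := by
    rw [abs_mul]
    refine (mul_le_of_le_one_left (abs_nonneg _) (abs_gradDist_le he k _)).trans ?_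
    refine (abs_add_three _ _ _).trans ?_
    have b1 := h.abs_mul_pt_sub_le ht x
    have b2 : |∑ j, gradProd u j j t x| ≤ 3 * fluxDens u t x := by
      refine (Finset.abs_sum_le_sum_abs _ _).trans
        ((Finset.sum_le_sum fun j _ => hQ j j).trans ?_)
      simp
    have b3 : |2⁻¹ * (massDens u t x * massDens u t x)| = 2⁻¹ * ‖u t x‖ ^ 4 := by
      rw [massDens_eq, abs_of_nonneg (by positivity)]
      ring
    rw [b3]
    linarith
  have a2 : |lapDist e (x - y) * ((u t x).re * (px k u t x).re + (u t x).im * (px k u t x).im)|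
      ≤ 3 * e⁻¹ * fluxDens u t x := by
    rw [abs_mul]
    refine mul_le_mul (abs_lapDist_le he _) ?_ (abs_nonneg _) (by positivity)
    exact (abs_re_mul_re_add_le _ _).trans ((norm_mul_norm_px_le u k t x).trans hSG)
  have a3 : |2⁻¹ * (gradLapDist e k (x - y) * massDens u t x)|
      ≤ 5 * e⁻¹ ^ 2 * fluxDens u t x := by
    rw [abs_mul, abs_mul, abs_of_nonneg (massDens_nonneg u t x), abs_of_pos (by norm_num)]
    have := mul_le_mul (abs_gradLapDist_le he k (x - y)) ((massDens_le u t x).trans hSG)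
      (massDens_nonneg u t x) (by positivity)
    have h0 := mul_nonneg (abs_nonneg (gradLapDist e k (x - y))) (massDens_nonneg u t x)
    linarith
  have a4 : |2 * ∑ j, gradDist e j (x - y) * gradProd u j k t x| ≤ 6 * fluxDens u t x := by
    rw [abs_mul, abs_two]
    have : |∑ j, gradDist e j (x - y) * gradProd u j k t x| ≤ 3 * fluxDens u t x := by
      refine (Finset.abs_sum_le_sum_abs _ _).trans
        ((Finset.sum_le_sum (g := fun _ => fluxDens u t x) fun j _ => ?_).trans ?_)
      · rw [abs_mul]
        exact (mul_le_of_le_one_left (abs_nonneg _) (abs_gradDist_le he j _)).trans (hQ j k)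
      · simp
    linarith
  rw [virialFlux]
  refine (abs_sub _ _).trans ?_
  have c1 := abs_add_le (gradDist e k (x - y) * ((u t x).re * (pt u t x).im
      - (u t x).im * (pt u t x).re + ∑ j, gradProd u j j t x
      + 2⁻¹ * (massDens u t x * massDens u t x))
    - lapDist e (x - y) * ((u t x).re * (px k u t x).re + (u t x).im * (px k u t x).im))
    (2⁻¹ * (gradLapDist e k (x - y) * massDens u t x))
  have c2 := abs_sub (gradDist e k (x - y) * ((u t x).re * (pt u t x).im
      - (u t x).im * (pt u t x).re + ∑ j, gradProd u j j t x
      + 2⁻¹ * (massDens u t x * massDens u t x)))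
    (lapDist e (x - y) * ((u t x).re * (px k u t x).re + (u t x).im * (px k u t x).im))
  linarith

/-- The potential and kinetic part of the source term is controlled by the energy density. -/
theorem abs_virialSource_le {e : ℝ} (he : 0 < e) (u : ℝ → E3 → ℂ) (y : E3) (t : ℝ) (x : E3) :
    |virialSource e u y t x|
      ≤ (36 * e⁻¹ + 3 * e⁻¹ + 8 * e⁻¹ ^ 3) * (sobolevDens u t x + ‖u t x‖ ^ 4) := by
  have hS := sobolevDens_nonneg u t x
  have h4 : 0 ≤ ‖u t x‖ ^ 4 := by positivity
  have hi := (invDist_pos he (x - y)).le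
  have a1 : |2 * (∑ j, ∑ k, hessDist e j k (x - y) * gradProd u j k t x)|
      ≤ 36 * e⁻¹ * sobolevDens u t x := by
    rw [abs_mul, abs_two]
    have : |∑ j, ∑ k, hessDist e j k (x - y) * gradProd u j k t x|
        ≤ ∑ _j : Fin 3, ∑ _k : Fin 3, 2 * e⁻¹ * sobolevDens u t x := by
      refine (Finset.abs_sum_le_sum_abs _ _).trans (Finset.sum_le_sum fun j _ =>
        (Finset.abs_sum_le_sum_abs _ _).trans (Finset.sum_le_sum fun k _ => ?_))
      rw [abs_mul]
      exact mul_le_mul (abs_hessDist_le he j k _) (abs_gradProd_le u j k t x) (abs_nonneg _)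
        (by positivity)
    simp only [Finset.sum_const, Finset.card_univ, Fintype.card_fin, nsmul_eq_mul] at this
    push_cast at this
    linarith
  have a2 : |2⁻¹ * (lapDist e (x - y) * (massDens u t x * massDens u t x))|
      ≤ 3 * e⁻¹ * ‖u t x‖ ^ 4 := by
    have b : massDens u t x * massDens u t x = ‖u t x‖ ^ 4 := by
      rw [massDens_eq]
      ring
    rw [b, abs_mul, abs_mul, abs_of_nonneg h4, abs_of_pos (by norm_num)]
    have := mul_le_mul_of_nonneg_right (abs_lapDist_le he (x - y)) h4
    have h0 := mul_nonneg (abs_nonneg (lapDist e (x - y))) h4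
    linarith
  have a3 : |15 / 2 * (e ^ 4 * invDist e (x - y) ^ 7 * massDens u t x)|
      ≤ 8 * e⁻¹ ^ 3 * sobolevDens u t x := by
    have hm := massDens_nonneg u t x
    rw [abs_of_nonneg (by positivity)]
    have := mul_le_mul (pow_four_mul_invDist_pow_le he (x - y)) (massDens_le u t x) hm
      (by positivity)
    have h0 : 0 ≤ e⁻¹ ^ 3 * sobolevDens u t x := by positivity
    linarith
  rw [virialSource]
  refine (abs_add_three _ _ _).trans ?_
  have b1 : 0 ≤ e⁻¹ * ‖u t x‖ ^ 4 := by positivity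
  have b2 : 0 ≤ e⁻¹ * sobolevDens u t x := by positivity
  have b3 : 0 ≤ e⁻¹ ^ 3 * ‖u t x‖ ^ 4 := by positivity
  linarith

namespace SchwartzSolution

variable {T : ℝ} {u : ℝ → E3 → ℂ} {U : ℝ → S3}

theorem integrable_sobolevDens (h : SchwartzSolution T u U) {t : ℝ} (ht : t ∈ Set.Icc 0 T) :
    Integrable (sobolevDens u t) := by
  have e : sobolevDens u t = fun x => ‖U t x‖ ^ 2 + ∑ j, ‖dS j (U t) x‖ ^ 2 := by
    ext x
    simp only [sobolevDens, h.coe t ht, h.px_coe ht]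
  rw [e]
  exact ((U t).integrable_norm_pow two_ne_zero).add
    (integrable_finsetSum _ fun j _ => (dS j (U t)).integrable_norm_pow two_ne_zero)

theorem integral_sobolevDens_le (h : SchwartzSolution T u U) {t K : ℝ} (ht : t ∈ Set.Icc 0 T)
    (hK : RegBound (U t) K) : ∫ x, sobolevDens u t x ≤ 7 * K := by
  simp only [sobolevDens, h.coe t ht, h.px_coe ht]
  have hj : ∀ j, Integrable fun x => ‖dS j (U t) x‖ ^ 2 := fun j =>
    (dS j (U t)).integrable_norm_pow two_ne_zero
  rw [integral_add ((U t).integrable_norm_pow two_ne_zero)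
    (integrable_finsetSum _ fun j _ => hj j), integral_finsetSum _ fun j _ => hj j]
  have h1 := Finset.sum_le_sum fun (j : Fin 3) (_ : j ∈ Finset.univ) => hK.integral_sq_dS_le j
  simp only [Finset.sum_const, Finset.card_univ, Fintype.card_fin, nsmul_eq_mul] at h1
  push_cast at h1
  linarith [hK.mass]

theorem integrable_pow_four (h : SchwartzSolution T u U) {t : ℝ} (ht : t ∈ Set.Icc 0 T) :
    Integrable fun x => ‖u t x‖ ^ 4 := by
  simp only [h.coe t ht]
  exact (U t).integrable_norm_pow (by norm_num)

theorem integral_pow_four_le (h : SchwartzSolution T u U) {t K : ℝ} (ht : t ∈ Set.Icc 0 T)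
    (hK : RegBound (U t) K) : ∫ x, ‖u t x‖ ^ 4 ≤ 4 * K := by
  simp only [h.coe t ht]
  exact (integral_pow_four_le_energy (U t)).trans (by linarith [hK.energy])

theorem integrable_fluxDens (h : SchwartzSolution T u U) {t : ℝ} (ht : t ∈ Set.Icc 0 T) :
    Integrable (fluxDens u t) := by
  refine ((h.integrable_sobolevDens ht).add (h.integrable_pow_four ht)).add
    (integrable_finsetSum _ fun j _ => ?_)
  simp only [h.coe t ht, h.px_px_coe ht]
  simpa using (mulS (dS j (dS j (U t))) (U t)).integrable.norm

theorem setIntegral_fluxDens_le (h : SchwartzSolution T u U) {t K R : ℝ} (ht : t ∈ Set.Icc 0 T)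
    (hK : RegBound (U t) K) (hR : 1 ≤ R) : ∫ x in Metric.ball 0 (2 * R), fluxDens u t x
      ≤ (11 * K + 3 * ((4 * (1 + K)) ^ 4 + K + 8 * volume.real (Metric.ball (0 : E3) 1)))
        * R ^ (3/4 : ℝ) := by
  have hK0 := hK.nonneg
  have hL := one_le_rpow_three_fourths hR
  have hb : ∀ j, ∫ x in Metric.ball 0 (2 * R), ‖px j (px j u) t x‖ * ‖u t x‖
      ≤ ((4 * (1 + K)) ^ 4 + K + 8 * volume.real (Metric.ball (0 : E3) 1)) * R ^ (3/4 : ℝ) := by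
    intro j
    simp only [h.coe t ht, h.px_px_coe ht]
    refine (setIntegral_ball_mul_le (fun x => norm_nonneg _) (fun x => norm_nonneg _)
      ((dS j (dS j (U t))).integrable_norm_pow (by norm_num))
      ((U t).integrable_norm_pow two_ne_zero) hR).trans ?_
    gcongr
    · exact integral_pow_four_le_of_nFour_le (hK.nFour_le j).2.1
    · exact hK.mass
  have hi : ∀ j, Integrable fun x => ‖px j (px j u) t x‖ * ‖u t x‖ := fun j => by
    simp only [h.coe t ht, h.px_px_coe ht]
    simpa using (mulS (dS j (dS j (U t))) (U t)).integrable.norm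
  have h1 : Integrable fun x => sobolevDens u t x + ‖u t x‖ ^ 4 :=
    (h.integrable_sobolevDens ht).add (h.integrable_pow_four ht)
  have h2 : ∫ x in Metric.ball 0 (2 * R), (sobolevDens u t x + ‖u t x‖ ^ 4) ≤ 11 * K := by
    refine (setIntegral_le_integral h1 (Filter.Eventually.of_forall fun x =>
      add_nonneg (sobolevDens_nonneg u t x) (by positivity))).trans ?_
    rw [integral_add (h.integrable_sobolevDens ht) (h.integrable_pow_four ht)]
    linarith [h.integral_sobolevDens_le ht hK, h.integral_pow_four_le ht hK]
  have h3 : Integrable fun x => ∑ j, ‖px j (px j u) t x‖ * ‖u t x‖ :=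
    integrable_finsetSum _ fun j _ => hi j
  simp only [fluxDens]
  rw [integral_add h1.integrableOn h3.integrableOn,
    integral_finsetSum _ fun j _ => (hi j).integrableOn]
  have h4 := Finset.sum_le_sum fun (j : Fin 3) (_ : j ∈ Finset.univ) => hb j
  simp only [Finset.sum_const, Finset.card_univ, Fintype.card_fin, nsmul_eq_mul] at h4
  push_cast at h4
  nlinarith [mul_le_mul_of_nonneg_left hL hK0]

end SchwartzSolution

/-- The interaction momentum density. -/
def interDens (e : ℝ) (u : ℝ → E3 → ℂ) (t : ℝ) (p : E3 × E3) : ℝ :=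
  massDens u t p.2 * virialDens e u p.2 t p.1

/-- The source in the interaction Morawetz identity. -/
def interSource (e : ℝ) (u : ℝ → E3 → ℂ) (t : ℝ) (p : E3 × E3) : ℝ :=
  massDens u t p.2 * virialSource e u p.2 t p.1
    - 2 * ∑ k, (∑ j, hessDist e j k (p.1 - p.2) * momDens u j t p.1) * momDens u k t p.2

theorem setIntegral_ball_prod_mul (f g : E3 → ℝ) (R : ℝ) :
    ∫ p in Metric.ball (0 : E3 × E3) R, f p.1 * g p.2
      = (∫ x in Metric.ball 0 R, f x) * ∫ y in Metric.ball 0 R, g y := by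
  have : Metric.ball (0 : E3 × E3) R = Metric.ball 0 R ×ˢ Metric.ball 0 R :=
    (ball_prod_same 0 0 R).symm
  rw [this]
  exact setIntegral_prod_mul f g _ _

theorem continuous_virialDens {e : ℝ} (he : 0 < e) {u : ℝ → E3 → ℂ} (hu : SpaceTimeSmooth u) :
    Continuous fun p : E3 × ℝ × E3 => virialDens e u p.1 p.2.1 p.2.2 := by
  have h1 := hu.continuous
  have h2 := fun j => (hu.px j).continuous
  have h3 := fun j => continuous_gradDist he j
  unfold virialDens momDens
  fun_prop

theorem continuous_virialRate {e : ℝ} (he : 0 < e) {u : ℝ → E3 → ℂ} (hu : SpaceTimeSmooth u) :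
    Continuous fun p : E3 × ℝ × E3 => virialRate e u p.1 p.2.1 p.2.2 := by
  have h1 := hu.continuous
  have h2 := fun j => (hu.px j).continuous
  have h3 := fun j => continuous_gradDist he j
  have h4 := hu.pt.continuous
  have h5 := fun j => (hu.pt.px j).continuous
  unfold virialRate
  fun_prop

theorem continuous_virialFlux {e : ℝ} (he : 0 < e) {u : ℝ → E3 → ℂ} (hu : SpaceTimeSmooth u)
    (k : Fin 3) : Continuous fun p : E3 × ℝ × E3 => virialFlux e u k p.1 p.2.1 p.2.2 := by
  have h1 := hu.continuous
  have h2 := fun j => (hu.px j).continuous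
  have h3 := fun j => continuous_gradDist he j
  have h4 := hu.pt.continuous
  have h5 := continuous_lapDist he
  have h6 := continuous_gradLapDist he k
  unfold virialFlux gradProd massDens
  fun_prop

theorem continuous_virialFluxDeriv {e : ℝ} (he : 0 < e) {u : ℝ → E3 → ℂ}
    (hu : SpaceTimeSmooth u) (k : Fin 3) :
    Continuous fun p : E3 × ℝ × E3 => virialFluxDeriv e u k p.1 p.2.1 p.2.2 := by
  have h1 := hu.continuous
  have h2 := fun j => (hu.px j).continuous
  have h3 := fun j => continuous_gradDist he j
  have h4 := hu.pt.continuous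
  have h5 := continuous_lapDist he
  have h6 := continuous_hessLapDist he k
  have h7 := fun j => continuous_hessDist he j k
  have h8 := fun j => ((hu.px j).px k).continuous
  have h9 := (hu.pt.px k).continuous
  unfold virialFluxDeriv gradProd massDens
  fun_prop

theorem continuous_massDens {u : ℝ → E3 → ℂ} (hu : SpaceTimeSmooth u) :
    Continuous fun p : ℝ × E3 => massDens u p.1 p.2 := by
  have := hu.continuous
  unfold massDens
  fun_prop

theorem continuous_momDens {u : ℝ → E3 → ℂ} (hu : SpaceTimeSmooth u) (j : Fin 3) :
    Continuous fun p : ℝ × E3 => momDens u j p.1 p.2 := by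
  have := hu.continuous
  have := (hu.px j).continuous
  unfold momDens
  fun_prop

theorem continuous_interDens {e : ℝ} (he : 0 < e) {u : ℝ → E3 → ℂ} (hu : SpaceTimeSmooth u) :
    Continuous (Function.uncurry (interDens e u)) := by
  have h1 : Continuous fun p : ℝ × E3 × E3 => massDens u p.1 p.2.2 :=
    (continuous_massDens hu).comp (f := fun p : ℝ × E3 × E3 => (p.1, p.2.2)) (by fun_prop)
  have h2 : Continuous fun p : ℝ × E3 × E3 => virialDens e u p.2.2 p.1 p.2.1 :=
    (continuous_virialDens he hu).comp
      (f := fun p : ℝ × E3 × E3 => (p.2.2, p.1, p.2.1)) (by fun_prop)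
  exact h1.mul h2

theorem continuous_interSource {e : ℝ} (he : 0 < e) {u : ℝ → E3 → ℂ} (hu : SpaceTimeSmooth u) :
    Continuous (Function.uncurry (interSource e u)) := by
  have h1 := hu.continuous
  have h2 := fun j => (hu.px j).continuous
  have h3 := fun j k => continuous_hessDist he j k
  have h4 := continuous_lapDist he
  have h5 := continuous_invDist he
  simp only [Function.uncurry_def, interSource, virialSource, gradProd, massDens, momDens]
  fun_prop

theorem abs_interDens_le {e : ℝ} (he : 0 < e) (u : ℝ → E3 → ℂ) (t : ℝ) (p : E3 × E3) :
    |interDens e u t p| ≤ 3 * (sobolevDens u t p.1 * sobolevDens u t p.2) := by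
  rw [interDens, abs_mul, abs_of_nonneg (massDens_nonneg u t p.2)]
  have := mul_le_mul (massDens_le u t p.2) (abs_virialDens_le he u p.2 t p.1) (abs_nonneg _)
    (sobolevDens_nonneg u t p.2)
  linarith

theorem abs_interSource_le {e : ℝ} (he : 0 < e) (u : ℝ → E3 → ℂ) (t : ℝ) (p : E3 × E3) :
    |interSource e u t p| ≤ (75 * e⁻¹ + 8 * e⁻¹ ^ 3)
      * ((sobolevDens u t p.1 + ‖u t p.1‖ ^ 4) * sobolevDens u t p.2) := by
  have hS := sobolevDens_nonneg u t p.1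
  have hS' := sobolevDens_nonneg u t p.2
  have h4 : 0 ≤ ‖u t p.1‖ ^ 4 := by positivity
  have a1 : |massDens u t p.2 * virialSource e u p.2 t p.1| ≤ (39 * e⁻¹ + 8 * e⁻¹ ^ 3)
      * ((sobolevDens u t p.1 + ‖u t p.1‖ ^ 4) * sobolevDens u t p.2) := by
    rw [abs_mul, abs_of_nonneg (massDens_nonneg u t p.2)]
    have := mul_le_mul (massDens_le u t p.2) (abs_virialSource_le he u p.2 t p.1) (abs_nonneg _)
      hS'
    linarith
  have a2 : |2 * ∑ k, (∑ j, hessDist e j k (p.1 - p.2) * momDens u j t p.1) * momDens u k t p.2|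
      ≤ 36 * e⁻¹ * (sobolevDens u t p.1 * sobolevDens u t p.2) := by
    rw [abs_mul, abs_two]
    have : |∑ k, (∑ j, hessDist e j k (p.1 - p.2) * momDens u j t p.1) * momDens u k t p.2|
        ≤ ∑ _k : Fin 3, (∑ _j : Fin 3, 2 * e⁻¹ * sobolevDens u t p.1) * sobolevDens u t p.2 := by
      refine (Finset.abs_sum_le_sum_abs _ _).trans (Finset.sum_le_sum fun k _ => ?_)
      rw [abs_mul]
      refine mul_le_mul ?_ (abs_momDens_le u k t p.2) (abs_nonneg _)
        (Finset.sum_nonneg fun _ _ => by positivity)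
      refine (Finset.abs_sum_le_sum_abs _ _).trans (Finset.sum_le_sum fun j _ => ?_)
      rw [abs_mul]
      exact mul_le_mul (abs_hessDist_le he j k _) (abs_momDens_le u j t p.1) (abs_nonneg _)
        (by positivity)
    simp only [Finset.sum_const, Finset.card_univ, Fintype.card_fin, nsmul_eq_mul] at this
    push_cast at this
    linarith
  rw [interSource]
  refine (abs_sub _ _).trans ?_
  have b : 0 ≤ e⁻¹ * (‖u t p.1‖ ^ 4 * sobolevDens u t p.2) := by positivity
  linarith

namespace SchwartzSolution

variable {T : ℝ} {u : ℝ → E3 → ℂ} {U : ℝ → S3}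

theorem integrable_interDens (h : SchwartzSolution T u U) {e : ℝ} (he : 0 < e) {t : ℝ}
    (ht : t ∈ Set.Icc 0 T) : Integrable (interDens e u t) := by
  have hS := h.integrable_sobolevDens ht
  have hc : Continuous (interDens e u t) :=
    (continuous_interDens he h.smooth).comp (by fun_prop : Continuous fun p : E3 × E3 => (t, p))
  exact ((hS.mul_prod hS).const_mul 3).mono' hc.aestronglyMeasurable
    (Filter.Eventually.of_forall fun p => abs_interDens_le he u t p)

theorem integrable_interSource (h : SchwartzSolution T u U) {e : ℝ} (he : 0 < e) {t : ℝ}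
    (ht : t ∈ Set.Icc 0 T) : Integrable (interSource e u t) := by
  have hS := h.integrable_sobolevDens ht
  have hc : Continuous (interSource e u t) :=
    (continuous_interSource he h.smooth).comp
      (by fun_prop : Continuous fun p : E3 × E3 => (t, p))
  exact (((hS.add (h.integrable_pow_four ht)).mul_prod hS).const_mul _).mono'
    hc.aestronglyMeasurable (Filter.Eventually.of_forall fun p => abs_interSource_le he u t p)

theorem integral_abs_interSource_le (h : SchwartzSolution T u U) {e : ℝ} (he : 0 < e) {t K : ℝ}
    (ht : t ∈ Set.Icc 0 T) (hK : RegBound (U t) K) :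
    ∫ p, |interSource e u t p| ≤ (75 * e⁻¹ + 8 * e⁻¹ ^ 3) * (11 * K * (7 * K)) := by
  have hS := h.integrable_sobolevDens ht
  have h4 := h.integrable_pow_four ht
  have hSn : 0 ≤ ∫ x, sobolevDens u t x := integral_nonneg (sobolevDens_nonneg u t)
  have hK0 := hK.nonneg
  refine (integral_mono (h.integrable_interSource he ht).abs
    (((hS.add h4).mul_prod hS).const_mul _) fun p => abs_interSource_le he u t p).trans ?_
  rw [integral_const_mul]
  have e1 := integral_prod_mul (μ := (volume : Measure E3)) (ν := (volume : Measure E3))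
    (fun x => sobolevDens u t x + ‖u t x‖ ^ 4) (sobolevDens u t)
  have e2 : ∫ p : E3 × E3, (sobolevDens u t + fun x => ‖u t x‖ ^ 4) p.1 * sobolevDens u t p.2
      = (∫ x, (sobolevDens u t x + ‖u t x‖ ^ 4)) * ∫ x, sobolevDens u t x := e1
  rw [e2, integral_add hS h4]
  have l1 := h.integral_sobolevDens_le ht hK
  have l2 := h.integral_pow_four_le ht hK
  refine mul_le_mul_of_nonneg_left (mul_le_mul (by linarith) l1 hSn (by positivity))
    (by positivity)

end SchwartzSolution

/-- The coordinate directions in the product of two copies of space. -/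
def pairDir : Fin 3 ⊕ Fin 3 → E3 × E3 :=
  Sum.elim (fun k => (EuclideanSpace.single k 1, 0)) (fun k => (0, EuclideanSpace.single k 1))

/-- The flux of the interaction momentum density. -/
def interFlux (e : ℝ) (u : ℝ → E3 → ℂ) : Fin 3 ⊕ Fin 3 → ℝ → E3 × E3 → ℝ
  | Sum.inl k => fun t p => massDens u t p.2 * virialFlux e u k p.2 t p.1
  | Sum.inr k => fun t p => -2 * (virialDens e u p.2 t p.1 * momDens u k t p.2)

/-- The divergence of `interFlux`, summand by summand. -/
def interFluxDeriv (e : ℝ) (u : ℝ → E3 → ℂ) : Fin 3 ⊕ Fin 3 → ℝ → E3 × E3 → ℝ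
  | Sum.inl k => fun t p => massDens u t p.2 * virialFluxDeriv e u k p.2 t p.1
  | Sum.inr k => fun t p => -2 * ((∑ j, -hessDist e j k (p.1 - p.2) * momDens u j t p.1)
      * momDens u k t p.2 + virialDens e u p.2 t p.1
      * ((u t p.2).re * (px k (px k u) t p.2).im - (u t p.2).im * (px k (px k u) t p.2).re))

theorem hasLineDerivAt_mul_const {E : Type*} [NormedAddCommGroup E] [NormedSpace ℝ E] {f : E → ℝ}
    {a : ℝ} {x v : E} (hf : HasLineDerivAt ℝ f a x v) (c : ℝ) :
    HasLineDerivAt ℝ (fun x => f x * c) (a * c) x v :=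
  HasDerivAt.mul_const hf c

theorem hasLineDerivAt_interFlux {e : ℝ} (he : 0 < e) {u : ℝ → E3 → ℂ} (hu : SpaceTimeSmooth u)
    (k : Fin 3 ⊕ Fin 3) (t : ℝ) (p : E3 × E3) :
    HasLineDerivAt ℝ (interFlux e u k t) (interFluxDeriv e u k t p) p (pairDir k) := by
  rcases k with k | k
  · refine hasLineDerivAt_prod_fst (f := interFlux e u (Sum.inl k) t) ?_
    exact hasLineDerivAt_const_mul (massDens u t p.2) (hasLineDerivAt_virialFlux hu he k p.2 t p.1)
  · refine hasLineDerivAt_prod_snd (f := interFlux e u (Sum.inr k) t) ?_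
    have h1 : HasLineDerivAt ℝ (fun y => virialDens e u y t p.1)
        (∑ j, -hessDist e j k (p.1 - p.2) * momDens u j t p.1) p.2 (EuclideanSpace.single k 1) :=
      hasLineDerivAt_sum fun j _ => hasLineDerivAt_mul_const
        (hasLineDerivAt_gradDist he (p.1 - p.2) j k).comp_sub_left (momDens u j t p.1)
    exact hasLineDerivAt_const_mul (-2 : ℝ)
      (hasLineDerivAt_mul h1 (hasLineDerivAt_momDens hu k t p.2))

theorem continuous_interFlux {e : ℝ} (he : 0 < e) {u : ℝ → E3 → ℂ} (hu : SpaceTimeSmooth u)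
    (k : Fin 3 ⊕ Fin 3) (t : ℝ) : Continuous (interFlux e u k t) := by
  have h1 : Continuous fun p : E3 × E3 => massDens u t p.2 :=
    (continuous_massDens hu).comp (f := fun p : E3 × E3 => (t, p.2)) (by fun_prop)
  rcases k with k | k
  · exact h1.mul ((continuous_virialFlux he hu k).comp
      (f := fun p : E3 × E3 => (p.2, t, p.1)) (by fun_prop))
  · exact (((continuous_virialDens he hu).comp
      (f := fun p : E3 × E3 => (p.2, t, p.1)) (by fun_prop)).mul
      ((continuous_momDens hu k).comp (f := fun p : E3 × E3 => (t, p.2)) (by fun_prop))).const_mul _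

theorem continuous_interFluxDeriv {e : ℝ} (he : 0 < e) {u : ℝ → E3 → ℂ} (hu : SpaceTimeSmooth u)
    (k : Fin 3 ⊕ Fin 3) (t : ℝ) : Continuous (interFluxDeriv e u k t) := by
  have h1 : Continuous fun p : E3 × E3 => massDens u t p.2 :=
    (continuous_massDens hu).comp (f := fun p : E3 × E3 => (t, p.2)) (by fun_prop)
  rcases k with k | k
  · exact h1.mul ((continuous_virialFluxDeriv he hu k).comp
      (f := fun p : E3 × E3 => (p.2, t, p.1)) (by fun_prop))
  · have h2 : Continuous fun p : E3 × E3 => virialDens e u p.2 t p.1 :=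
      (continuous_virialDens he hu).comp (f := fun p : E3 × E3 => (p.2, t, p.1)) (by fun_prop)
    have h3 := fun k => continuous_momDens hu k
    have h4 := fun j => continuous_hessDist he j k
    have h5 := hu.continuous
    have h6 := ((hu.px k).px k).continuous
    simp only [interFluxDeriv]
    fun_prop

namespace SchwartzSolution

variable {T : ℝ} {u : ℝ → E3 → ℂ} {U : ℝ → S3}

theorem abs_interFlux_le (h : SchwartzSolution T u U) {e : ℝ} (he : 0 < e) (k : Fin 3 ⊕ Fin 3)
    {t : ℝ} (ht : t ∈ Set.Icc 0 T) (p : E3 × E3) : |interFlux e u k t p|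
      ≤ (11 + 3 * e⁻¹ + 5 * e⁻¹ ^ 2) * (fluxDens u t p.1 * sobolevDens u t p.2) := by
  have hS := sobolevDens_nonneg u t p.1
  have hS' := sobolevDens_nonneg u t p.2
  have hG := sobolevDens_le_fluxDens u t p.1
  have h4 : 0 ≤ ‖u t p.1‖ ^ 4 := by positivity
  have hSG : sobolevDens u t p.1 ≤ fluxDens u t p.1 := by linarith
  rcases k with k | k
  · simp only [interFlux]
    rw [abs_mul, abs_of_nonneg (massDens_nonneg u t p.2)]
    have := mul_le_mul (massDens_le u t p.2) (h.abs_virialFlux_le he k p.2 ht p.1) (abs_nonneg _)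
      hS'
    linarith
  · simp only [interFlux]
    rw [abs_mul, abs_mul, abs_neg, abs_two]
    have h1 := mul_le_mul ((abs_virialDens_le he u p.2 t p.1).trans
      (mul_le_mul_of_nonneg_left hSG (by norm_num))) (abs_momDens_le u k t p.2) (abs_nonneg _)
      (mul_nonneg (by norm_num) (hS.trans hSG))
    have h2 : 0 ≤ fluxDens u t p.1 * sobolevDens u t p.2 := mul_nonneg (hS.trans hSG) hS'
    have h3 : 0 ≤ e⁻¹ * (fluxDens u t p.1 * sobolevDens u t p.2) := mul_nonneg (by positivity) h2
    have h4 : 0 ≤ e⁻¹ ^ 2 * (fluxDens u t p.1 * sobolevDens u t p.2) :=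
      mul_nonneg (by positivity) h2
    linarith

/-- The interaction Morawetz identity. -/
theorem integral_interDens_sub (h : SchwartzSolution T u U) {e : ℝ} (he : 0 < e) {c d K : ℝ}
    (hcd : Set.uIcc c d ⊆ Set.Icc 0 T) (hK : ∀ t ∈ Set.uIcc c d, RegBound (U t) K) :
    (∫ p, interDens e u d p) - ∫ p, interDens e u c p = ∫ t in c..d, ∫ p, interSource e u t p := by
  have hu := h.smooth
  have hK0 : 0 ≤ K := (hK c Set.left_mem_uIcc).nonneg
  set M := 11 * K + 3 * ((4 * (1 + K)) ^ 4 + K + 8 * volume.real (Metric.ball (0 : E3) 1))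
  have : (volume : Measure (E3 × E3)).IsAddHaarMeasure :=
    inferInstanceAs ((volume : Measure E3).prod volume).IsAddHaarMeasure
  refine integral_sub_integral_of_conservation_law (volume : Measure (E3 × E3)) pairDir
    (q := interDens e u)
    (q' := fun t p => 2 * ((u t p.2).re * (pt u t p.2).re + (u t p.2).im * (pt u t p.2).im)
      * virialDens e u p.2 t p.1 + massDens u t p.2 * virialRate e u p.2 t p.1)
    (r := interSource e u) (V := interFlux e u) (V' := interFluxDeriv e u)
    (K := (75 * e⁻¹ + 8 * e⁻¹ ^ 3) * (11 * K * (7 * K))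
      + (11 + 3 * e⁻¹ + 5 * e⁻¹ ^ 2) * (M * (7 * K)))
    (continuous_interDens he hu) ?_ ?_ (fun k t _ => continuous_interFlux he hu k t)
    (fun k t _ => continuous_interFluxDeriv he hu k t)
    (fun k t _ p => hasLineDerivAt_interFlux he hu k t p) ?_
    (h.integrable_interDens he (hcd Set.left_mem_uIcc))
    (h.integrable_interDens he (hcd Set.right_mem_uIcc))
    (fun t ht => h.integrable_interSource he (hcd ht)) ?_ ?_
  · have h1 := hu.continuous
    have h2 := hu.pt.continuous
    have h3 : Continuous fun p : ℝ × E3 × E3 => massDens u p.1 p.2.2 :=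
      (continuous_massDens hu).comp (f := fun p : ℝ × E3 × E3 => (p.1, p.2.2)) (by fun_prop)
    have h4 : Continuous fun p : ℝ × E3 × E3 => virialDens e u p.2.2 p.1 p.2.1 :=
      (continuous_virialDens he hu).comp
        (f := fun p : ℝ × E3 × E3 => (p.2.2, p.1, p.2.1)) (by fun_prop)
    have h5 : Continuous fun p : ℝ × E3 × E3 => virialRate e u p.2.2 p.1 p.2.1 :=
      (continuous_virialRate he hu).comp
        (f := fun p : ℝ × E3 × E3 => (p.2.2, p.1, p.2.1)) (by fun_prop)
    simp only [Function.uncurry_def]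
    refine (Continuous.mul ?_ h4).add (h3.mul h5)
    fun_prop
  · intro t p
    exact (hasDerivAt_massDens hu t p.2).mul (hasDerivAt_virialDens hu e p.2 t p.1)
  · intro t ht p
    have e1 := h.massDens_rate_eq (hcd ht) p.2
    have e2 := h.virialRate_eq he p.2 (hcd ht) p.1
    rw [e1, e2, Fintype.sum_sum_type]
    simp only [interFluxDeriv, interSource, Fin.sum_univ_three]
    ring
  · intro t ht
    have := h.integral_abs_interSource_le he (hcd ht) (hK t ht)
    simp only [Real.norm_eq_abs]
    have h0 : 0 ≤ (11 + 3 * e⁻¹ + 5 * e⁻¹ ^ 2) * (M * (7 * K)) := by positivity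
    linarith
  · intro k t ht R hR
    have hS := h.integrable_sobolevDens (hcd ht)
    have hF := h.integrable_fluxDens (hcd ht)
    have hi : Integrable fun p : E3 × E3 => fluxDens u t p.1 * sobolevDens u t p.2 :=
      hF.mul_prod hS
    have h0 : 0 ≤ (75 * e⁻¹ + 8 * e⁻¹ ^ 3) * (11 * K * (7 * K)) := by positivity
    have hRp : 0 ≤ R ^ (3/4 : ℝ) := by positivity
    have h1 : ∫ p in Metric.ball (0 : E3 × E3) (2 * R), ‖interFlux e u k t p‖
        ≤ (11 + 3 * e⁻¹ + 5 * e⁻¹ ^ 2) * ((∫ x in Metric.ball 0 (2 * R), fluxDens u t x)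
          * ∫ x in Metric.ball 0 (2 * R), sobolevDens u t x) := by
      rw [← setIntegral_ball_prod_mul, ← integral_const_mul]
      exact integral_mono_of_nonneg (Filter.Eventually.of_forall fun p => norm_nonneg _)
        (hi.const_mul _).integrableOn
        (Filter.Eventually.of_forall fun p => h.abs_interFlux_le he k (hcd ht) p)
    have h2 := h.setIntegral_fluxDens_le (hcd ht) (hK t ht) hR
    have h3 : ∫ x in Metric.ball 0 (2 * R), sobolevDens u t x ≤ 7 * K :=
      (setIntegral_le_integral hS (Filter.Eventually.of_forall (sobolevDens_nonneg u t))).trans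
        (h.integral_sobolevDens_le (hcd ht) (hK t ht))
    have h4 := mul_le_mul h2 h3 (integral_nonneg (sobolevDens_nonneg u t)) (by positivity)
    have h5 := mul_le_mul_of_nonneg_left h4
      (by positivity : 0 ≤ 11 + 3 * e⁻¹ + 5 * e⁻¹ ^ 2)
    have h6 := mul_nonneg h0 hRp
    refine h1.trans (h5.trans ?_)
    have h7 : ((75 * e⁻¹ + 8 * e⁻¹ ^ 3) * (11 * K * (7 * K))
        + (11 + 3 * e⁻¹ + 5 * e⁻¹ ^ 2) * (M * (7 * K))) * R ^ (3/4 : ℝ)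
        = (75 * e⁻¹ + 8 * e⁻¹ ^ 3) * (11 * K * (7 * K)) * R ^ (3/4 : ℝ)
        + (11 + 3 * e⁻¹ + 5 * e⁻¹ ^ 2) * (M * R ^ (3/4 : ℝ) * (7 * K)) := by ring
    rw [h7]
    exact le_add_of_nonneg_of_le h6 le_rfl

end SchwartzSolution

theorem hessDist_neg (e : ℝ) (j k : Fin 3) (w : E3) : hessDist e j k (-w) = hessDist e j k w := by
  simp only [hessDist, invDist_neg, PiLp.neg_apply, neg_mul_neg]

theorem lapDist_neg (e : ℝ) (w : E3) : lapDist e (-w) = lapDist e w := by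
  simp only [lapDist, invDist_neg]

/-- The part of the interaction Morawetz source that concentrates on the diagonal. -/
def diagDens (e : ℝ) (u : ℝ → E3 → ℂ) (t : ℝ) (p : E3 × E3) : ℝ :=
  e ^ 4 * invDist e (p.1 - p.2) ^ 7 * (massDens u t p.1 * massDens u t p.2)

theorem diagDens_nonneg {e : ℝ} (he : 0 < e) (u : ℝ → E3 → ℂ) (t : ℝ) (p : E3 × E3) :
    0 ≤ diagDens e u t p := by
  have := invDist_pos he (p.1 - p.2)
  have h1 := massDens_nonneg u t p.1
  have h2 := massDens_nonneg u t p.2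
  unfold diagDens
  positivity

/-- The symmetrised interaction source dominates its diagonal part. -/
theorem diagDens_le_interSource_add_swap {e : ℝ} (he : 0 < e) (u : ℝ → E3 → ℂ) (t : ℝ)
    (p : E3 × E3) :
    15 * diagDens e u t p ≤ interSource e u t p + interSource e u t p.swap := by
  obtain ⟨x, y⟩ := p
  have hn : y - x = -(x - y) := (neg_sub x y).symm
  have hH := hessDist_nonneg he (x - y)
  have hL := lapDist_nonneg he (x - y)
  have hm1 := massDens_nonneg u t x
  have hm2 := massDens_nonneg u t y
  have hLx : 0 ≤ lapDist e (x - y) * (massDens u t x * massDens u t y)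
      * (massDens u t x + massDens u t y) := by positivity
  have h10 := hessDist_comm e 1 0 (x - y)
  have h20 := hessDist_comm e 2 0 (x - y)
  have h21 := hessDist_comm e 2 1 (x - y)
  simp only [diagDens, interSource, virialSource, Prod.swap, hn, hessDist_neg, lapDist_neg,
    invDist_neg, Fin.sum_univ_three, h10, h20, h21, gradProd, momDens]
  simp only [massDens] at *
  generalize lapDist e (x - y) = L at *
  generalize e ^ 4 * invDist e (x - y) ^ 7 = s at *
  generalize hessDist e 0 0 (x - y) = H00 at *
  generalize hessDist e 1 1 (x - y) = H11 at *
  generalize hessDist e 2 2 (x - y) = H22 at *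
  generalize hessDist e 0 1 (x - y) = H01 at *
  generalize hessDist e 0 2 (x - y) = H02 at *
  generalize hessDist e 1 2 (x - y) = H12 at *
  generalize (u t x).re = f at *
  generalize (u t x).im = g at *
  generalize (u t y).re = f' at *
  generalize (u t y).im = g' at *
  generalize (px 0 u t x).re = f0 at *
  generalize (px 0 u t x).im = g0 at *
  generalize (px 0 u t y).re = f0' at *
  generalize (px 0 u t y).im = g0' at *
  generalize (px 1 u t x).re = f1 at *
  generalize (px 1 u t x).im = g1 at *
  generalize (px 1 u t y).re = f1' at *
  generalize (px 1 u t y).im = g1' at *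
  generalize (px 2 u t x).re = f2 at *
  generalize (px 2 u t x).im = g2 at *
  generalize (px 2 u t y).re = f2' at *
  generalize (px 2 u t y).im = g2' at *
  have k1 := hH (f' * f0 + g' * g0 + f * f0' + g * g0') (f' * f1 + g' * g1 + f * f1' + g * g1')
    (f' * f2 + g' * g2 + f * f2' + g * g2')
  have k2 := hH (f' * g0 - g' * f0 - f * g0' + g * f0') (f' * g1 - g' * f1 - f * g1' + g * f1')
    (f' * g2 - g' * f2 - f * g2' + g * f2')
  have k3 := hH (f' * f0 - g' * g0 - f * f0' + g * g0') (f' * f1 - g' * g1 - f * f1' + g * g1')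
    (f' * f2 - g' * g2 - f * f2' + g * g2')
  have k4 := hH (f' * g0 + g' * f0 - f * g0' - g * f0') (f' * g1 + g' * f1 - f * g1' - g * f1')
    (f' * g2 + g' * f2 - f * g2' - g * f2')
  clear hH hn hL hm1 hm2 h10 h20 h21
  rw [← sub_nonneg] at *
  refine (add_nonneg (add_nonneg (add_nonneg (add_nonneg k1 k2) k3) k4)
    (mul_nonneg (by norm_num : (0 : ℝ) ≤ 1 / 2) hLx)).trans_eq ?_
  ring

theorem continuous_diagDens {e : ℝ} (he : 0 < e) (hu : SpaceTimeSmooth u) :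
    Continuous (Function.uncurry (diagDens e u)) := by
  have h1 := continuous_massDens hu
  have h2 := continuous_invDist he
  have h3 : Continuous fun p : ℝ × E3 × E3 => massDens u p.1 p.2.2 :=
    h1.comp (f := fun p : ℝ × E3 × E3 => (p.1, p.2.2)) (by fun_prop)
  have h4 : Continuous fun p : ℝ × E3 × E3 => massDens u p.1 p.2.1 :=
    h1.comp (f := fun p : ℝ × E3 × E3 => (p.1, p.2.1)) (by fun_prop)
  simp only [Function.uncurry_def, diagDens]
  exact Continuous.mul (by fun_prop) (h4.mul h3)

namespace SchwartzSolution

variable {T : ℝ} {u : ℝ → E3 → ℂ} {U : ℝ → S3}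

theorem integral_diagDens_le (h : SchwartzSolution T u U) {e : ℝ} (he : 0 < e) {t : ℝ}
    (ht : t ∈ Set.Icc 0 T) :
    Integrable (diagDens e u t) ∧
      15 / 2 * ∫ p, diagDens e u t p ≤ ∫ p, interSource e u t p := by
  have hi := h.integrable_interSource he ht
  have hs : Integrable fun p : E3 × E3 => interSource e u t p.swap := hi.swap
  have hsum := hi.add hs
  have hle := diagDens_le_interSource_add_swap he u t
  have hd : Integrable (diagDens e u t) := by
    refine (hsum.div_const 15).mono' ?_ (Filter.Eventually.of_forall fun p => ?_)
    · exact ((continuous_diagDens he h.smooth).comp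
        (f := fun p : E3 × E3 => (t, p)) (by fun_prop)).aestronglyMeasurable
    · rw [Real.norm_eq_abs, abs_of_nonneg (diagDens_nonneg he u t p), le_div_iff₀ (by norm_num)]
      linarith [hle p, Pi.add_apply (interSource e u t) (fun p => interSource e u t p.swap) p]
  refine ⟨hd, ?_⟩
  have h1 := integral_mono (hd.const_mul 15) hsum hle
  have h2 : ∫ p : E3 × E3, interSource e u t p.swap = ∫ p, interSource e u t p :=
    integral_prod_swap (μ := (volume : Measure E3)) (ν := (volume : Measure E3)) (interSource e u t)
  rw [integral_const_mul, integral_add' hi hs, h2] at h1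
  linarith

end SchwartzSolution

open scoped Topology

theorem eventually_mul_le_lintegral_invDist {f : E3 → ℝ} (hf : Continuous f) (hf0 : ∀ x, 0 ≤ f x)
    (y : E3) : ∀ᶠ e in 𝓝[>] (0 : ℝ),
      ENNReal.ofReal (f y ^ 2 / 64) * volume (Metric.ball (0 : E3) 1)
        ≤ ∫⁻ x, ENNReal.ofReal (e ^ 4 * invDist e (x - y) ^ 7 * (f x * f y)) := by
  rcases (hf0 y).eq_or_lt with h0 | h0
  · exact Filter.Eventually.of_forall fun e => by simp [← h0]
  have h1 : ∀ᶠ x in 𝓝 y, f y / 2 < f x := hf.continuousAt.eventually_const_lt (by linarith)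
  obtain ⟨r, hr, hr'⟩ := Metric.eventually_nhds_iff_ball.1 h1
  filter_upwards [Ioo_mem_nhdsGT hr] with e he
  obtain ⟨he, her⟩ := he
  have h2 : ∀ x ∈ Metric.ball y e, ENNReal.ofReal (f y ^ 2 * (e ^ 3)⁻¹ / 64)
      ≤ ENNReal.ofReal (e ^ 4 * invDist e (x - y) ^ 7 * (f x * f y)) := fun x hx => by
    refine ENNReal.ofReal_le_ofReal ?_
    have h3 := hr' x (Metric.ball_subset_ball her.le hx)
    have h4 : ‖x - y‖ ≤ e := by
      rw [← dist_eq_norm]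
      exact (Metric.mem_ball.1 hx).le
    have h5 : 3 / 2 * e ≥ √(e ^ 2 + ‖x - y‖ ^ 2) := by
      refine Real.sqrt_le_iff.2 ⟨by positivity, ?_⟩
      nlinarith [norm_nonneg (x - y)]
    have h6 : (3 / 2 * e)⁻¹ ≤ invDist e (x - y) := inv_anti₀ (by positivity) h5
    have h7 : (3 / 2 * e)⁻¹ ^ 7 ≤ invDist e (x - y) ^ 7 := pow_le_pow_left₀ (by positivity) h6 7
    have h8 : e ^ 4 * (3 / 2 * e)⁻¹ ^ 7 = (2 / 3) ^ 7 * (e ^ 3)⁻¹ := by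
      field_simp
    have h9 : (e ^ 3)⁻¹ / 18 ≤ e ^ 4 * invDist e (x - y) ^ 7 := by
      have := mul_le_mul_of_nonneg_left h7 (by positivity : 0 ≤ e ^ 4)
      have h10 : 0 ≤ (e ^ 3)⁻¹ := by positivity
      rw [h8] at this
      linarith
    calc f y ^ 2 * (e ^ 3)⁻¹ / 64 ≤ (e ^ 3)⁻¹ / 18 * (f y / 2 * f y) := by
          have : 0 ≤ f y ^ 2 * (e ^ 3)⁻¹ := by positivity
          nlinarith
      _ ≤ _ := by
          have : 0 ≤ (e ^ 3)⁻¹ := by positivity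
          exact mul_le_mul h9 (by gcongr) (by positivity) (by linarith)
  calc ENNReal.ofReal (f y ^ 2 / 64) * volume (Metric.ball (0 : E3) 1)
      = ENNReal.ofReal (f y ^ 2 * (e ^ 3)⁻¹ / 64) * volume (Metric.ball y e) := by
        rw [Measure.addHaar_ball_of_pos _ _ he, finrank_euclideanSpace_fin, ← mul_assoc,
          ← ENNReal.ofReal_mul (by positivity)]
        congr 2
        field_simp
    _ = ∫⁻ x in Metric.ball y e, ENNReal.ofReal (f y ^ 2 * (e ^ 3)⁻¹ / 64) := by
        rw [setLIntegral_const]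
    _ ≤ ∫⁻ x in Metric.ball y e,
          ENNReal.ofReal (e ^ 4 * invDist e (x - y) ^ 7 * (f x * f y)) :=
        setLIntegral_mono' measurableSet_ball h2
    _ ≤ _ := setLIntegral_le_lintegral _ _

theorem integral_diagDens_time_le {T : ℝ} {u : ℝ → E3 → ℂ} (hu : SpaceTimeSmooth u)
    {B : ℝ} (hB : 0 ≤ B) (hu4 : ∀ t ∈ Set.Icc 0 T, Integrable fun x => ‖u t x‖ ^ 4)
    (hd : ∀ e, 0 < e → ∀ t ∈ Set.Icc 0 T, Integrable (diagDens e u t))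
    (hdi : ∀ e, 0 < e → IntegrableOn (fun t => ∫ p, diagDens e u t p) (Set.Ioc 0 T))
    (hdB : ∀ e, 0 < e → ∫ t in Set.Ioc 0 T, ∫ p, diagDens e u t p ≤ B) :
    volume.real (Metric.ball (0 : E3) 1) * ∫ t in Set.Ioc 0 T, ∫ x, ‖u t x‖ ^ 4 ≤ 64 * B := by
  set V := volume (Metric.ball (0 : E3) 1) with hV
  set τ : Measure ℝ := volume.restrict (Set.Ioc 0 T)
  obtain ⟨ε, hε0, hε⟩ : ∃ ε : ℕ → ℝ, (∀ n, 0 < ε n) ∧ Filter.Tendsto ε Filter.atTop (𝓝[>] 0) := by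
    refine ⟨fun n => 1 / ((n : ℝ) + 1), fun n => by positivity, ?_⟩
    exact tendsto_nhdsWithin_iff.2 ⟨tendsto_one_div_add_atTop_nhds_zero_nat,
      Filter.Eventually.of_forall fun n => by
        show (0 : ℝ) < 1 / ((n : ℝ) + 1)
        positivity⟩
  have hm : Continuous fun q : ℝ × E3 => massDens u q.1 q.2 := continuous_massDens hu
  set G : ℕ → ℝ × E3 → ℝ≥0∞ := fun n q =>
    ∫⁻ x, ENNReal.ofReal (diagDens (ε n) u q.1 (x, q.2)) with hG
  have hmeas : ∀ n, Measurable fun q : (ℝ × E3) × E3 =>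
      ENNReal.ofReal (diagDens (ε n) u q.1.1 (q.2, q.1.2)) := fun n => by
    have : Continuous fun q : (ℝ × E3) × E3 => diagDens (ε n) u q.1.1 (q.2, q.1.2) :=
      (continuous_diagDens (hε0 n) hu).comp
        (f := fun q : (ℝ × E3) × E3 => (q.1.1, (q.2, q.1.2))) (by fun_prop)
    exact ENNReal.measurable_ofReal.comp this.measurable
  have hGm : ∀ n, Measurable (G n) := fun n => (hmeas n).lintegral_prod_right'
  have hlow : ∀ q : ℝ × E3, ENNReal.ofReal (massDens u q.1 q.2 ^ 2 / 64) * V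
      ≤ Filter.liminf (fun n => G n q) Filter.atTop := fun q => by
    have hc : Continuous fun x => massDens u q.1 x :=
      hm.comp (f := fun x : E3 => (q.1, x)) (by fun_prop)
    exact Filter.le_liminf_of_le (by isBoundedDefault)
      (hε.eventually (eventually_mul_le_lintegral_invDist hc (massDens_nonneg u q.1) q.2))
  have hGB : ∀ n, ∫⁻ q, G n q ∂(τ.prod volume) ≤ ENNReal.ofReal B := fun n => by
    rw [lintegral_prod _ (hGm n).aemeasurable]
    have : ∀ t ∈ Set.Ioc 0 T, ∫⁻ y, G n (t, y) = ENNReal.ofReal (∫ p, diagDens (ε n) u t p) := by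
      intro t ht
      rw [ofReal_integral_eq_lintegral_ofReal (hd _ (hε0 n) t (Set.Ioc_subset_Icc_self ht))
        (Filter.Eventually.of_forall (diagDens_nonneg (hε0 n) u t))]
      have hc : Measurable fun p : E3 × E3 => ENNReal.ofReal (diagDens (ε n) u t p) :=
        ENNReal.measurable_ofReal.comp ((continuous_diagDens (hε0 n) hu).comp
          (f := fun p : E3 × E3 => (t, p)) (by fun_prop)).measurable
      exact (lintegral_prod_symm' _ hc).symm
    rw [setLIntegral_congr_fun measurableSet_Ioc this,
      ← ofReal_integral_eq_lintegral_ofReal (hdi _ (hε0 n))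
        (Filter.Eventually.of_forall fun t => integral_nonneg (diagDens_nonneg (hε0 n) u t))]
    exact ENNReal.ofReal_le_ofReal (hdB _ (hε0 n))
  have hfatou : ∫⁻ q, ENNReal.ofReal (massDens u q.1 q.2 ^ 2 / 64) * V ∂(τ.prod volume)
      ≤ ENNReal.ofReal B := by
    refine (lintegral_mono hlow).trans ((lintegral_liminf_le hGm).trans ?_)
    refine Filter.liminf_le_of_frequently_le' (Filter.Frequently.of_forall hGB)
  have hVt : V ≠ ⊤ := measure_ball_lt_top.ne
  have hVp : 0 < V.toReal := ENNReal.toReal_pos (Metric.measure_ball_pos _ _ one_pos).ne' hVt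
  have hm2 : Measurable fun q : ℝ × E3 => ENNReal.ofReal (massDens u q.1 q.2 ^ 2 / 64) :=
    ENNReal.measurable_ofReal.comp ((hm.pow 2).div_const 64).measurable
  rw [lintegral_mul_const _ hm2, lintegral_prod _ hm2.aemeasurable] at hfatou
  have hin : ∀ t ∈ Set.Ioc 0 T, ∫⁻ x, ENNReal.ofReal (massDens u t x ^ 2 / 64)
      = ENNReal.ofReal ((∫ x, ‖u t x‖ ^ 4) / 64) := fun t ht => by
    rw [← integral_div, ofReal_integral_eq_lintegral_ofReal
      ((hu4 t (Set.Ioc_subset_Icc_self ht)).div_const _)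
      (Filter.Eventually.of_forall fun x => by positivity)]
    refine lintegral_congr fun x => ?_
    rw [massDens_eq, ← pow_mul]
  rw [setLIntegral_congr_fun measurableSet_Ioc hin] at hfatou
  have hΦ : AEStronglyMeasurable (fun t => (∫ x, ‖u t x‖ ^ 4) / 64) τ := by
    have : StronglyMeasurable fun t => ∫ x, ‖u t x‖ ^ 4 :=
      StronglyMeasurable.integral_prod_right
        (f := fun t x => ‖u t x‖ ^ 4) (hu.continuous.norm.pow 4).stronglyMeasurable
    exact (this.measurable.div_const 64).aestronglyMeasurable
  have h2 : (∫ t in Set.Ioc 0 T, (∫ x, ‖u t x‖ ^ 4) / 64) * V.toReal ≤ B := by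
    rw [integral_eq_lintegral_of_nonneg_ae (Filter.Eventually.of_forall fun t => by positivity) hΦ,
      ← ENNReal.toReal_mul]
    exact ENNReal.toReal_le_of_le_ofReal hB hfatou
  rw [integral_div] at h2
  rw [measureReal_def]
  linarith

namespace SchwartzSolution

variable {T : ℝ} {u : ℝ → E3 → ℂ} {U : ℝ → S3}

theorem integral_diagDens_le_sub (h : SchwartzSolution T u U) (hT : 0 < T) {e : ℝ} (he : 0 < e)
    {K : ℝ} (hK : ∀ t ∈ Set.Icc 0 T, RegBound (U t) K) :
    IntegrableOn (fun t => ∫ p, diagDens e u t p) (Set.Ioc 0 T) ∧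
      15 / 2 * ∫ t in Set.Ioc 0 T, ∫ p, diagDens e u t p
        ≤ (∫ p, interDens e u T p) - ∫ p, interDens e u 0 p := by
  have hcd : Set.uIcc 0 T = Set.Icc 0 T := Set.uIcc_of_le hT.le
  rw [h.integral_interDens_sub he hcd.subset fun t ht => hK t (hcd ▸ ht),
    intervalIntegral.integral_of_le hT.le]
  have hfin : IsFiniteMeasure (volume.restrict (Set.Ioc 0 T)) :=
    ⟨by simp⟩
  have hI : IntegrableOn (fun t => ∫ p, interSource e u t p) (Set.Ioc 0 T) := by
    refine Integrable.of_bound ?_ ((75 * e⁻¹ + 8 * e⁻¹ ^ 3) * (11 * K * (7 * K)))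
      ((ae_restrict_iff' measurableSet_Ioc).2
      (Filter.Eventually.of_forall fun t ht => ?_))
    · exact (StronglyMeasurable.integral_prod_right (f := interSource e u)
        (continuous_interSource he h.smooth).stronglyMeasurable).aestronglyMeasurable
    · have ht' := Set.Ioc_subset_Icc_self ht
      exact (norm_integral_le_integral_norm _).trans
        (h.integral_abs_interSource_le he ht' (hK t ht'))
  have hle : ∀ t ∈ Set.Ioc 0 T, 15 / 2 * ∫ p, diagDens e u t p ≤ ∫ p, interSource e u t p :=
    fun t ht => (h.integral_diagDens_le he (Set.Ioc_subset_Icc_self ht)).2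
  have h0 : ∀ t, 0 ≤ ∫ p, diagDens e u t p := fun t => integral_nonneg (diagDens_nonneg he u t)
  have hD : IntegrableOn (fun t => ∫ p, diagDens e u t p) (Set.Ioc 0 T) := by
    refine Integrable.mono' hI ?_ ((ae_restrict_iff' measurableSet_Ioc).2
      (Filter.Eventually.of_forall fun t ht => ?_))
    · exact (StronglyMeasurable.integral_prod_right (f := diagDens e u)
        (continuous_diagDens he h.smooth).stronglyMeasurable).aestronglyMeasurable
    · rw [Real.norm_eq_abs, abs_of_nonneg (h0 t)]
      linarith [hle t ht, h0 t]
  refine ⟨hD, ?_⟩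
  rw [← integral_const_mul]
  exact setIntegral_mono_on (hD.const_mul _) hI measurableSet_Ioc hle

theorem abs_integral_interDens_le (h : SchwartzSolution T u U) {e : ℝ} (he : 0 < e) {t P : ℝ}
    (ht : t ∈ Set.Icc 0 T) (hP : ∀ y, |∫ x, virialDens e u y t x| ≤ P) :
    |∫ p, interDens e u t p| ≤ P * ∫ x, massDens u t x := by
  have hi := h.integrable_interDens he ht
  have hm : Integrable (massDens u t) := by
    have : massDens u t = fun x => ‖U t x‖ ^ 2 := by
      ext x
      rw [massDens_eq, h.coe t ht]
    rw [this]
    exact (U t).integrable_norm_pow two_ne_zero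
  have h1 : ∫ p, interDens e u t p
      = ∫ y, massDens u t y * ∫ x, virialDens e u y t x := by
    have h2 : ∫ p : E3 × E3, interDens e u t p.swap = ∫ p, interDens e u t p :=
      integral_prod_swap (μ := (volume : Measure E3)) (ν := (volume : Measure E3)) (interDens e u t)
    refine h2.symm.trans ((integral_prod _ hi.swap).trans ?_)
    simp only [← integral_const_mul]
    rfl
  rw [h1, mul_comm, ← integral_mul_const, ← Real.norm_eq_abs]
  refine norm_integral_le_of_norm_le (hm.mul_const P) (Filter.Eventually.of_forall fun y => ?_)
  rw [norm_mul, Real.norm_eq_abs, Real.norm_eq_abs, abs_of_nonneg (massDens_nonneg u t y)]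
  exact mul_le_mul_of_nonneg_left (hP y) (massDens_nonneg u t y)

end SchwartzSolution

/-- A Hardy inequality with the regularised inverse distance. -/
theorem integral_invDist_sq_mul_le {e : ℝ} (he : 0 < e) (g : S3) (y : E3) :
    ∫ x, invDist e (x - y) ^ 2 * ‖g x‖ ^ 2 ≤ 4 * ∑ j, ∫ x, ‖dS j g x‖ ^ 2 := by
  have hg2 : Integrable fun x => ‖g x‖ ^ 2 := g.integrable_norm_pow two_ne_zero
  have hd2 : ∀ j, Integrable fun x => ‖dS j g x‖ ^ 2 := fun j =>
    (dS j g).integrable_norm_pow two_ne_zero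
  have hgc := g.continuous
  have hdc := fun j => (dS j g).continuous
  have hσ := continuous_invDist he
  have hs0 : ∀ w, 0 < invDist e w := invDist_pos he
  have hs1 : ∀ w, invDist e w ≤ e⁻¹ := invDist_le he
  have hws : ∀ w : E3, w 0 ^ 2 * invDist e w ^ 2 + w 1 ^ 2 * invDist e w ^ 2
      + w 2 ^ 2 * invDist e w ^ 2 ≤ 1 := fun w => by
    have := invDist_sq_mul_sum he w
    nlinarith [mul_nonneg (sq_nonneg e) (sq_nonneg (invDist e w))]
  have hwj : ∀ (j : Fin 3) (w : E3), |w j * invDist e w| ≤ 1 := fun j w =>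
    abs_coord_mul_invDist_le he w j
  set D : Fin 3 → E3 → ℝ := fun j x =>
    2 * ((g x).re * (dS j g x).re + (g x).im * (dS j g x).im) with hD
  have hDb : ∀ j x, |D j x| ≤ 2 * (‖g x‖ * ‖dS j g x‖) := fun j x => by
    have h1 : (g x).re * (dS j g x).re + (g x).im * (dS j g x).im
        = (starRingEnd ℂ (g x) * dS j g x).re := by simp
    rw [hD, abs_mul, abs_two, h1]
    refine mul_le_mul_of_nonneg_left ((Complex.abs_re_le_norm _).trans_eq ?_) zero_le_two
    rw [norm_mul, RCLike.norm_conj]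
  have hDi : ∀ j, Integrable (D j) := fun j => by
    refine (hg2.add (hd2 j)).mono' (by fun_prop) (Filter.Eventually.of_forall fun x => ?_)
    rw [Real.norm_eq_abs]
    refine (hDb j x).trans ?_
    rw [Pi.add_apply]
    nlinarith [sq_nonneg (‖g x‖ - ‖dS j g x‖)]
  set f : Fin 3 → E3 → ℝ := fun j x => (x - y) j * invDist e (x - y) ^ 2 with hf
  set f' : Fin 3 → E3 → ℝ := fun j x =>
    invDist e (x - y) ^ 2 - 2 * ((x - y) j * (x - y) j) * invDist e (x - y) ^ 4 with hf'
  have hfb : ∀ j x, |f j x| ≤ e⁻¹ := fun j x => by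
    have : f j x = (x - y) j * invDist e (x - y) * invDist e (x - y) := by
      rw [hf]
      ring
    rw [this, abs_mul, abs_of_pos (hs0 _)]
    exact (mul_le_of_le_one_left (hs0 _).le (hwj j _)).trans (hs1 _)
  have hf'b : ∀ j x, |f' j x| ≤ 3 * e⁻¹ ^ 2 := fun j x => by
    have h1 : f' j x = (1 - 2 * ((x - y) j * invDist e (x - y)) ^ 2) * invDist e (x - y) ^ 2 := by
      simp only [hf']
      ring
    have h2 := (sq_le_one_iff_abs_le_one _).2 (hwj j (x - y))
    have h3 := sq_nonneg ((x - y) j * invDist e (x - y))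
    rw [h1, abs_mul, abs_of_nonneg (sq_nonneg (invDist e (x - y)))]
    refine mul_le_mul (abs_le.2 ⟨by linarith, by linarith⟩)
      (pow_le_pow_left₀ (hs0 _).le (hs1 _) 2) (sq_nonneg _) (by norm_num)
  have hi1 : ∀ j, Integrable fun x => f' j x * ‖g x‖ ^ 2 := fun j =>
    hg2.bdd_mul (c := 3 * e⁻¹ ^ 2) (Continuous.aestronglyMeasurable (by fun_prop))
      (Filter.Eventually.of_forall (hf'b j))
  have hi2 : ∀ j, Integrable fun x => f j x * D j x := fun j =>
    (hDi j).bdd_mul (c := e⁻¹) (Continuous.aestronglyMeasurable (by fun_prop))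
      (Filter.Eventually.of_forall (hfb j))
  have hi3 : ∀ j, Integrable fun x => f j x * ‖g x‖ ^ 2 := fun j =>
    hg2.bdd_mul (c := e⁻¹) (Continuous.aestronglyMeasurable (by fun_prop))
      (Filter.Eventually.of_forall (hfb j))
  have hi4 : Integrable fun x => invDist e (x - y) ^ 2 * ‖g x‖ ^ 2 :=
    hg2.bdd_mul (c := e⁻¹ ^ 2) (Continuous.aestronglyMeasurable (by fun_prop))
      (Filter.Eventually.of_forall fun x => by
        rw [Real.norm_eq_abs, abs_of_nonneg (sq_nonneg _)]
        exact pow_le_pow_left₀ (hs0 _).le (hs1 _) 2)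
  have hibp : ∀ j, ∫ x, f j x * D j x = -∫ x, f' j x * ‖g x‖ ^ 2 := fun j => by
    refine integral_bilinear_hasLineDerivAt_right_eq_neg_left_of_integrable
      (B := ContinuousLinearMap.mul ℝ ℝ) (v := EuclideanSpace.single j 1) (hi1 j) (hi2 j) (hi3 j)
      (fun x _ => ?_) (fun x _ => ?_)
    · have h1 := (hasLineDerivAt_coord_mul_invDist_pow he (x - y) j j 1).comp_sub_right
      refine HasLineDerivAt.congr_val (f := f j) h1 ?_
      simp only [hf', if_true]
      norm_num
    · have h1 := hasLineDerivAt_dS j g x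
      have h2 := hasLineDerivAt_add
        (hasLineDerivAt_mul (hasLineDerivAt_re h1) (hasLineDerivAt_re h1))
        (hasLineDerivAt_mul (hasLineDerivAt_im h1) (hasLineDerivAt_im h1))
      have h3 : (fun x => ‖g x‖ ^ 2)
          = fun x => (g x).re * (g x).re + (g x).im * (g x).im := by
        ext x
        rw [norm_sq_eq_re_add_im]
        ring
      rw [h3]
      refine h2.congr_val ?_
      simp only [hD]
      ring
  have hpt : ∀ x, 2⁻¹ * (invDist e (x - y) ^ 2 * ‖g x‖ ^ 2)
      ≤ ∑ j, (f' j x * ‖g x‖ ^ 2 + f j x * D j x) + 2 * ∑ j, ‖dS j g x‖ ^ 2 := fun x => by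
    have hw := hws (x - y)
    have hs := hs0 (x - y)
    have hN := sq_nonneg ‖g x‖
    have hj : ∀ j, -(2⁻¹ * (((x - y) j) ^ 2 * invDist e (x - y) ^ 2)
        * (invDist e (x - y) ^ 2 * ‖g x‖ ^ 2)) - 2 * ‖dS j g x‖ ^ 2 ≤ f j x * D j x := fun j => by
      have h1 := neg_abs_le (f j x * D j x)
      have h2 := mul_le_mul_of_nonneg_left (hDb j x) (abs_nonneg (f j x))
      rw [abs_mul] at h1
      have h3 : |f j x| ^ 2 = ((x - y) j) ^ 2 * invDist e (x - y) ^ 2 * invDist e (x - y) ^ 2 := by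
        rw [sq_abs, hf]
        ring
      have h4 := sq_nonneg (|f j x| * ‖g x‖ - 2 * ‖dS j g x‖)
      nlinarith
    have h0 := hj 0
    have h1 := hj 1
    have h2 := hj 2
    simp only [Fin.sum_univ_three]
    have hdiv : f' 0 x + f' 1 x + f' 2 x = 3 * invDist e (x - y) ^ 2
        - 2 * (((x - y) 0) ^ 2 * invDist e (x - y) ^ 2 + ((x - y) 1) ^ 2 * invDist e (x - y) ^ 2
          + ((x - y) 2) ^ 2 * invDist e (x - y) ^ 2) * invDist e (x - y) ^ 2 := by
      simp only [hf']
      ring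
    have hA : 0 ≤ invDist e (x - y) ^ 2 * ‖g x‖ ^ 2 := by positivity
    have hk := mul_le_mul_of_nonneg_right hw hA
    have hdiv' : (f' 0 x + f' 1 x + f' 2 x) * ‖g x‖ ^ 2 = 3 * (invDist e (x - y) ^ 2 * ‖g x‖ ^ 2)
        - 2 * ((((x - y) 0) ^ 2 * invDist e (x - y) ^ 2 + ((x - y) 1) ^ 2 * invDist e (x - y) ^ 2
          + ((x - y) 2) ^ 2 * invDist e (x - y) ^ 2) * (invDist e (x - y) ^ 2 * ‖g x‖ ^ 2)) := by
      rw [hdiv]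
      ring
    linarith
  have hI : ∀ j, Integrable fun x => f' j x * ‖g x‖ ^ 2 + f j x * D j x := fun j =>
    (hi1 j).add (hi2 j)
  have hIs : Integrable fun x => ∑ j, (f' j x * ‖g x‖ ^ 2 + f j x * D j x) :=
    integrable_finsetSum _ fun j _ => hI j
  have hds : Integrable fun x => 2 * ∑ j, ‖dS j g x‖ ^ 2 :=
    (integrable_finsetSum _ fun j _ => hd2 j).const_mul 2
  have h_int := integral_mono (hi4.const_mul 2⁻¹) (hIs.add hds) hpt
  rw [integral_const_mul, integral_add' hIs hds, integral_const_mul,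
    integral_finsetSum _ fun j _ => hI j, integral_finsetSum _ fun j _ => hd2 j] at h_int
  have hz : ∀ j, ∫ x, f' j x * ‖g x‖ ^ 2 + f j x * D j x = 0 := fun j => by
    rw [integral_add (hi1 j) (hi2 j), hibp j, add_neg_cancel]
  simp only [hz, Finset.sum_const_zero, zero_add] at h_int
  linarith

/-- The heat flow at time `s ^ 2`, up to a numerical factor. -/
def heatFlow (s : ℝ) (g : S3) : S3 := gaussFlow ((s ^ 2 : ℝ) : ℂ) g

/-- The derivative of `heatFlow` in `s`. -/
def heatRate (s : ℝ) (g : S3) : S3 := ((s / (2 * π ^ 2) : ℝ) : ℂ) • heatFlow s (lapS g)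

theorem sq_re_nonneg (s : ℝ) : 0 ≤ (((s ^ 2 : ℝ) : ℂ)).re := by
  rw [Complex.ofReal_re]
  positivity

theorem dS_heatFlow (j : Fin 3) (s : ℝ) (g : S3) : dS j (heatFlow s g) = heatFlow s (dS j g) :=
  (gaussFlow_lineDeriv (sq_re_nonneg s) _ g).symm

theorem lapS_dS (j : Fin 3) (g : S3) : lapS (dS j g) = dS j (lapS g) := by
  apply (FourierTransform.fourierCLE ℂ S3).injective
  ext ξ
  change 𝓕 (lapS (dS j g)) ξ = 𝓕 (dS j (lapS g)) ξ
  rw [fourier_lapS, dS, fourier_lineDeriv, dS, fourier_lineDeriv, fourier_lapS]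
  ring

theorem dS_smul (j : Fin 3) (c : ℂ) (g : S3) : dS j (c • g) = c • dS j g := by
  refine SchwartzMap.ext fun x => dS_eq_of_hasDerivAt ?_
  simpa using (hasDerivAt_dS j g x).const_mul c

theorem dS_heatRate (j : Fin 3) (s : ℝ) (g : S3) : dS j (heatRate s g) = heatRate s (dS j g) := by
  rw [heatRate, dS_smul, dS_heatFlow, heatRate, lapS_dS]

theorem hasDerivAt_heatFlow (g : S3) (x : E3) (s : ℝ) :
    HasDerivAt (fun s => heatFlow s g x) (heatRate s g x) s := by
  have hθ : ∀ s : ℝ, HasDerivAt (fun s : ℝ => ((s ^ 2 : ℝ) : ℂ)) ((2 * s : ℝ) : ℂ) s := fun s => by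
    simpa using (hasDerivAt_pow 2 s).ofReal_comp
  refine (hasDerivAt_gaussFlow hθ (by fun_prop) sq_re_nonneg g x s).congr_deriv ?_
  rw [heatRate, heatFlow, smul_apply, smul_eq_mul]
  congr 1
  push_cast
  field_simp
  ring

theorem continuous_heatFlow (g : S3) : Continuous fun p : ℝ × E3 => heatFlow p.1 g p.2 :=
  continuous_gaussFlow (θ := fun p : ℝ × E3 => ((p.1 ^ 2 : ℝ) : ℂ)) (by fun_prop) continuous_snd
    (fun p => sq_re_nonneg p.1) g

theorem continuous_heatRate (g : S3) : Continuous fun p : ℝ × E3 => heatRate p.1 g p.2 := by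
  have h := continuous_heatFlow (lapS g)
  simp only [heatRate, smul_apply]
  fun_prop

theorem norm_sq_fourier_heatFlow (s : ℝ) (g : S3) (ξ : E3) :
    ‖𝓕 (heatFlow s g) ξ‖ ^ 2 = Real.exp (-(2 * (s * ‖ξ‖) ^ 2)) * ‖𝓕 g ξ‖ ^ 2 := by
  rw [heatFlow, fourier_gaussFlow (sq_re_nonneg s), norm_mul, mul_pow, norm_gaussSymbol,
    Complex.ofReal_re, ← Real.exp_nat_mul]
  congr 2
  push_cast
  ring

theorem norm_sq_fourier_lapS (g : S3) (ξ : E3) :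
    ‖𝓕 (lapS g) ξ‖ ^ 2 = 16 * π ^ 4 * ‖ξ‖ ^ 4 * ‖𝓕 g ξ‖ ^ 2 := by
  have : -(4 * (π : ℂ) ^ 2) * ((‖ξ‖ ^ 2 : ℝ) : ℂ) = ((-(4 * π ^ 2) * ‖ξ‖ ^ 2 : ℝ) : ℂ) := by
    push_cast
    ring
  rw [fourier_lapS, this, norm_mul, mul_pow, Complex.norm_real, Real.norm_eq_abs, sq_abs]
  ring

theorem norm_sq_fourier_dS (j : Fin 3) (g : S3) (ξ : E3) :
    ‖𝓕 (dS j g) ξ‖ ^ 2 = 4 * π ^ 2 * ξ j ^ 2 * ‖𝓕 g ξ‖ ^ 2 := by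
  have h1 : (2 * π * I * (inner ℝ ξ (EuclideanSpace.single j (1 : ℝ)) : ℝ) : ℂ)
      = I * ((2 * π * ξ j : ℝ) : ℂ) := by
    rw [EuclideanSpace.inner_single_right, conj_trivial, one_mul]
    push_cast
    ring
  rw [dS, fourier_lineDeriv, h1, norm_mul, norm_mul, Complex.norm_I, one_mul, Complex.norm_real,
    Real.norm_eq_abs, mul_pow, sq_abs]
  ring

theorem sum_norm_sq_fourier_dS (g : S3) (ξ : E3) :
    ∑ j, ‖𝓕 (dS j g) ξ‖ ^ 2 = 4 * π ^ 2 * ‖ξ‖ ^ 2 * ‖𝓕 g ξ‖ ^ 2 := by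
  simp only [norm_sq_fourier_dS]
  rw [EuclideanSpace.norm_sq_eq, ← Finset.sum_mul, ← Finset.mul_sum]
  simp

theorem norm_sq_fourier_heatRate (s : ℝ) (g : S3) (ξ : E3) :
    ‖𝓕 (heatRate s g) ξ‖ ^ 2
      = 4 * s ^ 2 * ‖ξ‖ ^ 4 * Real.exp (-(2 * (s * ‖ξ‖) ^ 2)) * ‖𝓕 g ξ‖ ^ 2 := by
  have h : 𝓕 (heatRate s g) = ((s / (2 * π ^ 2) : ℝ) : ℂ) • 𝓕 (heatFlow s (lapS g)) :=
    map_smul (FourierTransform.fourierCLE ℂ S3) _ _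
  rw [h, smul_apply, norm_smul, mul_pow, norm_sq_fourier_heatFlow,
    norm_sq_fourier_lapS, Complex.norm_real, Real.norm_eq_abs, sq_abs]
  field_simp
  ring

theorem sum_norm_sq_fourier_dS_heatFlow (s : ℝ) (g : S3) (ξ : E3) :
    ∑ j, ‖𝓕 (dS j (heatFlow s g)) ξ‖ ^ 2
      = 4 * π ^ 2 * ‖ξ‖ ^ 2 * Real.exp (-(2 * (s * ‖ξ‖) ^ 2)) * ‖𝓕 g ξ‖ ^ 2 := by
  rw [sum_norm_sq_fourier_dS, norm_sq_fourier_heatFlow]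
  ring

theorem one_add_mul_exp_neg_le {z : ℝ} (hz : 0 ≤ z) :
    (1 + z) * Real.exp (-(2 * z)) ≤ 1 ∧ z * (1 + z) * Real.exp (-(2 * z)) ≤ 1 := by
  have h1 : 1 + z ≤ Real.exp z := by linarith [Real.add_one_le_exp z]
  have h2 : Real.exp z * (Real.exp z * Real.exp (-(2 * z))) = 1 := by
    rw [← Real.exp_add, ← Real.exp_add]
    ring_nf
    exact Real.exp_zero
  have h3 := Real.exp_pos (-(2 * z))
  have h4 : (1 + z) * (1 + z) ≤ Real.exp z * Real.exp z :=
    mul_le_mul h1 h1 (by linarith) (Real.exp_pos _).le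
  have h5 : (1 + z) * (1 + z) * Real.exp (-(2 * z)) ≤ 1 := by
    refine (mul_le_mul_of_nonneg_right h4 h3.le).trans_eq ?_
    rw [mul_assoc, h2]
  refine ⟨le_trans ?_ h5, le_trans ?_ h5⟩ <;>
  refine mul_le_mul_of_nonneg_right (by nlinarith) h3.le

theorem integrable_norm_pow_mul_norm_sq_fourier (g : S3) :
    (Integrable fun ξ : E3 => ‖𝓕 g ξ‖ ^ 2) ∧ (Integrable fun ξ : E3 => ‖ξ‖ * ‖𝓕 g ξ‖ ^ 2) ∧
      Integrable fun ξ : E3 => ‖ξ‖ ^ 2 * ‖𝓕 g ξ‖ ^ 2 := by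
  have h0 : Integrable fun ξ : E3 => ‖𝓕 g ξ‖ ^ 2 := (𝓕 g).integrable_norm_pow two_ne_zero
  have h2 : Integrable fun ξ : E3 => ‖ξ‖ ^ 2 * ‖𝓕 g ξ‖ ^ 2 := by
    have h : Integrable fun ξ : E3 => (∑ j, ‖𝓕 (dS j g) ξ‖ ^ 2) / (4 * π ^ 2) :=
      (integrable_finsetSum _ fun j _ => (𝓕 (dS j g)).integrable_norm_pow two_ne_zero).div_const _
    refine h.congr (Filter.Eventually.of_forall fun ξ => ?_)
    simp only [sum_norm_sq_fourier_dS]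
    field_simp
  have hc := (𝓕 g).continuous
  refine ⟨h0, (h0.add h2).mono' (Continuous.aestronglyMeasurable (by fun_prop))
    (Filter.Eventually.of_forall fun ξ => ?_), h2⟩
  rw [Real.norm_eq_abs, abs_of_nonneg (by positivity), Pi.add_apply]
  nlinarith [sq_nonneg ‖𝓕 g ξ‖, mul_nonneg (sq_nonneg (‖ξ‖ - 1)) (sq_nonneg ‖𝓕 g ξ‖),
    mul_nonneg (norm_nonneg ξ) (sq_nonneg ‖𝓕 g ξ‖)]

theorem integral_norm_sq_heatFlow_le (s : ℝ) (g : S3) :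
    ∫ x, ‖heatFlow s g x‖ ^ 2 ≤ ∫ ξ, ‖𝓕 g ξ‖ ^ 2 := by
  rw [← SchwartzMap.integral_norm_sq_fourier]
  refine integral_mono ((𝓕 (heatFlow s g)).integrable_norm_pow two_ne_zero)
    (integrable_norm_pow_mul_norm_sq_fourier g).1 fun ξ => ?_
  simp only [norm_sq_fourier_heatFlow]
  refine mul_le_of_le_one_left (by positivity) (Real.exp_le_one_iff.2 ?_)
  have := sq_nonneg (s * ‖ξ‖)
  linarith

theorem sq_mul_sum_integral_norm_sq_dS_heatFlow_le (s : ℝ) (g : S3) :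
    s ^ 2 * ∑ j, ∫ x, ‖dS j (heatFlow s g) x‖ ^ 2 ≤ 4 * π ^ 2 * ∫ ξ, ‖𝓕 g ξ‖ ^ 2 := by
  simp only [← SchwartzMap.integral_norm_sq_fourier (dS _ (heatFlow s g))]
  have hi : ∀ j : Fin 3, Integrable fun ξ => ‖𝓕 (dS j (heatFlow s g)) ξ‖ ^ 2 := fun j =>
    (𝓕 (dS j (heatFlow s g))).integrable_norm_pow two_ne_zero
  rw [← integral_finsetSum _ fun j _ => hi j, ← integral_const_mul, ← integral_const_mul]
  refine integral_mono ((integrable_finsetSum _ fun j _ => hi j).const_mul _)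
    ((integrable_norm_pow_mul_norm_sq_fourier g).1.const_mul _) fun ξ => ?_
  simp only [sum_norm_sq_fourier_dS_heatFlow]
  have h := (one_add_mul_exp_neg_le (sq_nonneg (s * ‖ξ‖))).1
  have he := Real.exp_pos (-(2 * (s * ‖ξ‖) ^ 2))
  have h1 : (s * ‖ξ‖) ^ 2 * Real.exp (-(2 * (s * ‖ξ‖) ^ 2)) ≤ 1 := by linarith
  have h2 := mul_le_mul_of_nonneg_left h1
    (by positivity : 0 ≤ 4 * π ^ 2 * ‖𝓕 g ξ‖ ^ 2)
  calc _ = 4 * π ^ 2 * ‖𝓕 g ξ‖ ^ 2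
        * ((s * ‖ξ‖) ^ 2 * Real.exp (-(2 * (s * ‖ξ‖) ^ 2))) := by ring
    _ ≤ _ := by linarith

/-- The dissipation of the heat flow at scale `s`. -/
def heatDissip (s : ℝ) (g : S3) : ℝ :=
  ∫ ξ : E3, ‖ξ‖ ^ 2 / (1 + (s * ‖ξ‖) ^ 2) * ‖𝓕 g ξ‖ ^ 2

theorem integrable_heatDissip (s : ℝ) (g : S3) :
    Integrable fun ξ : E3 => ‖ξ‖ ^ 2 / (1 + (s * ‖ξ‖) ^ 2) * ‖𝓕 g ξ‖ ^ 2 := by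
  have hc := (𝓕 g).continuous
  refine (integrable_norm_pow_mul_norm_sq_fourier g).2.2.mono' ?_
    (Filter.Eventually.of_forall fun ξ => ?_)
  · refine Continuous.aestronglyMeasurable (Continuous.mul (Continuous.div₀ (by fun_prop)
      (by fun_prop) fun ξ => by positivity) (by fun_prop))
  · rw [Real.norm_eq_abs, abs_of_nonneg (by positivity)]
    refine mul_le_mul_of_nonneg_right (div_le_self (by positivity) ?_) (by positivity)
    have := sq_nonneg (s * ‖ξ‖)
    linarith

theorem heatDissip_le (s : ℝ) (g : S3) : heatDissip s g ≤ ∫ ξ : E3, ‖ξ‖ ^ 2 * ‖𝓕 g ξ‖ ^ 2 := by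
  refine integral_mono (integrable_heatDissip s g)
    (integrable_norm_pow_mul_norm_sq_fourier g).2.2 fun ξ => ?_
  refine mul_le_mul_of_nonneg_right (div_le_self (by positivity) ?_) (by positivity)
  have := sq_nonneg (s * ‖ξ‖)
  linarith

theorem integral_norm_sq_heatRate_le (s : ℝ) (g : S3) :
    ∫ x, ‖heatRate s g x‖ ^ 2 ≤ 4 * heatDissip s g := by
  rw [← SchwartzMap.integral_norm_sq_fourier, heatDissip, ← integral_const_mul]
  refine integral_mono ((𝓕 (heatRate s g)).integrable_norm_pow two_ne_zero)
    ((integrable_heatDissip s g).const_mul _) fun ξ => ?_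
  simp only [norm_sq_fourier_heatRate]
  have h := (one_add_mul_exp_neg_le (sq_nonneg (s * ‖ξ‖))).2
  have hp : 0 < 1 + (s * ‖ξ‖) ^ 2 := by positivity
  rw [mul_right_comm, ← le_div_iff₀ hp] at h
  have h2 := mul_le_mul_of_nonneg_left h (by positivity : 0 ≤ 4 * ‖ξ‖ ^ 2 * ‖𝓕 g ξ‖ ^ 2)
  calc _ = 4 * ‖ξ‖ ^ 2 * ‖𝓕 g ξ‖ ^ 2
        * ((s * ‖ξ‖) ^ 2 * Real.exp (-(2 * (s * ‖ξ‖) ^ 2))) := by ring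
    _ ≤ _ := h2
    _ = _ := by ring

theorem sum_integral_norm_sq_dS_heatFlow_le (s : ℝ) (g : S3) :
    ∑ j, ∫ x, ‖dS j (heatFlow s g) x‖ ^ 2 ≤ 4 * π ^ 2 * heatDissip s g := by
  simp only [← SchwartzMap.integral_norm_sq_fourier (dS _ (heatFlow s g))]
  have hi : ∀ j : Fin 3, Integrable fun ξ => ‖𝓕 (dS j (heatFlow s g)) ξ‖ ^ 2 := fun j =>
    (𝓕 (dS j (heatFlow s g))).integrable_norm_pow two_ne_zero
  rw [← integral_finsetSum _ fun j _ => hi j, heatDissip, ← integral_const_mul]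
  refine integral_mono (integrable_finsetSum _ fun j _ => hi j)
    ((integrable_heatDissip s g).const_mul _) fun ξ => ?_
  simp only [sum_norm_sq_fourier_dS_heatFlow]
  have h := (one_add_mul_exp_neg_le (sq_nonneg (s * ‖ξ‖))).1
  have hp : 0 < 1 + (s * ‖ξ‖) ^ 2 := by positivity
  rw [mul_comm, ← le_div_iff₀ hp] at h
  have h2 := mul_le_mul_of_nonneg_left h
    (by positivity : 0 ≤ 4 * π ^ 2 * ‖ξ‖ ^ 2 * ‖𝓕 g ξ‖ ^ 2)
  calc _ = 4 * π ^ 2 * ‖ξ‖ ^ 2 * ‖𝓕 g ξ‖ ^ 2 * Real.exp (-(2 * (s * ‖ξ‖) ^ 2)) := by ring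
    _ ≤ _ := h2
    _ = _ := by ring

theorem integral_arctan_kernel_le {ρ S : ℝ} (hρ : 0 ≤ ρ) (hS : 0 ≤ S) :
    ∫ s in Set.Ioc 0 S, ρ ^ 2 / (1 + (s * ρ) ^ 2) ≤ ρ * (π / 2) := by
  rw [← intervalIntegral.integral_of_le hS]
  have hd : ∀ s ∈ Set.uIcc 0 S, HasDerivAt (fun s => ρ * Real.arctan (s * ρ))
      (ρ ^ 2 / (1 + (s * ρ) ^ 2)) s := fun s _ => by
    refine (((hasDerivAt_id s).mul_const ρ).arctan.const_mul ρ).congr_deriv ?_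
    simp only [id]
    ring
  have hc : Continuous fun s : ℝ => ρ ^ 2 / (1 + (s * ρ) ^ 2) :=
    Continuous.div₀ (by fun_prop) (by fun_prop) fun s => by positivity
  rw [intervalIntegral.integral_eq_sub_of_hasDerivAt hd (hc.intervalIntegrable _ _)]
  simp only [zero_mul, Real.arctan_zero, mul_zero, sub_zero]
  exact mul_le_mul_of_nonneg_left (Real.arctan_lt_pi_div_two _).le hρ

theorem integral_heatDissip_le (g : S3) {S : ℝ} (hS : 0 ≤ S) :
    IntegrableOn (fun s => heatDissip s g) (Set.Ioc 0 S) ∧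
      ∫ s in Set.Ioc 0 S, heatDissip s g ≤ π / 2 * ∫ ξ : E3, ‖ξ‖ * ‖𝓕 g ξ‖ ^ 2 := by
  have hfin : IsFiniteMeasure (volume.restrict (Set.Ioc 0 S)) := ⟨by simp⟩
  have hc := (𝓕 g).continuous
  obtain ⟨-, hg1, hg2⟩ := integrable_norm_pow_mul_norm_sq_fourier g
  have hF : Integrable (Function.uncurry fun (s : ℝ) (ξ : E3) =>
      ‖ξ‖ ^ 2 / (1 + (s * ‖ξ‖) ^ 2) * ‖𝓕 g ξ‖ ^ 2)
      ((volume.restrict (Set.Ioc 0 S)).prod volume) := by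
    have h1 := (integrable_const (μ := volume.restrict (Set.Ioc 0 S)) (1 : ℝ)).mul_prod hg2
    refine h1.mono' ?_ (Filter.Eventually.of_forall fun p => ?_)
    · refine Continuous.aestronglyMeasurable (Continuous.mul (Continuous.div₀ (by fun_prop)
        (by fun_prop) fun ξ => by positivity) (by fun_prop))
    · rw [Function.uncurry, Real.norm_eq_abs, abs_of_nonneg (by positivity), one_mul]
      refine mul_le_mul_of_nonneg_right (div_le_self (by positivity) ?_) (by positivity)
      have := sq_nonneg (p.1 * ‖p.2‖)
      linarith
  refine ⟨hF.integral_prod_left, ?_⟩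
  simp only [heatDissip]
  rw [integral_integral_swap hF, ← integral_const_mul]
  refine integral_mono hF.integral_prod_right (hg1.const_mul _) fun ξ => ?_
  simp only [integral_mul_const]
  have h := mul_le_mul_of_nonneg_right (integral_arctan_kernel_le (norm_nonneg ξ) hS)
    (sq_nonneg ‖𝓕 g ξ‖)
  linarith

/-- The momentum of a Schwartz function in the direction away from `y`. -/
def radialMom (e : ℝ) (y : E3) (g : S3) (x : E3) : ℝ :=
  ∑ j, gradDist e j (x - y) * ((g x).re * (dS j g x).im - (g x).im * (dS j g x).re)

/-- The part of the derivative of `radialMom` along the heat flow that is not a divergence. -/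
def radialMomSource (e : ℝ) (y : E3) (s : ℝ) (g : S3) (x : E3) : ℝ :=
  2 * (∑ j, gradDist e j (x - y) * ((heatRate s g x).re * (dS j (heatFlow s g) x).im
      - (heatRate s g x).im * (dS j (heatFlow s g) x).re))
    - lapDist e (x - y) * ((heatFlow s g x).re * (heatRate s g x).im
      - (heatFlow s g x).im * (heatRate s g x).re)

theorem HasDerivAt.complex_re {f : ℝ → ℂ} {a : ℂ} {s : ℝ} (h : HasDerivAt f a s) :
    HasDerivAt (fun s => (f s).re) a.re s :=
  Complex.reCLM.hasFDerivAt.comp_hasDerivAt s h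

theorem HasDerivAt.complex_im {f : ℝ → ℂ} {a : ℂ} {s : ℝ} (h : HasDerivAt f a s) :
    HasDerivAt (fun s => (f s).im) a.im s :=
  Complex.imCLM.hasFDerivAt.comp_hasDerivAt s h

theorem Continuous.complex_re {X : Type*} [TopologicalSpace X] {f : X → ℂ} (h : Continuous f) :
    Continuous fun x => (f x).re :=
  Complex.continuous_re.comp h

theorem Continuous.complex_im {X : Type*} [TopologicalSpace X] {f : X → ℂ} (h : Continuous f) :
    Continuous fun x => (f x).im :=
  Complex.continuous_im.comp h

theorem abs_re_mul_im_sub_le (z w : ℂ) : |z.re * w.im - z.im * w.re| ≤ ‖z‖ * ‖w‖ := by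
  rw [abs_sub_comm]
  exact abs_im_mul_re_sub_le z w

theorem abs_radialMom_le {e : ℝ} (he : 0 < e) (y : E3) (g : S3) {S : ℝ} (hS : 0 < S) (x : E3) :
    |radialMom e y g x| ≤ S⁻¹ * (3 / 2 * ‖g x‖ ^ 2) + S / 2 * ∑ j, ‖dS j g x‖ ^ 2 := by
  have hj : ∀ j, |gradDist e j (x - y) * ((g x).re * (dS j g x).im - (g x).im * (dS j g x).re)|
      ≤ S⁻¹ * (1 / 2 * ‖g x‖ ^ 2) + S / 2 * ‖dS j g x‖ ^ 2 := fun j => by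
    rw [abs_mul]
    refine (mul_le_of_le_one_left (abs_nonneg _) (abs_gradDist_le he j _)).trans
      ((abs_re_mul_im_sub_le _ _).trans ?_)
    have h1 : 0 ≤ S⁻¹ * (‖g x‖ - S * ‖dS j g x‖) ^ 2 := by positivity
    have h2 : S⁻¹ * (‖g x‖ - S * ‖dS j g x‖) ^ 2
        = S⁻¹ * ‖g x‖ ^ 2 - 2 * (‖g x‖ * ‖dS j g x‖) + S * ‖dS j g x‖ ^ 2 := by
      field_simp
      ring
    linarith
  refine (Finset.abs_sum_le_sum_abs _ _).trans ((Finset.sum_le_sum fun j _ => hj j).trans_eq ?_)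
  simp only [Fin.sum_univ_three]
  ring

theorem integrable_radialMom {e : ℝ} (he : 0 < e) (y : E3) (g : S3) :
    Integrable (radialMom e y g) := by
  have h1 : Integrable fun x => 3 / 2 * ‖g x‖ ^ 2 :=
    (g.integrable_norm_pow two_ne_zero).const_mul (3 / 2)
  have h2 : Integrable fun x => ∑ j, ‖dS j g x‖ ^ 2 :=
    integrable_finsetSum _ fun j _ => (dS j g).integrable_norm_pow two_ne_zero
  refine ((h1.const_mul 1⁻¹).add (h2.const_mul (1 / 2))).mono' ?_
    (Filter.Eventually.of_forall fun x => abs_radialMom_le he y g one_pos x)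
  have h3 := g.continuous
  have h4 := fun j => (dS j g).continuous
  have h5 := fun j => continuous_gradDist he j
  unfold radialMom
  exact Continuous.aestronglyMeasurable (by fun_prop)

theorem abs_radialMomSource_le {e : ℝ} (he : 0 < e) (y : E3) (s : ℝ) (g : S3) (x : E3) :
    |radialMomSource e y s g x| ≤ 6 * ‖heatRate s g x‖ ^ 2 + ∑ j, ‖dS j (heatFlow s g) x‖ ^ 2
      + invDist e (x - y) ^ 2 * ‖heatFlow s g x‖ ^ 2 := by
  have hj : ∀ j, |gradDist e j (x - y) * ((heatRate s g x).re * (dS j (heatFlow s g) x).im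
      - (heatRate s g x).im * (dS j (heatFlow s g) x).re)|
      ≤ 1 / 2 * ‖heatRate s g x‖ ^ 2 + 1 / 2 * ‖dS j (heatFlow s g) x‖ ^ 2 := fun j => by
    rw [abs_mul]
    refine (mul_le_of_le_one_left (abs_nonneg _) (abs_gradDist_le he j _)).trans
      ((abs_re_mul_im_sub_le _ _).trans ?_)
    nlinarith [sq_nonneg (‖heatRate s g x‖ - ‖dS j (heatFlow s g) x‖)]
  have h1 := (Finset.abs_sum_le_sum_abs _ _).trans
    (Finset.sum_le_sum fun (j : Fin 3) (_ : j ∈ Finset.univ) => hj j)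
  have h2 := abs_re_mul_im_sub_le (heatFlow s g x) (heatRate s g x)
  have h3 := lapDist_le he (x - y)
  have h4 := lapDist_nonneg he (x - y)
  have h5 := invDist_pos he (x - y)
  have h6 : lapDist e (x - y) * |(heatFlow s g x).re * (heatRate s g x).im
      - (heatFlow s g x).im * (heatRate s g x).re|
      ≤ 3 * invDist e (x - y) * (‖heatFlow s g x‖ * ‖heatRate s g x‖) :=
    mul_le_mul h3 h2 (abs_nonneg _) (by positivity)
  have h7 := sq_nonneg (invDist e (x - y) * ‖heatFlow s g x‖ - 3 / 2 * ‖heatRate s g x‖)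
  refine (abs_sub _ _).trans ?_
  rw [abs_mul, abs_mul, abs_two, abs_of_nonneg h4]
  rw [Fin.sum_univ_three] at h1 ⊢
  simp only [Fin.sum_univ_three] at h1 ⊢
  nlinarith [sq_nonneg ‖heatRate s g x‖]

theorem integral_abs_radialMomSource_le {e : ℝ} (he : 0 < e) (y : E3) (s : ℝ) (g : S3) :
    Integrable (radialMomSource e y s g) ∧
      ∫ x, |radialMomSource e y s g x| ≤ (24 + 20 * π ^ 2) * heatDissip s g := by
  have h1 : Integrable fun x => 6 * ‖heatRate s g x‖ ^ 2 :=
    ((heatRate s g).integrable_norm_pow two_ne_zero).const_mul 6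
  have h2j : ∀ j, Integrable fun x => ‖dS j (heatFlow s g) x‖ ^ 2 := fun j =>
    (dS j (heatFlow s g)).integrable_norm_pow two_ne_zero
  have h2 : Integrable fun x => ∑ j, ‖dS j (heatFlow s g) x‖ ^ 2 :=
    integrable_finsetSum _ fun j _ => h2j j
  have hσ := continuous_invDist he
  have h3 : Integrable fun x => invDist e (x - y) ^ 2 * ‖heatFlow s g x‖ ^ 2 :=
    ((heatFlow s g).integrable_norm_pow two_ne_zero).bdd_mul (c := e⁻¹ ^ 2)
      (Continuous.aestronglyMeasurable (by fun_prop)) (Filter.Eventually.of_forall fun x => by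
        rw [Real.norm_eq_abs, abs_of_nonneg (sq_nonneg _)]
        exact pow_le_pow_left₀ (invDist_pos he _).le (invDist_le he _) 2)
  have hle := abs_radialMomSource_le he y s g
  have hi : Integrable (radialMomSource e y s g) := by
    refine ((h1.add h2).add h3).mono' ?_ (Filter.Eventually.of_forall hle)
    have h4 := (heatFlow s g).continuous
    have h5 := (heatRate s g).continuous
    have h6 := fun j => (dS j (heatFlow s g)).continuous
    have h7 := fun j => continuous_gradDist he j
    have h8 := continuous_lapDist he
    unfold radialMomSource
    exact Continuous.aestronglyMeasurable (by fun_prop)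
  refine ⟨hi, (integral_mono hi.abs ((h1.add h2).add h3) hle).trans ?_⟩
  rw [integral_add' (h1.add h2) h3, integral_add' h1 h2, integral_const_mul,
    integral_finsetSum _ fun j _ => h2j j]
  have k1 := integral_norm_sq_heatRate_le s g
  have k2 := sum_integral_norm_sq_dS_heatFlow_le s g
  have k3 := integral_invDist_sq_mul_le he (heatFlow s g) y
  linarith

theorem integral_radialMom_heatFlow_sub {e : ℝ} (he : 0 < e) (y : E3) (g : S3) (S : ℝ) :
    (∫ x, radialMom e y (heatFlow S g) x) - ∫ x, radialMom e y (heatFlow 0 g) x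
      = ∫ s in (0 : ℝ)..S, ∫ x, radialMomSource e y s g x := by
  set N2 : ℝ := ∫ ξ : E3, ‖ξ‖ ^ 2 * ‖𝓕 g ξ‖ ^ 2
  set N0 : ℝ := ∫ ξ : E3, ‖𝓕 g ξ‖ ^ 2
  have hN2 : 0 ≤ N2 := integral_nonneg fun ξ => by positivity
  have hN0 : 0 ≤ N0 := integral_nonneg fun ξ => by positivity
  have hF := continuous_heatFlow g
  have hR := continuous_heatRate g
  have hFj : ∀ j, Continuous fun p : ℝ × E3 => dS j (heatFlow p.1 g) p.2 := fun j => by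
    simpa only [dS_heatFlow] using continuous_heatFlow (dS j g)
  have hRj : ∀ j, Continuous fun p : ℝ × E3 => dS j (heatRate p.1 g) p.2 := fun j => by
    simpa only [dS_heatRate] using continuous_heatRate (dS j g)
  have ha : ∀ j, Continuous fun p : ℝ × E3 => gradDist e j (p.2 - y) := fun j =>
    (continuous_gradDist he j).comp (continuous_snd.sub continuous_const)
  have hax : ∀ j, Continuous fun x : E3 => gradDist e j (x - y) := fun j =>
    (continuous_gradDist he j).comp (continuous_sub_right y)
  refine integral_sub_integral_of_conservation_law (volume : Measure E3)
    (fun j : Fin 3 => EuclideanSpace.single j 1)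
    (q := fun s x => radialMom e y (heatFlow s g) x)
    (q' := fun s x => ∑ j, gradDist e j (x - y) *
      (((heatRate s g x).re * (dS j (heatFlow s g) x).im
        + (heatFlow s g x).re * (dS j (heatRate s g) x).im)
      - ((heatRate s g x).im * (dS j (heatFlow s g) x).re
        + (heatFlow s g x).im * (dS j (heatRate s g) x).re)))
    (r := fun s x => radialMomSource e y s g x)
    (V := fun j s x => gradDist e j (x - y) * ((heatFlow s g x).re * (heatRate s g x).im
      - (heatFlow s g x).im * (heatRate s g x).re))
    (V' := fun j s x => hessDist e j j (x - y) * ((heatFlow s g x).re * (heatRate s g x).im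
        - (heatFlow s g x).im * (heatRate s g x).re)
      + gradDist e j (x - y) *
        (((dS j (heatFlow s g) x).re * (heatRate s g x).im
          + (heatFlow s g x).re * (dS j (heatRate s g) x).im)
        - ((dS j (heatFlow s g) x).im * (heatRate s g x).re
          + (heatFlow s g x).im * (dS j (heatRate s g) x).re)))
    (K := (24 + 20 * π ^ 2) * N2 + N0)
    ?_ ?_ ?_ ?_ ?_ ?_ ?_ (integrable_radialMom he y _) (integrable_radialMom he y _) ?_ ?_ ?_
  · simp only [Function.uncurry_def, radialMom]
    exact continuous_finsetSum _ fun j _ => (ha j).mul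
      ((hF.complex_re.mul (hFj j).complex_im).sub (hF.complex_im.mul (hFj j).complex_re))
  · simp only [Function.uncurry_def]
    exact continuous_finsetSum _ fun j _ => (ha j).mul
      (((hR.complex_re.mul (hFj j).complex_im).add (hF.complex_re.mul (hRj j).complex_im)).sub
        ((hR.complex_im.mul (hFj j).complex_re).add (hF.complex_im.mul (hRj j).complex_re)))
  · intro s x
    refine HasDerivAt.fun_sum fun j _ => HasDerivAt.const_mul _ ?_
    have h1 := hasDerivAt_heatFlow g x s
    have h2 := hasDerivAt_heatFlow (dS j g) x s
    simp only [dS_heatFlow, dS_heatRate]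
    exact (h1.complex_re.mul h2.complex_im).sub (h1.complex_im.mul h2.complex_re)
  · intro j s _
    have h1 := (heatFlow s g).continuous
    have h2 := (heatRate s g).continuous
    exact (hax j).mul ((h1.complex_re.mul h2.complex_im).sub (h1.complex_im.mul h2.complex_re))
  · intro j s _
    have h1 := (heatFlow s g).continuous
    have h2 := (heatRate s g).continuous
    have h3 := (dS j (heatFlow s g)).continuous
    have h4 := (dS j (heatRate s g)).continuous
    have h5 : Continuous fun x => hessDist e j j (x - y) :=
      (continuous_hessDist he j j).comp (continuous_sub_right y)
    exact (h5.mul ((h1.complex_re.mul h2.complex_im).sub (h1.complex_im.mul h2.complex_re))).add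
      ((hax j).mul (((h3.complex_re.mul h2.complex_im).add (h1.complex_re.mul h4.complex_im)).sub
        ((h3.complex_im.mul h2.complex_re).add (h1.complex_im.mul h4.complex_re))))
  · intro j s _ x
    have h1 := hasLineDerivAt_dS j (heatFlow s g) x
    have h2 := hasLineDerivAt_dS j (heatRate s g) x
    have h3 := (hasLineDerivAt_gradDist he (x - y) j j).comp_sub_right
    exact hasLineDerivAt_mul h3 (hasLineDerivAt_sub
      (hasLineDerivAt_mul (hasLineDerivAt_re h1) (hasLineDerivAt_im h2))
      (hasLineDerivAt_mul (hasLineDerivAt_im h1) (hasLineDerivAt_re h2)))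
  · intro s _ x
    simp only [radialMomSource, ← sum_hessDist he (x - y), Fin.sum_univ_three]
    ring
  · exact fun s _ => (integral_abs_radialMomSource_le he y s g).1
  · intro s _
    have h1 := (integral_abs_radialMomSource_le he y s g).2
    have h2 := mul_le_mul_of_nonneg_left (heatDissip_le s g)
      (by positivity : 0 ≤ 24 + 20 * π ^ 2)
    simp only [Real.norm_eq_abs]
    linarith
  · intro j s _ R hR1
    have h1 : Integrable fun x => ‖heatFlow s g x‖ ^ 2 :=
      (heatFlow s g).integrable_norm_pow two_ne_zero
    have h2 : Integrable fun x => ‖heatRate s g x‖ ^ 2 :=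
      (heatRate s g).integrable_norm_pow two_ne_zero
    have h3 : ∫ x in Metric.ball (0 : E3) (2 * R), ‖gradDist e j (x - y)
        * ((heatFlow s g x).re * (heatRate s g x).im
          - (heatFlow s g x).im * (heatRate s g x).re)‖
        ≤ ∫ x, (‖heatFlow s g x‖ ^ 2 + ‖heatRate s g x‖ ^ 2) := by
      refine setIntegral_le_integral_of_norm_le (h1.add h2) fun x => ?_
      rw [Real.norm_eq_abs, abs_mul]
      refine (mul_le_of_le_one_left (abs_nonneg _) (abs_gradDist_le he j _)).trans
        ((abs_re_mul_im_sub_le _ _).trans ?_)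
      nlinarith [sq_nonneg (‖heatFlow s g x‖ - ‖heatRate s g x‖)]
    rw [integral_add h1 h2] at h3
    have k1 := integral_norm_sq_heatFlow_le s g
    have k2 := integral_norm_sq_heatRate_le s g
    have k3 := heatDissip_le s g
    have k4 : 1 ≤ R ^ (3/4 : ℝ) := one_le_rpow_three_fourths hR1
    have k5 : 0 ≤ (20 + 20 * π ^ 2) * N2 := by positivity
    have k6 : 0 ≤ (24 + 20 * π ^ 2) * N2 + N0 := by positivity
    refine h3.trans (le_trans ?_ (le_mul_of_one_le_right k6 k4))
    linarith

/-- The radial momentum is bounded by the homogeneous Sobolev norm of order one half. -/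
theorem abs_integral_radialMom_le {e : ℝ} (he : 0 < e) (y : E3) (g : S3) :
    |∫ x, radialMom e y g x| ≤ (24 + 20 * π ^ 2) * (π / 2) * ∫ ξ : E3, ‖ξ‖ * ‖𝓕 g ξ‖ ^ 2 := by
  set N0 : ℝ := ∫ ξ : E3, ‖𝓕 g ξ‖ ^ 2
  have hbound : ∀ S : ℝ, 0 < S → |∫ x, radialMom e y g x|
      ≤ (24 + 20 * π ^ 2) * (π / 2) * (∫ ξ : E3, ‖ξ‖ * ‖𝓕 g ξ‖ ^ 2)
        + S⁻¹ * ((3 / 2 + 2 * π ^ 2) * N0) := fun S hS => by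
    have h0 := integral_radialMom_heatFlow_sub he y g S
    have hz : heatFlow 0 g = g := by
      rw [heatFlow]
      simp [gaussFlow_zero]
    rw [hz] at h0
    have h1 : |∫ s in (0 : ℝ)..S, ∫ x, radialMomSource e y s g x|
        ≤ (24 + 20 * π ^ 2) * (π / 2 * ∫ ξ : E3, ‖ξ‖ * ‖𝓕 g ξ‖ ^ 2) := by
      rw [intervalIntegral.integral_of_le hS.le, ← Real.norm_eq_abs]
      obtain ⟨k1, k2⟩ := integral_heatDissip_le g hS.le
      refine (norm_integral_le_of_norm_le (k1.const_mul (24 + 20 * π ^ 2))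
        (Filter.Eventually.of_forall fun s => ?_)).trans ?_
      · exact (norm_integral_le_integral_norm _).trans
          (integral_abs_radialMomSource_le he y s g).2
      · rw [integral_const_mul]
        exact mul_le_mul_of_nonneg_left k2 (by positivity)
    have h2 : |∫ x, radialMom e y (heatFlow S g) x| ≤ S⁻¹ * ((3 / 2 + 2 * π ^ 2) * N0) := by
      have i1 : Integrable fun x => ‖heatFlow S g x‖ ^ 2 :=
        (heatFlow S g).integrable_norm_pow two_ne_zero
      have i2 : ∀ j, Integrable fun x => ‖dS j (heatFlow S g) x‖ ^ 2 := fun j =>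
        (dS j (heatFlow S g)).integrable_norm_pow two_ne_zero
      have i3 := integrable_finsetSum Finset.univ fun j _ => i2 j
      rw [← Real.norm_eq_abs]
      refine (norm_integral_le_of_norm_le (((i1.const_mul (3 / 2)).const_mul S⁻¹).add
        (i3.const_mul (S / 2))) (Filter.Eventually.of_forall
          (abs_radialMom_le he y (heatFlow S g) hS))).trans ?_
      rw [integral_add' ((i1.const_mul (3 / 2)).const_mul S⁻¹) (i3.const_mul (S / 2)),
        integral_const_mul, integral_const_mul, integral_const_mul,
        integral_finsetSum _ fun j _ => i2 j]
      have k1 := integral_norm_sq_heatFlow_le S g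
      have k2 := sq_mul_sum_integral_norm_sq_dS_heatFlow_le S g
      have k3 := mul_le_mul_of_nonneg_left k1 (by positivity : 0 ≤ S⁻¹ * (3 / 2))
      have k4 := mul_le_mul_of_nonneg_left k2 (by positivity : 0 ≤ S⁻¹ / 2)
      have k5 : S⁻¹ / 2 * (S ^ 2 * ∑ j, ∫ x, ‖dS j (heatFlow S g) x‖ ^ 2)
          = S / 2 * ∑ j, ∫ x, ‖dS j (heatFlow S g) x‖ ^ 2 := by
        field_simp
      rw [k5] at k4
      linarith
    have h3 : ∫ x, radialMom e y g x = (∫ x, radialMom e y (heatFlow S g) x)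
        - ∫ s in (0 : ℝ)..S, ∫ x, radialMomSource e y s g x := by
      linarith
    rw [h3]
    refine (abs_sub _ _).trans ?_
    linarith
  have hlim : Filter.Tendsto (fun S : ℝ =>
      (24 + 20 * π ^ 2) * (π / 2) * (∫ ξ : E3, ‖ξ‖ * ‖𝓕 g ξ‖ ^ 2)
        + S⁻¹ * ((3 / 2 + 2 * π ^ 2) * N0)) Filter.atTop
      (𝓝 ((24 + 20 * π ^ 2) * (π / 2) * (∫ ξ : E3, ‖ξ‖ * ‖𝓕 g ξ‖ ^ 2)
        + 0 * ((3 / 2 + 2 * π ^ 2) * N0))) :=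
    tendsto_const_nhds.add (tendsto_inv_atTop_zero.mul_const _)
  rw [zero_mul, add_zero] at hlim
  exact ge_of_tendsto hlim ((Filter.eventually_gt_atTop 0).mono hbound)

theorem L2Norm_sq (f : E3 → ℂ) : L2Norm f ^ 2 = ∫ x, ‖f x‖ ^ 2 := by
  rw [L2Norm, ← Real.sqrt_eq_rpow, Real.sq_sqrt (integral_nonneg fun x => by positivity)]

theorem HdotNorm_half_sq (g : S3) : HdotNorm (1/2) g ^ 2 = ∫ ξ : E3, ‖ξ‖ * ‖𝓕 g ξ‖ ^ 2 := by
  rw [HdotNorm, ← Real.sqrt_eq_rpow, Real.sq_sqrt (integral_nonneg fun ξ => by positivity)]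
  norm_num [SchwartzMap.fourier_coe]

theorem RegBound.integral_norm_mul_norm_sq_fourier_le {g : S3} {K : ℝ} (h : RegBound g K) :
    ∫ ξ : E3, ‖ξ‖ * ‖𝓕 g ξ‖ ^ 2 ≤ 7 * K := by
  obtain ⟨h0, h1, h2⟩ := integrable_norm_pow_mul_norm_sq_fourier g
  have hj : ∀ j, Integrable fun ξ : E3 => ‖𝓕 (dS j g) ξ‖ ^ 2 := fun j =>
    (𝓕 (dS j g)).integrable_norm_pow two_ne_zero
  have hs := integrable_finsetSum Finset.univ fun j _ => hj j
  have hle : ∀ ξ : E3, ‖ξ‖ * ‖𝓕 g ξ‖ ^ 2 ≤ ‖𝓕 g ξ‖ ^ 2 + ∑ j, ‖𝓕 (dS j g) ξ‖ ^ 2 := fun ξ => by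
    rw [sum_norm_sq_fourier_dS]
    have hπ : 1 ≤ 4 * π ^ 2 := by nlinarith [Real.pi_gt_three]
    have k1 : ‖ξ‖ ≤ 1 + 4 * π ^ 2 * ‖ξ‖ ^ 2 := by
      nlinarith [sq_nonneg (‖ξ‖ - 1 / 2), sq_nonneg ‖ξ‖]
    nlinarith [mul_le_mul_of_nonneg_right k1 (sq_nonneg ‖𝓕 g ξ‖)]
  refine (integral_mono h1 (h0.add hs) hle).trans ?_
  rw [integral_add' h0 hs, integral_finsetSum _ fun j _ => hj j]
  simp only [SchwartzMap.integral_norm_sq_fourier]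
  have k := Finset.sum_le_sum fun (j : Fin 3) (_ : j ∈ Finset.univ) => h.integral_sq_dS_le j
  simp only [Finset.sum_const, Finset.card_univ, Fintype.card_fin, nsmul_eq_mul] at k
  push_cast at k
  linarith [h.mass]

theorem le_biSup_of_forall_le {s : Set ℝ} {f : ℝ → ℝ} {B : ℝ} (hB : 0 ≤ B)
    (hf : ∀ t ∈ s, f t ≤ B) {t : ℝ} (ht : t ∈ s) : f t ≤ ⨆ t ∈ s, f t := by
  have hb : BddAbove (Set.range fun t => ⨆ _ : t ∈ s, f t) := by
    refine ⟨B, ?_⟩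
    rintro _ ⟨t, rfl⟩
    exact Real.iSup_le (fun h => hf t h) hB
  refine le_trans ?_ (le_ciSup hb t)
  rw [ciSup_pos ht]

namespace SchwartzSolution

variable {T : ℝ} {u : ℝ → E3 → ℂ} {U : ℝ → S3}

theorem HdotNorm_half_sq_le_iSup (h : SchwartzSolution T u U) {t : ℝ} (ht : t ∈ Set.Icc 0 T) :
    HdotNorm (1/2) (u t) ^ 2 ≤ ⨆ t ∈ Set.Icc (0:ℝ) T, HdotNorm (1/2) (u t) ^ 2 := by
  obtain ⟨K, hK⟩ := h.exists_forall_regBound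
  refine le_biSup_of_forall_le (f := fun t => HdotNorm (1/2) (u t) ^ 2) (B := 7 * K)
    (mul_nonneg (by norm_num) (hK t ht).nonneg) (fun s hs => ?_) ht
  simp only [h.coe s hs, HdotNorm_half_sq]
  exact (hK s hs).integral_norm_mul_norm_sq_fourier_le

theorem abs_integral_virialDens_le (h : SchwartzSolution T u U) {e : ℝ} (he : 0 < e) {t : ℝ}
    (ht : t ∈ Set.Icc 0 T) (y : E3) : |∫ x, virialDens e u y t x|
      ≤ (24 + 20 * π ^ 2) * (π / 2) * HdotNorm (1/2) (u t) ^ 2 := by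
  have hv : virialDens e u y t = radialMom e y (U t) := by
    ext x
    simp only [virialDens, momDens, radialMom, h.coe t ht, h.px_coe ht]
  rw [hv, h.coe t ht, HdotNorm_half_sq]
  exact abs_integral_radialMom_le he y (U t)

theorem integral_massDens_eq (h : SchwartzSolution T u U) {t : ℝ} (ht : t ∈ Set.Icc 0 T) :
    ∫ x, massDens u t x = L2Norm (u 0) ^ 2 := by
  obtain ⟨K, hK⟩ := h.exists_forall_regBound
  have h0 : (0:ℝ) ∈ Set.Icc 0 T := ⟨le_rfl, ht.1.trans ht.2⟩
  have hsub : Set.uIcc 0 t ⊆ Set.Icc 0 T := Set.uIcc_subset_Icc h0 ht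
  simp only [L2Norm_sq, massDens_eq, h.coe t ht, h.coe 0 h0]
  exact h.mass_eq hsub fun s hs => hK s (hsub hs)

end SchwartzSolution

/-- The interaction Morawetz estimate for the cubic defocusing NLS on `ℝ³`. -/
theorem interaction_morawetz_3d :
    ∃ C > (0:ℝ), ∀ T > (0:ℝ), ∀ u : ℝ → EuclideanSpace ℝ (Fin 3) → ℂ,
      IsNLSSolution 3 T u →
      (∫ t in Set.Ioc (0:ℝ) T, ∫ x, ‖u t x‖ ^ 4)
        ≤ C * (⨆ t ∈ Set.Icc (0:ℝ) T, (HdotNorm (1/2) (u t)) ^ 2) * (L2Norm (u 0)) ^ 2 := by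
  set V := volume.real (Metric.ball (0 : E3) 1)
  have hV : 0 < V := ENNReal.toReal_pos (Metric.measure_ball_pos _ _ one_pos).ne'
    measure_ball_lt_top.ne
  set A : ℝ := (24 + 20 * π ^ 2) * (π / 2)
  have hA : 0 < A := by positivity
  refine ⟨64 * (4 / 15 * A) / V, by positivity, fun T hT u hu => ?_⟩
  obtain ⟨U, h⟩ := hu.exists_schwartzSolution
  obtain ⟨K, hK⟩ := h.exists_forall_regBound
  set S : ℝ := ⨆ t ∈ Set.Icc (0:ℝ) T, HdotNorm (1/2) (u t) ^ 2
  have h0T : (0:ℝ) ∈ Set.Icc 0 T := ⟨le_rfl, hT.le⟩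
  have hTT : T ∈ Set.Icc 0 T := ⟨hT.le, le_rfl⟩
  have hS : 0 ≤ S := (sq_nonneg _).trans (h.HdotNorm_half_sq_le_iSup h0T)
  have hI : ∀ e, 0 < e → ∀ t ∈ Set.Icc 0 T, |∫ p, interDens e u t p| ≤ A * S * L2Norm (u 0) ^ 2 :=
    fun e he t ht => by
      rw [← h.integral_massDens_eq ht]
      exact h.abs_integral_interDens_le he ht fun y => (h.abs_integral_virialDens_le he ht y).trans
        (mul_le_mul_of_nonneg_left (h.HdotNorm_half_sq_le_iSup ht) hA.le)
  have hmain := integral_diagDens_time_le h.smooth (B := 4 / 15 * (A * S * L2Norm (u 0) ^ 2))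
    (by positivity) (fun t ht => h.integrable_pow_four ht)
    (fun e he t ht => (h.integral_diagDens_le he ht).1)
    (fun e he => (h.integral_diagDens_le_sub hT he hK).1) fun e he => by
      have k1 := (h.integral_diagDens_le_sub hT he hK).2
      have k2 := abs_le.1 (hI e he T hTT)
      have k3 := abs_le.1 (hI e he 0 h0T)
      linarith [k2.2, k3.1]
  rw [div_mul_eq_mul_div, div_mul_eq_mul_div, le_div_iff₀ hV]
  linarith

end
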